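/- Let Ω be a bounded domain of an n-dimensional Alexandrov space with curvature ≥ k, let p > 1, Y a complete metric space, and u ∈ W^{1,p}(Ω,Y). Fix any sufficiently small δ with 0 < δ < δ_{n,k}. Then for any open subset B ⊂⊂ Ω^δ there exists a constant ε̄ = ε̄(δ,B) such that for all 0 < ε < ε̄(δ,B), ∫_B | e^u_{p,ε}(x) − |∇u|_p(x) | dvol(x) ≤ κ̄(δ), where κ̄(δ) is a positive function depending only on δ with κ̄(δ) → 0 as δ → 0. -/

import Mathlib

open MeasureTheory Metric Filter Set Asymptotics
open scoped Topology ENNReal NNReal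

noncomputable section

namespace Paper

/-- A unit-speed geodesic of length `L`. -/
def IsUnitGeodesic {M : Type*} [MetricSpace M] (γ : ℝ → M) (L : ℝ) : Prop :=
  0 ≤ L ∧ ∀ s ∈ Set.Icc (0:ℝ) L, ∀ t ∈ Set.Icc (0:ℝ) L, dist (γ s) (γ t) = |s - t|

/-- A geodesic metric space: every pair of points is joined by a unit-speed
shortest geodesic. -/
def GeodesicSpace (M : Type*) [MetricSpace M] : Prop :=
  ∀ x y : M, ∃ γ : ℝ → M, IsUnitGeodesic γ (dist x y) ∧ γ 0 = x ∧ γ (dist x y) = y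

/-- The comparison angle `∠̃_k` in the model plane `𝕄²_k` at the vertex between two
sides of lengths `a`, `b` whose opposite side has length `c`, given by the law of
cosines in the model plane of constant curvature `k`. -/
def cmpAngle (k a b c : ℝ) : ℝ :=
  if k = 0 then Real.arccos ((a ^ 2 + b ^ 2 - c ^ 2) / (2 * a * b))
  else if k < 0 then
    Real.arccos ((Real.cosh (Real.sqrt (-k) * a) * Real.cosh (Real.sqrt (-k) * b) -
        Real.cosh (Real.sqrt (-k) * c)) /
      (Real.sinh (Real.sqrt (-k) * a) * Real.sinh (Real.sqrt (-k) * b)))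
  else
    Real.arccos ((Real.cos (Real.sqrt k * c) -
        Real.cos (Real.sqrt k * a) * Real.cos (Real.sqrt k * b)) /
      (Real.sin (Real.sqrt k * a) * Real.sin (Real.sqrt k * b)))

/-- A (complete, locally compact) geodesic space has curvature `≥ k` in the sense of
Alexandrov: near every point, comparison angles along pairs of geodesics issuing from a common
point are non-increasing in each of the two parameters. -/
structure CurvBddBelow (M : Type*) [MetricSpace M] (k : ℝ) : Prop where
  locallyCompact : LocallyCompactSpace M
  geodesic : GeodesicSpace M
  comparison : ∀ x : M, ∃ U ∈ 𝓝 x,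
    ∀ (p : M) (γ σ : ℝ → M) (L₁ L₂ : ℝ),
      IsUnitGeodesic γ L₁ → IsUnitGeodesic σ L₂ →
      (∀ s ∈ Set.Icc (0:ℝ) L₁, γ s ∈ U) → (∀ t ∈ Set.Icc (0:ℝ) L₂, σ t ∈ U) →
      γ 0 = p → σ 0 = p →
      ∀ s t s' t' : ℝ, 0 < s → s ≤ s' → s' ≤ L₁ → 0 < t → t ≤ t' → t' ≤ L₂ →
        cmpAngle k s' t' (dist (γ s') (σ t')) ≤ cmpAngle k s t (dist (γ s) (σ t))

/-- An `n`-dimensional Alexandrov space with curvature `≥ k` (without boundary);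
its Hausdorff dimension equals `n` and it carries the `n`-dimensional Hausdorff
measure `μH[n]` as its volume. -/
structure AlexandrovSpace (M : Type*) [MetricSpace M] (n : ℕ) (k : ℝ) : Prop where
  curv : CurvBddBelow M k
  dim : dimH (Set.univ : Set M) = n

/-- An NPC space: a complete geodesic space which is globally non-positively curved in
the sense of Alexandrov (CAT(0)); the comparison inequality `d(P,S) ≤ |P̄S̄|` for the
midpoint `S` of the side `QR` is expressed through the Euclidean median formula. -/
structure NPCSpace (Y : Type*) [MetricSpace Y] : Prop where
  complete : CompleteSpace Y
  geodesic : GeodesicSpace Y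
  cat0 : ∀ p q r m : Y, dist q m = dist q r / 2 → dist r m = dist q r / 2 →
    dist p m ^ 2 ≤ (dist p q ^ 2 + dist p r ^ 2) / 2 - dist q r ^ 2 / 4

/-- `Lip_0(Ω)`: Lipschitz functions with compact support contained in `Ω`. -/
def IsLip0 {M : Type*} [MetricSpace M] (Ω : Set M) (φ : M → ℝ) : Prop :=
  (∃ c : ℝ≥0, LipschitzWith c φ) ∧ IsCompact (tsupport φ) ∧ tsupport φ ⊆ Ω

/-- `C_0(Ω)`: continuous functions with compact support contained in `Ω`. -/
def IsC0 {M : Type*} [MetricSpace M] (Ω : Set M) (φ : M → ℝ) : Prop :=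
  Continuous φ ∧ IsCompact (tsupport φ) ∧ tsupport φ ⊆ Ω

/-- `A ⊂⊂ B` : `A` is compactly contained in `B`. -/
def CptIn {M : Type*} [TopologicalSpace M] (A B : Set M) : Prop :=
  IsCompact (closure A) ∧ closure A ⊆ B

/-- An abstract first-order Sobolev calculus on the metric measure space `(M, d, μ)`:
it records the Sobolev spaces `W^{1,2}(Ω)`, `W^{1,2}_0(Ω)` and the pointwise inner
product of weak gradients `⟨∇f, ∇g⟩`, with the basic compatibility properties. -/
structure SobolevFramework (M : Type*) [MetricSpace M] [MeasurableSpace M]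
    (μ : Measure M) where
  memW12 : Set M → (M → ℝ) → Prop
  memW12_0 : Set M → (M → ℝ) → Prop
  innerGrad : (M → ℝ) → (M → ℝ) → M → ℝ
  innerGrad_symm : ∀ f g, innerGrad f g = innerGrad g f
  innerGrad_add_left : ∀ f g h, innerGrad (f + g) h = innerGrad f h + innerGrad g h
  innerGrad_smul_left : ∀ (c : ℝ) (f g : M → ℝ),
    innerGrad (fun x => c * f x) g = fun x => c * innerGrad f g x
  innerGrad_nonneg : ∀ f x, 0 ≤ innerGrad f f x
  innerGrad_lip_le : ∀ (f : M → ℝ) (c : ℝ≥0), LipschitzWith c f →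
    ∀ x, innerGrad f f x ≤ (c : ℝ) ^ 2
  lip_memW12 : ∀ (Ω : Set M) (f : M → ℝ), Bornology.IsBounded Ω →
    (∃ c : ℝ≥0, LipschitzWith c f) → memW12 Ω f
  lip0_memW12_0 : ∀ (Ω : Set M) (f : M → ℝ), IsLip0 Ω f → memW12_0 Ω f
  memW12_0_sub : ∀ (Ω : Set M) (f : M → ℝ), memW12_0 Ω f → memW12 Ω f

variable {M : Type*} [MetricSpace M] [MeasurableSpace M] {μ : Measure M}

/-- `f ∈ W^{1,2}_loc(Ω)`. -/
def memW12loc (F : SobolevFramework M μ) (Ω : Set M) (f : M → ℝ) : Prop :=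
  ∀ Ω' : Set M, IsOpen Ω' → CptIn Ω' Ω → F.memW12 Ω' f

/-- `f` is a super-solution of the Poisson equation `𝓛_f = h·vol` on `Ω`:
`𝓛_f(φ) = -∫_Ω ⟨∇f,∇φ⟩ ≤ ∫_Ω hφ` for all nonnegative `φ ∈ Lip_0(Ω)`. -/
def IsSupersolution (F : SobolevFramework M μ) (Ω : Set M) (f h : M → ℝ) : Prop :=
  ∀ φ : M → ℝ, IsLip0 Ω φ → (∀ x, 0 ≤ φ x) →
    -∫ x in Ω, F.innerGrad f φ x ∂μ ≤ ∫ x in Ω, h x * φ x ∂μ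

/-- `f` is a sub-solution of the Poisson equation `𝓛_f = h·vol` on `Ω`. -/
def IsSubsolution (F : SobolevFramework M μ) (Ω : Set M) (f h : M → ℝ) : Prop :=
  ∀ φ : M → ℝ, IsLip0 Ω φ → (∀ x, 0 ≤ φ x) →
    ∫ x in Ω, h x * φ x ∂μ ≤ -∫ x in Ω, F.innerGrad f φ x ∂μ

/-- `f` is a weak solution of `𝓛_f = h·vol` on `Ω`. -/
def IsWeakSolution (F : SobolevFramework M μ) (Ω : Set M) (f h : M → ℝ) : Prop :=
  IsSupersolution F Ω f h ∧ IsSubsolution F Ω f h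

/-- The normalizing constant `c_{n,p} = ∫_{𝕊^{n-1}} |x¹|^p dσ
    = 2 π^{(n-1)/2} Γ((p+1)/2) / Γ((n+p)/2)`. -/
def cnp (n : ℕ) (p : ℝ) : ℝ :=
  2 * Real.pi ^ (((n : ℝ) - 1) / 2) * Real.Gamma ((p + 1) / 2) /
    Real.Gamma (((n : ℝ) + p) / 2)

/-- `ω_{n-1}`, the volume of the standard unit sphere `𝕊^{n-1} ⊂ ℝⁿ`. -/
def sphereVol (n : ℕ) : ℝ := 2 * Real.pi ^ ((n : ℝ) / 2) / Real.Gamma ((n : ℝ) / 2)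

variable {Y : Type*} [MetricSpace Y]

/-- The approximating energy density
`e^u_{p,ε}(x) = ((n+p)/(c_{n,p} ε^{n+p})) ∫_{B_x(ε)∩Ω} d_Y^p(u(x),u(y)) dμ(y)`. -/
def ksDensity (n : ℕ) (p : ℝ) (μ : Measure M) (Ω : Set M) (u : M → Y) (ε : ℝ)
    (x : M) : ℝ :=
  ((n : ℝ) + p) / (cnp n p * ε ^ ((n : ℝ) + p)) *
    ∫ y in Metric.ball x ε ∩ Ω, dist (u x) (u y) ^ p ∂μ

/-- The approximating energy `E^u_{p,ε}(φ) = ∫_Ω φ e^u_{p,ε} dμ`. -/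
def ksApproxEnergy (n : ℕ) (p : ℝ) (μ : Measure M) (Ω : Set M) (u : M → Y)
    (φ : M → ℝ) (ε : ℝ) : ℝ :=
  ∫ x in Ω, φ x * ksDensity n p μ Ω u ε x ∂μ

/-- Membership in the Korevaar-Schoen type Sobolev space `W^{1,p}(Ω,Y)`:
`u ∈ L^p(Ω,Y)` is Borel with separable range, the energy functional
`E^u_p(φ) = lim_{ε→0⁺} E^u_{p,ε}(φ)` exists for every `φ ∈ C_0(Ω)`, and the total
energy `sup {E^u_p(φ) : φ ∈ C_0(Ω), 0 ≤ φ ≤ 1}` is finite. -/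
def MemKS (n : ℕ) (p : ℝ) (μ : Measure M) (Ω : Set M) (u : M → Y) : Prop :=
  (∀ P : Y, Measurable fun x => dist (u x) P) ∧
  TopologicalSpace.IsSeparable (Set.range u) ∧
  (∃ P : Y, IntegrableOn (fun x => dist (u x) P ^ p) Ω μ) ∧
  (∀ φ : M → ℝ, IsC0 Ω φ → ∃ e : ℝ,
    Tendsto (fun ε => ksApproxEnergy n p μ Ω u φ ε) (𝓝[>] (0:ℝ)) (𝓝 e)) ∧
  ∃ C : ℝ, ∀ (φ : M → ℝ) (e : ℝ), IsC0 Ω φ → (∀ x, 0 ≤ φ x ∧ φ x ≤ 1) →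
    Tendsto (fun ε => ksApproxEnergy n p μ Ω u φ ε) (𝓝[>] (0:ℝ)) (𝓝 e) → e ≤ C

/-- The total energy `E^u_p = sup {E^u_p(φ) : φ ∈ C_0(Ω), 0 ≤ φ ≤ 1}`. -/
def ksEnergy (n : ℕ) (p : ℝ) (μ : Measure M) (Ω : Set M) (u : M → Y) : ℝ :=
  sSup { e : ℝ | ∃ φ : M → ℝ, IsC0 Ω φ ∧ (∀ x, 0 ≤ φ x ∧ φ x ≤ 1) ∧
    Tendsto (fun ε => ksApproxEnergy n p μ Ω u φ ε) (𝓝[>] (0:ℝ)) (𝓝 e) }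

/-- `ν` is the (finite Borel) energy measure `E^u_p` of `u` on `Ω`:
`E^u_{p,ε}(φ) → ∫ φ dν` for every nonnegative `φ ∈ C_0(Ω)`. -/
def IsEnergyMeasure (n : ℕ) (p : ℝ) (μ : Measure M) (Ω : Set M) (u : M → Y)
    (ν : Measure M) : Prop :=
  IsFiniteMeasure ν ∧
  ∀ φ : M → ℝ, IsC0 Ω φ → (∀ x, 0 ≤ φ x) →
    Tendsto (fun ε => ksApproxEnergy n p μ Ω u φ ε) (𝓝[>] (0:ℝ)) (𝓝 (∫ x, φ x ∂ν))

/-- `|∇u|_p`, the density of the absolutely continuous part of the energy measure `ν`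
with respect to `μ` (the Radon–Nikodym derivative). -/
def ksDens (μ ν : Measure M) (x : M) : ℝ := (ν.rnDeriv μ x).toReal

/-- `u` is a harmonic map: `u ∈ W^{1,2}(Ω,Y)` minimizes the energy `E^w_2` among all
`w ∈ W^{1,2}(Ω,Y)` with `d_Y(w(·),u(·)) ∈ W^{1,2}_0(Ω)`. -/
def IsHarmonicMap (F : SobolevFramework M μ) (n : ℕ) (Ω : Set M) (u : M → Y) : Prop :=
  MemKS n 2 μ Ω u ∧
  ∀ w : M → Y, MemKS n 2 μ Ω w → F.memW12_0 Ω (fun x => dist (w x) (u x)) →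
    ksEnergy n 2 μ Ω u ≤ ksEnergy n 2 μ Ω w

/-- The oscillation `osc_A u = max_{x,y ∈ A} d_Y(u(x),u(y))`. -/
def oscOn (u : M → Y) (A : Set M) : ℝ :=
  sSup { d : ℝ | ∃ x ∈ A, ∃ y ∈ A, d = dist (u x) (u y) }

/-- The pointwise Lipschitz constant `Lip u(x) = limsup_{y→x} d_Y(u(x),u(y))/|xy|`. -/
def pLipMap (u : M → Y) (x : M) : ℝ :=
  Filter.limsup (fun y => dist (u x) (u y) / dist x y) (𝓝[≠] x)

/-- The volume `vol(Σ_x)` of the space of directions at `x`, recovered as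
`lim_{r→0⁺} n · vol(B_x(r)) / rⁿ`. -/
def dirVolume (μ : Measure M) (n : ℕ) (x : M) : ℝ :=
  limUnder (𝓝[>] (0:ℝ)) (fun r => (n : ℝ) * (μ (Metric.ball x r)).toReal / r ^ n)

/-- The model function `s_k`. -/
def snk (k r : ℝ) : ℝ :=
  if k < 0 then Real.sinh (Real.sqrt (-k) * r) / Real.sqrt (-k)
  else if k = 0 then r
  else Real.sin (Real.sqrt k * r) / Real.sqrt k

/-- The set `M^δ = {x : vol(Σ_x) > (1-δ)·vol(𝕊^{n-1})}` of `δ`-regular points. -/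
def Mdelta (μ : Measure M) (n : ℕ) (δ : ℝ) : Set M :=
  { x : M | (1 - δ) * sphereVol n < dirVolume μ n x }

/-- The auxiliary function
`f_t(x,λ) = inf_{y∈Ω'} { e^{-2nkλ} |xy|²/(2t) - d_Y(u(x),u(y)) }`. -/
def auxF (n : ℕ) (k : ℝ) (u : M → Y) (Ω' : Set M) (t : ℝ) (x : M) (l : ℝ) : ℝ :=
  sInf { v : ℝ | ∃ y ∈ Ω',
    v = Real.exp (-2 * (n : ℝ) * k * l) * dist x y ^ 2 / (2 * t) - dist (u x) (u y) }

/-- The set `S_t(x,λ)` of points realizing the infimum defining `f_t(x,λ)`. -/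
def auxS (n : ℕ) (k : ℝ) (u : M → Y) (Ω' : Set M) (t : ℝ) (l : ℝ) (x : M) : Set M :=
  { y ∈ Ω' | auxF n k u Ω' t x l
      = Real.exp (-2 * (n : ℝ) * k * l) * dist x y ^ 2 / (2 * t) - dist (u x) (u y) }

/-- `L_{t,λ}(x) = dist(x, S_t(x,λ))`. -/
def auxL (n : ℕ) (k : ℝ) (u : M → Y) (Ω' : Set M) (t : ℝ) (l : ℝ) (x : M) : ℝ :=
  Metric.infDist x (auxS n k u Ω' t l x)

/-- Distance between two sets. -/
def setDist (A B : Set M) : ℝ := sInf { d : ℝ | ∃ x ∈ A, ∃ y ∈ B, d = dist x y }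

/-- `g` is a (weak) super-solution of the heat equation `𝓛_g = ∂g/∂λ` on the parabolic
cylinder `Q = G×I`: `-∫_Q ⟨∇g,∇φ⟩ dν ≤ ∫_Q (∂g/∂λ)φ dν` for all nonnegative
`φ ∈ Lip_0(Q)`, with `ν = μ × 𝓛¹` and spatial weak gradients. -/
def IsHeatSupersolution (F : SobolevFramework M μ) (G : Set M) (I : Set ℝ)
    (g : M × ℝ → ℝ) : Prop :=
  ∀ φ : M × ℝ → ℝ, IsLip0 (G ×ˢ I) φ → (∀ z, 0 ≤ φ z) →
    -∫ z in G ×ˢ I, F.innerGrad (fun x => g (x, z.2)) (fun x => φ (x, z.2)) z.1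
        ∂(μ.prod volume) ≤
      ∫ z in G ×ˢ I, deriv (fun s => g (z.1, s)) z.2 * φ z ∂(μ.prod volume)

/-- `g` is a (weak) sub-solution of the heat equation `𝓛_g = ∂g/∂λ` on `Q = G×I`. -/
def IsHeatSubsolution (F : SobolevFramework M μ) (G : Set M) (I : Set ℝ)
    (g : M × ℝ → ℝ) : Prop :=
  ∀ φ : M × ℝ → ℝ, IsLip0 (G ×ˢ I) φ → (∀ z, 0 ≤ φ z) →
    ∫ z in G ×ˢ I, deriv (fun s => g (z.1, s)) z.2 * φ z ∂(μ.prod volume) ≤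
      -∫ z in G ×ˢ I, F.innerGrad (fun x => g (x, z.2)) (fun x => φ (x, z.2)) z.1
        ∂(μ.prod volume)

/-- `|∇⁺v|(x) = limsup_{r→0} sup_{y∈B_x(r)} (v(y)-v(x))_+ / r`. -/
def upGrad (v : M → ℝ) (x : M) : ℝ :=
  Filter.limsup
    (fun r => sSup { d : ℝ | ∃ y ∈ Metric.ball x r, d = max (v y - v x) 0 / r })
    (𝓝[>] (0:ℝ))

end Paper

namespace Paper

theorem mul_sinh_le_sinh_mul {x R t : ℝ} (hx : 0 ≤ x) (hxR : x ≤ R) (hR : R ≤ 1)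
    (ht0 : 0 ≤ t) (ht1 : t ≤ 1) :
    t * (1 - (1 - t) * R) * Real.sinh x ≤ Real.sinh (t * x) := by
  have hsx : 0 ≤ Real.sinh x := Real.sinh_nonneg_iff.2 hx
  have h1 : ∀ s : ℝ, HasDerivAt (fun s => Real.sinh (s * x) - x ^ 2 * Real.sinh x * s ^ 2 / 2)
      (Real.cosh (s * x) * x - x ^ 2 * Real.sinh x * s) s := by
    intro s
    have := ((hasDerivAt_id s).mul_const x).sinh.sub
      (((hasDerivAt_pow 2 s).const_mul (x ^ 2 * Real.sinh x)).div_const 2)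
    exact this.congr_deriv (by simp; ring)
  have h2 : ∀ s : ℝ, HasDerivAt (fun s => Real.cosh (s * x) * x - x ^ 2 * Real.sinh x * s)
      (Real.sinh (s * x) * x * x - x ^ 2 * Real.sinh x) s := by
    intro s
    have := (((hasDerivAt_id s).mul_const x).cosh.mul_const x).sub
      ((hasDerivAt_id s).const_mul (x ^ 2 * Real.sinh x))
    exact this.congr_deriv (by simp)
  have hc : ConcaveOn ℝ (Icc (0:ℝ) 1)
      (fun s => Real.sinh (s * x) - x ^ 2 * Real.sinh x * s ^ 2 / 2) := by
    apply concaveOn_of_hasDerivWithinAt2_nonpos (convex_Icc 0 1)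
      (fun s _ => (h1 s).continuousAt.continuousWithinAt)
      (fun s _ => (h1 s).hasDerivWithinAt) (fun s _ => (h2 s).hasDerivWithinAt)
    intro s hs
    rw [interior_Icc] at hs
    have : Real.sinh (s * x) ≤ Real.sinh x :=
      Real.sinh_le_sinh.2 (by nlinarith [hs.2])
    nlinarith [sq_nonneg x]
  have := hc.2 (left_mem_Icc.2 zero_le_one) (right_mem_Icc.2 zero_le_one)
    (sub_nonneg.2 ht1) ht0 (by ring)
  simp at this
  have hxx : x ^ 2 ≤ R := by nlinarith
  have h3 : 0 ≤ t * (1 - t) := mul_nonneg ht0 (by linarith)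
  nlinarith [mul_nonneg h3 hsx, mul_nonneg (mul_nonneg h3 hsx) (sub_nonneg.2 hxx), sq_nonneg x,
    mul_nonneg (mul_nonneg h3 hsx) (sq_nonneg x)]

theorem sin_mul_le_mul_sin {x R t : ℝ} (hx : 0 ≤ x) (hxR : x ≤ R) (hR : R ≤ 1)
    (ht0 : 0 ≤ t) (ht1 : t ≤ 1) :
    Real.sin (t * (1 - (1 - t) * R) * x) ≤ t * Real.sin x := by
  have hpi := Real.pi_gt_three
  have h1 : ∀ s : ℝ, HasDerivAt (fun s => Real.sin (s * x) + x ^ 3 * s ^ 2 / 2)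
      (Real.cos (s * x) * x + x ^ 3 * s) s := by
    intro s
    have := ((hasDerivAt_id s).mul_const x).sin.add
      (((hasDerivAt_pow 2 s).const_mul (x ^ 3)).div_const 2)
    exact this.congr_deriv (by simp; ring)
  have h2 : ∀ s : ℝ, HasDerivAt (fun s => Real.cos (s * x) * x + x ^ 3 * s)
      (- Real.sin (s * x) * x * x + x ^ 3) s := by
    intro s
    have := (((hasDerivAt_id s).mul_const x).cos.mul_const x).add
      ((hasDerivAt_id s).const_mul (x ^ 3))
    exact this.congr_deriv (by simp)
  have hc : ConvexOn ℝ (Icc (0:ℝ) 1)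
      (fun s => Real.sin (s * x) + x ^ 3 * s ^ 2 / 2) := by
    apply convexOn_of_hasDerivWithinAt2_nonneg (convex_Icc 0 1)
      (fun s _ => (h1 s).continuousAt.continuousWithinAt)
      (fun s _ => (h1 s).hasDerivWithinAt) (fun s _ => (h2 s).hasDerivWithinAt)
    intro s hs
    rw [interior_Icc] at hs
    have : Real.sin (s * x) ≤ x := (Real.sin_le (by nlinarith [hs.1])).trans (by nlinarith [hs.2])
    nlinarith [sq_nonneg x]
  have h3 := hc.2 (left_mem_Icc.2 zero_le_one) (right_mem_Icc.2 zero_le_one)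
    (sub_nonneg.2 ht1) ht0 (by ring)
  simp at h3
  have hd : 0 ≤ t * (1 - t) := mul_nonneg ht0 (by linarith)
  have hR0 : 0 ≤ R := hx.trans hxR
  have htx : t * x ≤ 1 := by nlinarith
  have hl0 : 0 ≤ t * (1 - (1 - t) * R) * x :=
    mul_nonneg (mul_nonneg ht0 (by nlinarith)) hx
  set e := t * (1 - t) * R * x with he
  have he0 : 0 ≤ e := by positivity
  have hsplit : t * (1 - (1 - t) * R) * x = t * x - e := by rw [he]; ring
  rw [hsplit] at hl0 ⊢
  have hcos : 1 / 2 ≤ Real.cos (t * x) := by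
    have := Real.one_sub_sq_div_two_le_cos (x := t * x)
    have h0 : 0 ≤ t * x := mul_nonneg ht0 hx
    nlinarith
  have htan : Real.sin (t * x - e) ≤ Real.sin (t * x) - e * Real.cos (t * x) := by
    rw [Real.sin_sub]
    have hs0 : 0 ≤ Real.sin (t * x) :=
      Real.sin_nonneg_of_nonneg_of_le_pi (mul_nonneg ht0 hx) (by linarith)
    have hc0 : 0 ≤ Real.cos (t * x) := by linarith
    have he1 : e ≤ t * x := by linarith
    have htan1 : Real.sin (t * x) * (1 - Real.cos e) ≥ Real.cos (t * x) * (e - Real.sin e) := by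
      rcases eq_or_lt_of_le he0 with h | h
      · simp [← h]
      have hS : Real.cos e * e ≤ Real.sin e := by
        have h4 := Real.le_tan he0 (by linarith)
        rw [Real.tan_eq_sin_div_cos, le_div_iff₀
          (Real.cos_pos_of_mem_Ioo ⟨by linarith, by linarith⟩)] at h4
        linarith
      have hT : Real.cos (t * x) * (t * x) ≤ Real.sin (t * x) := by
        have h4 := Real.le_tan (x := t * x) (by linarith) (by linarith)
        rw [Real.tan_eq_sin_div_cos, le_div_iff₀
          (Real.cos_pos_of_mem_Ioo ⟨by linarith, by linarith⟩)] at h4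
        linarith
      have hce : 0 ≤ 1 - Real.cos e := by linarith [Real.cos_le_one e]
      have : Real.cos (t * x) * e ≤ Real.sin (t * x) := by nlinarith
      have h5 : e - Real.sin e ≤ e * (1 - Real.cos e) := by linarith
      nlinarith
    linarith
  have hxx : x ^ 2 ≤ R := by nlinarith
  have hdx : 0 ≤ t * (1 - t) * x := mul_nonneg hd hx
  have h6 : e / 2 ≤ e * Real.cos (t * x) := by nlinarith
  have h7 : t * (1 - t) * x * x ^ 2 ≤ e := by
    rw [he]; nlinarith
  nlinarith

theorem sinh_mul_le_mul_sinh {x l : ℝ} (hx : 0 ≤ x) (hl0 : 0 ≤ l) (hl1 : l ≤ 1) :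
    Real.sinh (l * x) ≤ l * Real.sinh x := by
  have hc : ConvexOn ℝ (Ici (0:ℝ)) Real.sinh := by
    apply convexOn_of_hasDerivWithinAt2_nonneg (convex_Ici 0) Real.continuous_sinh.continuousOn
      (fun s _ => (Real.hasDerivAt_sinh s).hasDerivWithinAt)
      (fun s _ => (Real.hasDerivAt_cosh s).hasDerivWithinAt)
    intro s hs
    rw [interior_Ici] at hs
    exact Real.sinh_nonneg_iff.2 (le_of_lt hs)
  have := hc.2 (x := 0) (y := x) (by simp) hx (sub_nonneg.2 hl1) hl0 (by ring)
  simpa using this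

theorem contract_factor_nonneg {t R : ℝ} (hR : R ≤ 1) (ht0 : 0 ≤ t) (ht1 : t ≤ 1) :
    0 ≤ t * (1 - (1 - t) * R) :=
  mul_nonneg ht0 (by nlinarith)

theorem contract_factor_le_one {t R : ℝ} (hR : 0 ≤ R) (ht0 : 0 ≤ t) (ht1 : t ≤ 1) :
    t * (1 - (1 - t) * R) ≤ 1 := by
  have : 0 ≤ (1 - t) * R := mul_nonneg (by linarith) hR
  nlinarith

theorem le_of_arccos_le_arccos {A B : ℝ} (hA : A ∈ Icc (-1 : ℝ) 1) (hB : B ∈ Icc (-1 : ℝ) 1)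
    (h : Real.arccos A ≤ Real.arccos B) : B ≤ A :=
  (Real.strictAntiOn_arccos.le_iff_ge hA hB).1 h

theorem cosh_eq_one_add (x : ℝ) : Real.cosh x = 1 + 2 * Real.sinh (x / 2) ^ 2 := by
  have h := Real.cosh_two_mul (x / 2)
  have h2 := Real.cosh_sq (x / 2)
  rw [show 2 * (x / 2) = x by ring] at h
  linarith

theorem cos_eq_one_sub (x : ℝ) : Real.cos x = 1 - 2 * Real.sin (x / 2) ^ 2 := by
  have h := Real.cos_two_mul (x / 2)
  have h2 := Real.sin_sq_add_cos_sq (x / 2)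
  rw [show 2 * (x / 2) = x by ring] at h
  linarith

theorem hyp_arg_mem {a b c : ℝ} (ha : 0 < a) (hb : 0 < b) (h1 : |a - b| ≤ c) (h2 : c ≤ a + b) :
    (Real.cosh a * Real.cosh b - Real.cosh c) / (Real.sinh a * Real.sinh b) ∈
      Icc (-1 : ℝ) 1 := by
  have hs : 0 < Real.sinh a * Real.sinh b :=
    mul_pos (Real.sinh_pos_iff.2 ha) (Real.sinh_pos_iff.2 hb)
  have hc : 0 ≤ c := (abs_nonneg _).trans h1
  have e1 : Real.cosh (a - b) ≤ Real.cosh c :=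
    Real.cosh_le_cosh.2 (by rwa [abs_of_nonneg hc])
  have e2 : Real.cosh c ≤ Real.cosh (a + b) :=
    Real.cosh_le_cosh.2 (by rwa [abs_of_nonneg hc, abs_of_nonneg (by linarith)])
  rw [Real.cosh_sub] at e1
  rw [Real.cosh_add] at e2
  constructor
  · rw [le_div_iff₀ hs]; linarith
  · rw [div_le_iff₀ hs]; linarith

theorem hyp_contract {a b c c' t R : ℝ} (ha : 0 < a) (hb : 0 < b) (haR : a ≤ R) (hbR : b ≤ R)
    (hR : R ≤ 1) (ht0 : 0 < t) (ht1 : t ≤ 1) (h1 : |a - b| ≤ c) (h2 : c ≤ a + b)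
    (h1' : |t * a - t * b| ≤ c') (h2' : c' ≤ t * a + t * b)
    (h : Real.arccos ((Real.cosh a * Real.cosh b - Real.cosh c) /
          (Real.sinh a * Real.sinh b)) ≤
      Real.arccos ((Real.cosh (t * a) * Real.cosh (t * b) - Real.cosh c') /
          (Real.sinh (t * a) * Real.sinh (t * b)))) :
    t * (1 - (1 - t) * R) * c ≤ c' := by
  have hta : 0 < t * a := mul_pos ht0 ha
  have htb : 0 < t * b := mul_pos ht0 hb
  have hBA := le_of_arccos_le_arccos (hyp_arg_mem ha hb h1 h2) (hyp_arg_mem hta htb h1' h2') h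
  have hc : 0 ≤ c := (abs_nonneg _).trans h1
  have hc' : 0 ≤ c' := (abs_nonneg _).trans h1'
  set l := t * (1 - (1 - t) * R) with hl
  have hl0 : 0 ≤ l := contract_factor_nonneg hR ht0.le ht1
  have hl1 : l ≤ 1 := contract_factor_le_one (ha.le.trans haR) ht0.le ht1
  have hsa := Real.sinh_pos_iff.2 ha
  have hsb := Real.sinh_pos_iff.2 hb
  have hsta := Real.sinh_pos_iff.2 hta
  have hstb := Real.sinh_pos_iff.2 htb
  have la : l * Real.sinh a ≤ Real.sinh (t * a) := mul_sinh_le_sinh_mul ha.le haR hR ht0.le ht1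
  have lb : l * Real.sinh b ≤ Real.sinh (t * b) := mul_sinh_le_sinh_mul hb.le hbR hR ht0.le ht1
  have hd : l * Real.sinh (|a - b| / 2) ≤ Real.sinh (t * (|a - b| / 2)) := by
    apply mul_sinh_le_sinh_mul (by positivity) _ hR ht0.le ht1
    rcases abs_cases (a - b) with ⟨h, _⟩ | ⟨h, _⟩ <;> rw [h] <;> linarith
  have ec := cosh_eq_one_add c
  have ec' := cosh_eq_one_add c'
  have ed := cosh_eq_one_add |a - b|
  have ed' := cosh_eq_one_add (t * |a - b|)
  rw [Real.cosh_abs, Real.cosh_sub] at ed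
  rw [← abs_of_pos ht0, ← abs_mul, Real.cosh_abs, mul_sub, Real.cosh_sub,
    ← mul_sub, abs_mul, abs_of_pos ht0, mul_div_assoc] at ed'
  rw [div_le_div_iff₀ (by positivity) (by positivity)] at hBA
  have hX : Real.sinh (|a - b| / 2) ^ 2 ≤ Real.sinh (c / 2) ^ 2 :=
    pow_le_pow_left₀ (Real.sinh_nonneg_iff.2 (by positivity)) (Real.sinh_le_sinh.2 (by linarith)) 2
  have hd2 : l ^ 2 * Real.sinh (|a - b| / 2) ^ 2 ≤ Real.sinh (t * (|a - b| / 2)) ^ 2 := by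
    rw [← mul_pow]
    exact pow_le_pow_left₀ (mul_nonneg hl0 (Real.sinh_nonneg_iff.2 (by positivity))) hd 2
  have hprod : l ^ 2 * (Real.sinh a * Real.sinh b) ≤ Real.sinh (t * a) * Real.sinh (t * b) := by
    calc l ^ 2 * (Real.sinh a * Real.sinh b) = (l * Real.sinh a) * (l * Real.sinh b) := by ring
      _ ≤ _ := mul_le_mul la lb (by positivity) hsta.le
  have key : l ^ 2 * Real.sinh (c / 2) ^ 2 ≤ Real.sinh (c' / 2) ^ 2 := by
    have hP : 0 < Real.sinh a * Real.sinh b := by positivity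
    have e1 : (Real.sinh (t * a) * Real.sinh (t * b)) *
        (Real.sinh (c / 2) ^ 2 - Real.sinh (|a - b| / 2) ^ 2) ≤
        (Real.sinh a * Real.sinh b) *
          (Real.sinh (c' / 2) ^ 2 - Real.sinh (t * (|a - b| / 2)) ^ 2) := by
      have f1 : Real.cosh a * Real.cosh b =
        1 + 2 * Real.sinh (|a - b| / 2) ^ 2 + Real.sinh a * Real.sinh b := by linarith
      have f2 : Real.cosh (t * a) * Real.cosh (t * b) =
        1 + 2 * Real.sinh (t * (|a - b| / 2)) ^ 2 + Real.sinh (t * a) * Real.sinh (t * b) := by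
          linarith
      rw [f1, f2, ec, ec'] at hBA
      linarith
    have e2 := mul_le_mul_of_nonneg_right hprod (sub_nonneg.2 hX)
    have e3 : (Real.sinh a * Real.sinh b) *
        (l ^ 2 * (Real.sinh (c / 2) ^ 2 - Real.sinh (|a - b| / 2) ^ 2)) ≤
        (Real.sinh a * Real.sinh b) *
          (Real.sinh (c' / 2) ^ 2 - Real.sinh (t * (|a - b| / 2)) ^ 2) := by linarith
    have e4 := le_of_mul_le_mul_left e3 hP
    linarith
  rw [← mul_pow] at key
  have key2 := abs_le_of_sq_le_sq key (Real.sinh_nonneg_iff.2 (by positivity))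
  have key3 := (sinh_mul_le_mul_sinh (x := c / 2) (by positivity) hl0 hl1).trans ((le_abs_self _).trans key2)
  have := Real.sinh_le_sinh.1 key3
  linarith

theorem sph_arg_mem {a b c : ℝ} (ha : 0 < a) (hb : 0 < b) (ha1 : a ≤ 1) (hb1 : b ≤ 1)
    (h1 : |a - b| ≤ c) (h2 : c ≤ a + b) :
    (Real.cos c - Real.cos a * Real.cos b) / (Real.sin a * Real.sin b) ∈ Icc (-1 : ℝ) 1 := by
  have hpi := Real.pi_gt_three
  have hs : 0 < Real.sin a * Real.sin b :=
    mul_pos (Real.sin_pos_of_pos_of_lt_pi ha (by linarith))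
      (Real.sin_pos_of_pos_of_lt_pi hb (by linarith))
  have hc : 0 ≤ c := (abs_nonneg _).trans h1
  have e1 : Real.cos c ≤ Real.cos (a - b) := by
    rw [← Real.cos_abs (a - b)]
    exact Real.cos_le_cos_of_nonneg_of_le_pi (abs_nonneg _) (by linarith) h1
  have e2 : Real.cos (a + b) ≤ Real.cos c :=
    Real.cos_le_cos_of_nonneg_of_le_pi hc (by linarith) h2
  rw [Real.cos_sub] at e1
  rw [Real.cos_add] at e2
  constructor
  · rw [le_div_iff₀ hs]; linarith
  · rw [div_le_iff₀ hs]; linarith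

theorem mul_sin_le_sin_mul {x t : ℝ} (hx : 0 ≤ x) (hx1 : x ≤ 1) (ht0 : 0 ≤ t) (ht1 : t ≤ 1) :
    t * Real.sin x ≤ Real.sin (t * x) := by
  have hpi := Real.pi_gt_three
  have := strictConcaveOn_sin_Icc.concaveOn.2 (x := 0) (y := x) ⟨le_rfl, by linarith⟩
    ⟨hx, by linarith⟩ (sub_nonneg.2 ht1) ht0 (by ring)
  simpa using this

theorem sph_contract {a b c c' t R : ℝ} (ha : 0 < a) (hb : 0 < b) (haR : a ≤ R) (hbR : b ≤ R)
    (hR : R ≤ 1) (ht0 : 0 < t) (ht1 : t ≤ 1) (h1 : |a - b| ≤ c) (h2 : c ≤ a + b)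
    (h1' : |t * a - t * b| ≤ c') (h2' : c' ≤ t * a + t * b)
    (h : Real.arccos ((Real.cos c - Real.cos a * Real.cos b) / (Real.sin a * Real.sin b)) ≤
      Real.arccos ((Real.cos c' - Real.cos (t * a) * Real.cos (t * b)) /
          (Real.sin (t * a) * Real.sin (t * b)))) :
    t * (1 - (1 - t) * R) * c ≤ c' := by
  have hpi := Real.pi_gt_three
  have hta : 0 < t * a := mul_pos ht0 ha
  have htb : 0 < t * b := mul_pos ht0 hb
  have hta1 : t * a ≤ 1 := by nlinarith
  have htb1 : t * b ≤ 1 := by nlinarith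
  have hBA := le_of_arccos_le_arccos (sph_arg_mem ha hb (haR.trans hR) (hbR.trans hR) h1 h2)
    (sph_arg_mem hta htb hta1 htb1 h1' h2') h
  have hc : 0 ≤ c := (abs_nonneg _).trans h1
  have hc' : 0 ≤ c' := (abs_nonneg _).trans h1'
  have pos : ∀ x : ℝ, 0 < x → x ≤ 1 → 0 < Real.sin x := fun x hx hx1 =>
    Real.sin_pos_of_pos_of_lt_pi hx (by linarith)
  have nn : ∀ x : ℝ, 0 ≤ x → x ≤ 1 → 0 ≤ Real.sin x := fun x hx hx1 =>
    Real.sin_nonneg_of_nonneg_of_le_pi hx (by linarith)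
  have hsa := pos a ha (haR.trans hR)
  have hsb := pos b hb (hbR.trans hR)
  have hsta := pos _ hta hta1
  have hstb := pos _ htb htb1
  have la : t * Real.sin a ≤ Real.sin (t * a) :=
    mul_sin_le_sin_mul ha.le (haR.trans hR) ht0.le ht1
  have lb : t * Real.sin b ≤ Real.sin (t * b) :=
    mul_sin_le_sin_mul hb.le (hbR.trans hR) ht0.le ht1
  have hab : |a - b| / 2 ≤ R := by
    rcases abs_cases (a - b) with ⟨h, _⟩ | ⟨h, _⟩ <;> rw [h] <;> linarith
  have hab0 : 0 ≤ |a - b| / 2 := by positivity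
  have hd : t * Real.sin (|a - b| / 2) ≤ Real.sin (t * (|a - b| / 2)) :=
    mul_sin_le_sin_mul hab0 (hab.trans hR) ht0.le ht1
  have ec := cos_eq_one_sub c
  have ec' := cos_eq_one_sub c'
  have ed := cos_eq_one_sub |a - b|
  have ed' := cos_eq_one_sub (t * |a - b|)
  rw [Real.cos_abs, Real.cos_sub] at ed
  rw [← abs_of_pos ht0, ← abs_mul, Real.cos_abs, mul_sub, Real.cos_sub,
    ← mul_sub, abs_mul, abs_of_pos ht0, mul_div_assoc] at ed'
  rw [div_le_div_iff₀ (by positivity) (by positivity)] at hBA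
  have hX : Real.sin (|a - b| / 2) ^ 2 ≤ Real.sin (c / 2) ^ 2 :=
    pow_le_pow_left₀ (nn _ hab0 (hab.trans hR))
      (Real.sin_le_sin_of_le_of_le_pi_div_two (by linarith) (by linarith) (by linarith)) 2
  have hd2 : t ^ 2 * Real.sin (|a - b| / 2) ^ 2 ≤ Real.sin (t * (|a - b| / 2)) ^ 2 := by
    rw [← mul_pow]
    exact pow_le_pow_left₀ (mul_nonneg ht0.le (nn _ hab0 (hab.trans hR))) hd 2
  have hprod : t ^ 2 * (Real.sin a * Real.sin b) ≤ Real.sin (t * a) * Real.sin (t * b) := by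
    calc t ^ 2 * (Real.sin a * Real.sin b) = (t * Real.sin a) * (t * Real.sin b) := by ring
      _ ≤ _ := mul_le_mul la lb (by positivity) hsta.le
  have key : t ^ 2 * Real.sin (c / 2) ^ 2 ≤ Real.sin (c' / 2) ^ 2 := by
    have hP : 0 < Real.sin a * Real.sin b := by positivity
    have e1 : (Real.sin (t * a) * Real.sin (t * b)) *
        (Real.sin (c / 2) ^ 2 - Real.sin (|a - b| / 2) ^ 2) ≤
        (Real.sin a * Real.sin b) *
          (Real.sin (c' / 2) ^ 2 - Real.sin (t * (|a - b| / 2)) ^ 2) := by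
      have f1 : Real.cos a * Real.cos b =
        1 - 2 * Real.sin (|a - b| / 2) ^ 2 - Real.sin a * Real.sin b := by linarith
      have f2 : Real.cos (t * a) * Real.cos (t * b) =
        1 - 2 * Real.sin (t * (|a - b| / 2)) ^ 2 - Real.sin (t * a) * Real.sin (t * b) := by
          linarith
      rw [f1, f2, ec, ec'] at hBA
      linarith
    have e2 := mul_le_mul_of_nonneg_right hprod (sub_nonneg.2 hX)
    have e3 : (Real.sin a * Real.sin b) *
        (t ^ 2 * (Real.sin (c / 2) ^ 2 - Real.sin (|a - b| / 2) ^ 2)) ≤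
        (Real.sin a * Real.sin b) *
          (Real.sin (c' / 2) ^ 2 - Real.sin (t * (|a - b| / 2)) ^ 2) := by linarith
    have e4 := le_of_mul_le_mul_left e3 hP
    linarith
  rw [← mul_pow] at key
  have key2 := abs_le_of_sq_le_sq key (nn _ (by positivity) (by linarith))
  have key3 := (sin_mul_le_mul_sin (x := c / 2) (by positivity) (by linarith) hR ht0.le
    ht1).trans ((le_abs_self _).trans key2)
  clear hBA key key2 hprod hd2 hX
  have hl1 := mul_le_mul_of_nonneg_right (contract_factor_le_one (ha.le.trans haR) ht0.le ht1) hc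
  by_contra hcon
  push Not at hcon
  have := Real.sin_lt_sin_of_lt_of_le_pi_div_two (x := c' / 2)
    (y := t * (1 - (1 - t) * R) * (c / 2)) (by linarith) (by linarith) (by linarith)
  linarith

theorem flat_arg_mem {a b c : ℝ} (ha : 0 < a) (hb : 0 < b)
    (h1 : |a - b| ≤ c) (h2 : c ≤ a + b) :
    (a ^ 2 + b ^ 2 - c ^ 2) / (2 * a * b) ∈ Icc (-1 : ℝ) 1 := by
  have hs : 0 < 2 * a * b := by positivity
  have hc : 0 ≤ c := (abs_nonneg _).trans h1
  have e1 : (a - b) ^ 2 ≤ c ^ 2 := sq_le_sq.2 (by rwa [abs_of_nonneg hc])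
  have e2 : c ^ 2 ≤ (a + b) ^ 2 := pow_le_pow_left₀ hc h2 2
  constructor
  · rw [le_div_iff₀ hs]; nlinarith
  · rw [div_le_iff₀ hs]; nlinarith

/-- If the comparison angle does not decrease when both sides of a hinge are shortened by the
factor `t`, then the opposite side shrinks at most by a factor close to `t`. -/
theorem cmpAngle_contract {k a b c c' t r : ℝ} (ha : 0 < a) (hb : 0 < b) (har : a ≤ r)
    (hbr : b ≤ r) (hr : Real.sqrt |k| * r ≤ 1) (ht0 : 0 < t) (ht1 : t ≤ 1)
    (h1 : |a - b| ≤ c) (h2 : c ≤ a + b)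
    (h1' : |t * a - t * b| ≤ c') (h2' : c' ≤ t * a + t * b)
    (h : cmpAngle k a b c ≤ cmpAngle k (t * a) (t * b) c') :
    t * (1 - (1 - t) * (Real.sqrt |k| * r)) * c ≤ c' := by
  have hta : 0 < t * a := mul_pos ht0 ha
  have htb : 0 < t * b := mul_pos ht0 hb
  have scale : ∀ s x y z : ℝ, 0 < s → |x - y| ≤ z → |s * x - s * y| ≤ s * z := by
    intro s x y z hs hz
    rw [← mul_sub, abs_mul, abs_of_pos hs]
    exact mul_le_mul_of_nonneg_left hz hs.le
  unfold cmpAngle at h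
  rcases lt_trichotomy k 0 with hk | hk | hk
  · rw [abs_of_neg hk] at hr ⊢
    simp only [hk.ne, hk, if_true, if_false] at h
    set s := Real.sqrt (-k) with hs
    have hs0 : 0 < s := Real.sqrt_pos.2 (by linarith)
    rw [mul_left_comm s t a, mul_left_comm s t b] at h
    have h3 := scale s _ _ _ hs0 h1'
    rw [mul_left_comm s t a, mul_left_comm s t b] at h3
    have := hyp_contract (mul_pos hs0 ha) (mul_pos hs0 hb)
      (mul_le_mul_of_nonneg_left har hs0.le) (mul_le_mul_of_nonneg_left hbr hs0.le) hr ht0 ht1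
      (scale s _ _ _ hs0 h1) (by nlinarith) h3 (by nlinarith) h
    rw [mul_left_comm] at this
    exact le_of_mul_le_mul_left this hs0
  · subst hk
    simp only [if_true] at h
    have hBA := le_of_arccos_le_arccos (flat_arg_mem ha hb h1 h2) (flat_arg_mem hta htb h1' h2') h
    rw [div_le_div_iff₀ (by positivity) (by positivity)] at hBA
    simp only [abs_zero, Real.sqrt_zero, zero_mul, mul_zero, sub_zero, mul_one]
    have hP : 0 < 2 * a * b := by positivity
    have : (2 * a * b) * (t * c) ^ 2 ≤ (2 * a * b) * c' ^ 2 := by nlinarith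
    exact (le_abs_self _).trans (abs_le_of_sq_le_sq (le_of_mul_le_mul_left this hP)
      ((abs_nonneg _).trans h1'))
  · rw [abs_of_pos hk] at hr ⊢
    simp only [hk.ne', not_lt.2 hk.le, if_false] at h
    set s := Real.sqrt k with hs
    have hs0 : 0 < s := Real.sqrt_pos.2 hk
    rw [mul_left_comm s t a, mul_left_comm s t b] at h
    have h3 := scale s _ _ _ hs0 h1'
    rw [mul_left_comm s t a, mul_left_comm s t b] at h3
    have := sph_contract (mul_pos hs0 ha) (mul_pos hs0 hb)
      (mul_le_mul_of_nonneg_left har hs0.le) (mul_le_mul_of_nonneg_left hbr hs0.le) hr ht0 ht1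
      (scale s _ _ _ hs0 h1) (by nlinarith) h3 (by nlinarith) h
    rw [mul_left_comm] at this
    exact le_of_mul_le_mul_left this hs0

/-- `y` divides a shortest path from `p` to `x` in the ratio `t : 1 - t`. -/
def IsDivPt {M : Type*} [MetricSpace M] (t : ℝ) (p x y : M) : Prop :=
  dist p y = t * dist p x ∧ dist y x = (1 - t) * dist p x

theorem GeodesicSpace.exists_isDivPt {M : Type*} [MetricSpace M] (hG : GeodesicSpace M) {t : ℝ}
    (ht0 : 0 ≤ t) (ht1 : t ≤ 1) (p x : M) : ∃ y, IsDivPt t p x y := by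
  obtain ⟨γ, ⟨h0, hγ⟩, hp, hx⟩ := hG p x
  have hm : t * dist p x ∈ Icc 0 (dist p x) :=
    ⟨by positivity, by nlinarith [dist_nonneg (x := p) (y := x)]⟩
  refine ⟨γ (t * dist p x), ?_, ?_⟩
  · have := hγ 0 ⟨le_rfl, h0⟩ _ hm
    rwa [hp, zero_sub, abs_neg, abs_of_nonneg hm.1] at this
  · have := hγ _ hm (dist p x) ⟨h0, le_rfl⟩
    rw [hx, abs_of_nonpos (by linarith [hm.2])] at this
    linarith

theorem IsDivPt.symm {M : Type*} [MetricSpace M] {t : ℝ} {p x y : M} (h : IsDivPt t p x y) :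
    IsDivPt (1 - t) x p y := by
  refine ⟨?_, ?_⟩
  · rw [dist_comm x y, dist_comm x p, h.2]
  · rw [dist_comm y p, dist_comm x p, h.1]; ring

theorem GeodesicSpace.exists_through {M : Type*} [MetricSpace M] (hG : GeodesicSpace M) {t : ℝ}
    {p x y : M} (h : IsDivPt t p x y) :
    ∃ γ : ℝ → M, IsUnitGeodesic γ (dist p x) ∧ γ 0 = p ∧ γ (t * dist p x) = y ∧
      γ (dist p x) = x := by
  obtain ⟨γ₁, ⟨h0₁, hγ₁⟩, hp₁, hx₁⟩ := hG p y
  obtain ⟨γ₂, ⟨h0₂, hγ₂⟩, hp₂, hx₂⟩ := hG y x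
  set d := dist p x with hd
  set a := t * d with ha
  have h1 : dist p y = a := h.1
  have h2 : dist y x = d - a := by rw [h.2]; ring
  rw [h1] at h0₁ hγ₁ hx₁
  rw [h2] at h0₂ hγ₂ hx₂
  let γ : ℝ → M := fun s => if s ≤ a then γ₁ s else γ₂ (s - a)
  have l1 : ∀ s, s ≤ a → γ s = γ₁ s := fun s hs => if_pos hs
  have l2 : ∀ s, a ≤ s → γ s = γ₂ (s - a) := by
    intro s hs
    rcases hs.eq_or_lt with rfl | hs
    · rw [l1 _ le_rfl, hx₁, sub_self, hp₂]
    · exact if_neg (not_le.2 hs)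
  have e0 : γ 0 = p := by rw [l1 0 h0₁, hp₁]
  have e1 : γ a = y := by rw [l1 a le_rfl, hx₁]
  have e2 : γ d = x := by rw [l2 d (by linarith), hx₂]
  have key : ∀ s t, 0 ≤ s → s ≤ t → t ≤ d → dist (γ s) (γ t) = t - s := by
    intro s t hs hst htd
    rcases le_total t a with h | h
    · rw [l1 s (by linarith), l1 t h, hγ₁ s ⟨hs, by linarith⟩ t ⟨by linarith, h⟩,
        abs_of_nonpos (by linarith)]
      ring
    rcases le_total a s with h' | h'
    · rw [l2 s h', l2 t h, hγ₂ _ ⟨by linarith, by linarith⟩ _ ⟨by linarith, by linarith⟩,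
        abs_of_nonpos (by linarith)]
      ring
    have d1 : dist p (γ s) = s := by
      rw [← hp₁, l1 s h', hγ₁ 0 ⟨le_rfl, h0₁⟩ s ⟨hs, h'⟩, abs_of_nonpos (by linarith)]
      ring
    have d2 : dist (γ s) y = a - s := by
      rw [← hx₁, l1 s h', hγ₁ s ⟨hs, h'⟩ a ⟨h0₁, le_rfl⟩, abs_of_nonpos (by linarith)]
      ring
    have d3 : dist y (γ t) = t - a := by
      rw [← hp₂, l2 t h, hγ₂ 0 ⟨le_rfl, h0₂⟩ _ ⟨by linarith, by linarith⟩,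
        abs_of_nonpos (by linarith)]
      ring
    have d4 : dist (γ t) x = d - t := by
      rw [← hx₂, l2 t h, hγ₂ _ ⟨by linarith, by linarith⟩ _ ⟨h0₂, le_rfl⟩,
        abs_of_nonpos (by linarith)]
      ring
    have t1 := dist_triangle (γ s) y (γ t)
    have t2 := dist_triangle4 p (γ s) (γ t) x
    linarith
  refine ⟨γ, ⟨by linarith, fun s hs t ht => ?_⟩, e0, e1, e2⟩
  rcases le_total s t with h | h
  · rw [key s t hs.1 h ht.2, abs_of_nonpos (by linarith)]; ring
  · rw [dist_comm, key t s ht.1 h hs.2, abs_of_nonneg (by linarith)]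

/-- Shortening all geodesics from `p` of length at most `r ≤ ρ` by a factor `t` shrinks distances
at most by a factor close to `t`. -/
def ContractsAt {M : Type*} [MetricSpace M] (k : ℝ) (p : M) (ρ : ℝ) : Prop :=
  Real.sqrt |k| * ρ ≤ 1 ∧ ∀ r ≤ ρ, ∀ x ∈ closedBall p r, ∀ x' ∈ closedBall p r, ∀ t : ℝ, 0 < t →
    t ≤ 1 → ∀ y y', IsDivPt t p x y → IsDivPt t p x' y' →
      t * (1 - (1 - t) * (Real.sqrt |k| * r)) * dist x x' ≤ dist y y'

theorem ContractsAt.mono {M : Type*} [MetricSpace M] {k : ℝ} {p : M} {ρ ρ' : ℝ}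
    (h : ContractsAt k p ρ) (hρ : ρ' ≤ ρ) : ContractsAt k p ρ' :=
  ⟨(mul_le_mul_of_nonneg_left hρ (Real.sqrt_nonneg _)).trans h.1,
    fun r hr => h.2 r (hr.trans hρ)⟩

theorem CurvBddBelow.contractsAt_nhds {M : Type*} [MetricSpace M] {k : ℝ}
    (hM : CurvBddBelow M k) (x₀ : M) :
    ∃ ρ > 0, ∀ p ∈ ball x₀ ρ, ContractsAt k p ρ := by
  obtain ⟨U, hU, hcmp⟩ := hM.comparison x₀
  obtain ⟨R, hR, hRU⟩ := Metric.mem_nhds_iff.1 hU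
  have hs : 0 ≤ Real.sqrt |k| := Real.sqrt_nonneg _
  refine ⟨min (R / 2) (1 / (Real.sqrt |k| + 1)), by positivity, fun p hp => ⟨?_, ?_⟩⟩
  · calc Real.sqrt |k| * min (R / 2) (1 / (Real.sqrt |k| + 1))
        ≤ Real.sqrt |k| * (1 / (Real.sqrt |k| + 1)) :=
          mul_le_mul_of_nonneg_left (min_le_right _ _) hs
      _ ≤ 1 := by rw [mul_one_div, div_le_one (by positivity)]; linarith
  intro r hr x hx x' hx' t ht0 ht1 y y' hy hy'
  have hrR : r ≤ R / 2 := hr.trans (min_le_left _ _)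
  have hrk : Real.sqrt |k| * r ≤ 1 := by
    calc Real.sqrt |k| * r
        ≤ Real.sqrt |k| * (1 / (Real.sqrt |k| + 1)) :=
          mul_le_mul_of_nonneg_left (hr.trans (min_le_right _ _)) hs
      _ ≤ 1 := by rw [mul_one_div, div_le_one (by positivity)]; linarith
  rw [mem_closedBall'] at hx hx'
  have hr0 : 0 ≤ r := dist_nonneg.trans hx
  have hfac : t * (1 - (1 - t) * (Real.sqrt |k| * r)) ≤ t := by
    have : 0 ≤ (1 - t) * (Real.sqrt |k| * r) := by
      have : 0 ≤ 1 - t := by linarith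
      positivity
    nlinarith
  rcases eq_or_ne p x with rfl | hpx
  · have : p = y := by rw [← dist_eq_zero, hy.1, dist_self, mul_zero]
    rw [← this, hy'.1]
    exact mul_le_mul_of_nonneg_right hfac dist_nonneg
  rcases eq_or_ne p x' with rfl | hpx'
  · have : p = y' := by rw [← dist_eq_zero, hy'.1, dist_self, mul_zero]
    rw [← this, dist_comm x, dist_comm y, hy.1]
    exact mul_le_mul_of_nonneg_right hfac dist_nonneg
  have ha := dist_pos.2 hpx
  have hb := dist_pos.2 hpx'
  obtain ⟨γ, hγ, γ0, γt, γ1⟩ := hM.geodesic.exists_through hy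
  obtain ⟨σ, hσ, σ0, σt, σ1⟩ := hM.geodesic.exists_through hy'
  have inU : ∀ (z : M) (τ : ℝ → M), dist p z ≤ r → IsUnitGeodesic τ (dist p z) → τ 0 = p →
      ∀ s ∈ Icc (0:ℝ) (dist p z), τ s ∈ U := by
    intro z τ hz hτ h0 s hs
    apply hRU
    have := hτ.2 s hs 0 ⟨le_rfl, hτ.1⟩
    rw [h0, sub_zero, abs_of_nonneg hs.1] at this
    rw [mem_ball] at hp ⊢
    have h3 := dist_triangle (τ s) p x₀
    have h4 := hp.trans_le (min_le_left _ _)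
    linarith [hs.2]
  have := hcmp p γ σ _ _ hγ hσ (inU x γ hx hγ γ0) (inU x' σ hx' hσ σ0) γ0 σ0
    (t * dist p x) (t * dist p x') (dist p x) (dist p x') (mul_pos ht0 ha)
    (by nlinarith) le_rfl (mul_pos ht0 hb) (by nlinarith) le_rfl
  rw [γt, γ1, σt, σ1] at this
  have tri : ∀ z w : M, |dist p z - dist p w| ≤ dist z w ∧ dist z w ≤ dist p z + dist p w :=
    fun z w => ⟨by rw [dist_comm p z, dist_comm p w]; exact abs_dist_sub_le z w p,
      by rw [dist_comm p z]; exact dist_triangle z p w⟩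
  have t' := tri y y'
  rw [hy.1, hy'.1] at t'
  exact cmpAngle_contract ha hb hx hx' hrk ht0 ht1 (tri x x').1 (tri x x').2 t'.1 t'.2 this

theorem CurvBddBelow.exists_contractsAt {M : Type*} [MetricSpace M] {k : ℝ}
    (hM : CurvBddBelow M k) {K : Set M} (hK : IsCompact K) :
    ∃ ρ > 0, ∀ p ∈ K, ContractsAt k p ρ := by
  refine hK.induction_on (p := fun K => ∃ ρ > 0, ∀ p ∈ K, ContractsAt k p ρ)
    ⟨1, one_pos, by simp⟩ (fun s t hst ⟨ρ, h, h'⟩ => ⟨ρ, h, fun p hp => h' p (hst hp)⟩) ?_ ?_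
  · rintro s t ⟨ρ, h, h'⟩ ⟨ρ', g, g'⟩
    refine ⟨min ρ ρ', lt_min h g, ?_⟩
    rintro p (hp | hp)
    · exact (h' p hp).mono (min_le_left _ _)
    · exact (g' p hp).mono (min_le_right _ _)
  · intro x _
    obtain ⟨ρ, h, h'⟩ := hM.contractsAt_nhds x
    exact ⟨ball x ρ, mem_nhdsWithin_of_mem_nhds (ball_mem_nhds x h), ρ, h, h'⟩

theorem GeodesicSpace.preconnectedSpace {M : Type*} [MetricSpace M] (hG : GeodesicSpace M) :
    PreconnectedSpace M := by
  refine ⟨isPreconnected_of_forall_pair fun x _ y _ => ?_⟩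
  obtain ⟨γ, ⟨h0, hγ⟩, hx, hy⟩ := hG x y
  refine ⟨γ '' Icc 0 (dist x y), subset_univ _, ⟨0, ⟨le_rfl, h0⟩, hx⟩, ⟨_, ⟨h0, le_rfl⟩, hy⟩, ?_⟩
  apply isPreconnected_Icc.image
  have : LipschitzOnWith 1 γ (Icc 0 (dist x y)) :=
    LipschitzOnWith.of_dist_le_mul fun s hs t ht => by
      rw [hγ s hs t ht, NNReal.coe_one, one_mul, Real.dist_eq]
  exact this.continuousOn

theorem separableSpace_of_locallyCompact_preconnected {M : Type*} [MetricSpace M]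
    [LocallyCompactSpace M] [PreconnectedSpace M] : TopologicalSpace.SeparableSpace M := by
  rcases isEmpty_or_nonempty M with hM | ⟨⟨x₀⟩⟩
  · infer_instance
  have hF : ∀ d : M, ∃ F : Set M, F.Countable ∧ ∀ q : ℚ, IsCompact (closedBall d (q : ℝ)) →
      closedBall d (q : ℝ) ⊆ closure F := by
    intro d
    have : ∀ q : ℚ, ∃ F : Set M, F.Countable ∧ (IsCompact (closedBall d (q : ℝ)) →
      closedBall d (q : ℝ) ⊆ closure F) := by
      intro q
      by_cases h : IsCompact (closedBall d (q : ℝ))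
      · obtain ⟨F, hF, hF'⟩ := h.isSeparable
        exact ⟨F, hF, fun _ => hF'⟩
      · exact ⟨∅, countable_empty, fun h' => (h h').elim⟩
    choose F hF hF' using this
    exact ⟨⋃ q, F q, countable_iUnion hF,
      fun q hq => (hF' q hq).trans (closure_mono (subset_iUnion F q))⟩
  choose F hFc hF using hF
  let D : ℕ → Set M := fun i => Nat.rec {x₀} (fun _ S => ⋃ d ∈ S, F d) i
  have hDc : ∀ i, (D i).Countable := by
    intro i
    induction i with
    | zero => exact countable_singleton _
    | succ i ih => exact ih.biUnion fun d _ => hFc d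
  set E : Set M := ⋃ i, D i with hE
  have hEF : ∀ d ∈ E, F d ⊆ E := by
    intro d hd
    obtain ⟨i, hi⟩ := mem_iUnion.1 hd
    exact (subset_biUnion_of_mem (u := fun d => F d) hi).trans (subset_iUnion D (i + 1))
  have hopen : IsOpen (closure E) := by
    rw [Metric.isOpen_iff]
    intro q hq
    obtain ⟨R, hR, hRc⟩ := Metric.exists_isCompact_closedBall q
    obtain ⟨d, hd, hqd⟩ := Metric.mem_closure_iff.1 hq (R / 4) (by positivity)
    obtain ⟨ρ, h1, h2⟩ := exists_rat_btwn (show R / 4 < R / 2 by linarith)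
    refine ⟨ρ - R / 4, by linarith, ?_⟩
    have hsub : closedBall d (ρ : ℝ) ⊆ closedBall q R :=
      closedBall_subset_closedBall' (by rw [dist_comm]; linarith)
    have := hF d ρ (hRc.of_isClosed_subset isClosed_closedBall hsub)
    refine Subset.trans ?_ (this.trans (closure_mono (hEF d hd)))
    exact ball_subset_closedBall.trans (closedBall_subset_closedBall' (by linarith))
  have hclopen : IsClopen (closure E) := ⟨isClosed_closure, hopen⟩
  have huniv := hclopen.eq_univ ⟨x₀, subset_closure (mem_iUnion.2 ⟨0, rfl⟩)⟩
  exact ⟨⟨E, countable_iUnion hDc, dense_iff_closure_eq.2 huniv⟩⟩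

/-- In a ball all of whose subballs contain `N` well separated points, every finite cover has large
`s`-dimensional content. -/
theorem le_sum_rpow_of_cover {M : Type*} [MetricSpace M] {q₀ : M} {r₀ a s : ℝ} {N : ℕ}
    (ha : 0 < a) (ha2 : a ≤ 2) (hs : 0 ≤ s) (hN : 2 ≤ N) (hNa : 1 ≤ N * (a / 4) ^ s)
    (H : ∀ q ρ, 0 < ρ → dist q q₀ + ρ ≤ r₀ → ∃ y : Fin N → M,
      (∀ j, dist (y j) q ≤ ρ / 2) ∧ ∀ i j, i ≠ j → a * ρ ≤ dist (y i) (y j))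
    {ι : Type*} (T : ι → Set M) (l : ι → ℝ) (hl : ∀ i, 0 ≤ l i)
    (hT : ∀ i, ∀ x ∈ T i, ∀ y ∈ T i, dist x y ≤ l i) (F : Finset ι) :
    ∀ q ρ, 0 < ρ → dist q q₀ + ρ ≤ r₀ → closedBall q ρ ⊆ ⋃ i ∈ F, T i →
      (a * ρ / 4) ^ s ≤ ∑ i ∈ F, l i ^ s := by
  classical
  induction F using Finset.strongInduction with
  | H F ih =>
  intro q ρ hρ hq hcov
  by_cases hbig : ∃ i ∈ F, a * ρ / 4 ≤ l i
  · obtain ⟨i, hi, hil⟩ := hbig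
    exact (Real.rpow_le_rpow (by positivity) hil hs).trans
      (Finset.single_le_sum (f := fun i => l i ^ s)
        (fun j _ => Real.rpow_nonneg (hl j) _) hi)
  push Not at hbig
  obtain ⟨y, hy, hsep⟩ := H q ρ hρ hq
  have haρ : 0 < a * ρ / 4 := by positivity
  let G : Fin N → Finset ι := fun j => {i ∈ F | (T i ∩ closedBall (y j) (a * ρ / 4)).Nonempty}
  have hdisj : ∀ i j, i ≠ j → Disjoint (G i) (G j) := by
    intro i j hij
    rw [Finset.disjoint_left]
    intro m hm hm'
    obtain ⟨hmF, z, hz, hzi⟩ := Finset.mem_filter.1 hm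
    obtain ⟨_, w, hw, hwj⟩ := Finset.mem_filter.1 hm'
    have h1 := hT m z hz w hw
    have h2 := hbig m hmF
    rw [mem_closedBall'] at hzi
    rw [mem_closedBall] at hwj
    have h3 := dist_triangle4 (y i) z w (y j)
    have := hsep i j hij
    linarith
  have hsub : ∀ j, closedBall (y j) (a * ρ / 4) ⊆ closedBall q ρ := by
    intro j
    apply closedBall_subset_closedBall'
    have := hy j
    nlinarith
  have hcov' : ∀ j, closedBall (y j) (a * ρ / 4) ⊆ ⋃ i ∈ G j, T i := by
    intro j z hz
    obtain ⟨i, hi, hzi⟩ := mem_iUnion₂.1 (hcov (hsub j hz))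
    exact mem_iUnion₂.2 ⟨i, Finset.mem_filter.2 ⟨hi, z, hzi, hz⟩, hzi⟩
  have hne : ∀ j, (G j).Nonempty := by
    intro j
    obtain ⟨i, hi, -⟩ := mem_iUnion₂.1 (hcov' j (mem_closedBall_self haρ.le))
    exact ⟨i, hi⟩
  have hG : ∀ j, G j ⊂ F := by
    intro j
    have : Nontrivial (Fin N) := Fin.nontrivial_iff_two_le.2 hN
    obtain ⟨j', hj'⟩ := exists_ne j
    obtain ⟨i, hi⟩ := hne j'
    refine ⟨Finset.filter_subset _ _, fun h => ?_⟩
    exact Finset.disjoint_left.1 (hdisj j j' hj'.symm) (h (Finset.mem_filter.1 hi).1) hi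
  have hstep : ∀ j, (a * (a * ρ / 4) / 4) ^ s ≤ ∑ i ∈ G j, l i ^ s := by
    intro j
    refine ih (G j) (hG j) (y j) (a * ρ / 4) haρ ?_ (hcov' j)
    have := dist_triangle (y j) q q₀
    have := hy j
    nlinarith
  calc (a * ρ / 4) ^ s ≤ (N * (a / 4) ^ s) * (a * ρ / 4) ^ s :=
        le_mul_of_one_le_left (Real.rpow_nonneg haρ.le _) hNa
    _ = ∑ j : Fin N, (a * (a * ρ / 4) / 4) ^ s := by
        rw [Finset.sum_const, Finset.card_univ, Fintype.card_fin, nsmul_eq_mul, mul_assoc,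
          ← Real.mul_rpow (by positivity) haρ.le]
        congr 2; ring
    _ ≤ ∑ j : Fin N, ∑ i ∈ G j, l i ^ s := Finset.sum_le_sum fun j _ => hstep j
    _ = ∑ i ∈ Finset.univ.biUnion G, l i ^ s :=
        (Finset.sum_biUnion fun i _ j _ hij => hdisj i j hij).symm
    _ ≤ ∑ i ∈ F, l i ^ s := by
        apply Finset.sum_le_sum_of_subset_of_nonneg
        · exact Finset.biUnion_subset.2 fun j _ => Finset.filter_subset _ _
        · exact fun i _ _ => Real.rpow_nonneg (hl i) _

theorem hausdorffMeasure_ne_zero_of_packing {M : Type*} [MetricSpace M] [MeasurableSpace M]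
    [BorelSpace M] {q₀ : M} {r₀ a s : ℝ} {N : ℕ}
    (hr₀ : 0 < r₀) (hK : IsCompact (closedBall q₀ r₀))
    (ha : 0 < a) (ha2 : a ≤ 2) (hs : 0 < s) (hN : 2 ≤ N) (hNa : 1 ≤ N * (a / 4) ^ s)
    (H : ∀ q ρ, 0 < ρ → dist q q₀ + ρ ≤ r₀ → ∃ y : Fin N → M,
      (∀ j, dist (y j) q ≤ ρ / 2) ∧ ∀ i j, i ≠ j → a * ρ ≤ dist (y i) (y j)) :
    μH[s] (closedBall q₀ r₀) ≠ 0 := by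
  intro h0
  set c : ℝ := (a * r₀ / 4) ^ s with hc
  have hc0 : 0 < c := Real.rpow_pos_of_pos (by positivity) _
  have hlt : (⨅ (t : ℕ → Set M) (_ : closedBall q₀ r₀ ⊆ ⋃ n, t n) (_ : ∀ n, ediam (t n) ≤ 1),
      ∑' n, ⨆ _ : (t n).Nonempty, ediam (t n) ^ s) < ENNReal.ofReal (c / 2) := by
    refine lt_of_le_of_lt ?_ (ENNReal.ofReal_pos.2 (half_pos hc0))
    rw [← h0, Measure.hausdorffMeasure_apply]
    exact le_iSup₂_of_le (1 : ℝ≥0∞) one_pos le_rfl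
  simp only [iInf_lt_iff] at hlt
  obtain ⟨t, htc, htd, hts⟩ := hlt
  have hterm : ∀ m, (⨆ _ : (t m).Nonempty, ediam (t m) ^ s) = ediam (t m) ^ s := by
    intro m
    rcases (t m).eq_empty_or_nonempty with h | h
    · rw [h]; simp [hs]
    · simp [h]
  simp only [hterm] at hts
  obtain ⟨η, hη0, hηsum⟩ := ENNReal.exists_pos_sum_of_countable
    (ENNReal.ofReal_pos.2 (half_pos hc0)).ne' ℕ
  have hfin : ∀ m, ediam (t m) ≠ ∞ := fun m => ((htd m).trans_lt ENNReal.one_lt_top).ne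
  have hd : ∀ m, ∃ δ : ℝ, 0 < δ ∧ ((ediam (t m)).toReal + 2 * δ) ^ s ≤
      (ediam (t m)).toReal ^ s + η m := by
    intro m
    have hcont : Continuous fun δ : ℝ => ((ediam (t m)).toReal + 2 * δ) ^ s :=
      (continuous_const.add (continuous_const.mul continuous_id)).rpow_const fun _ => Or.inr hs.le
    have h1 : ∀ᶠ δ in 𝓝 (0:ℝ), ((ediam (t m)).toReal + 2 * δ) ^ s <
        (ediam (t m)).toReal ^ s + η m := by
      apply hcont.continuousAt.eventually_lt continuousAt_const
      simpa using hη0 m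
    obtain ⟨δ, hδ, hδ0⟩ := ((h1.filter_mono nhdsWithin_le_nhds).and
      (self_mem_nhdsWithin : Ioi (0:ℝ) ∈ 𝓝[>] 0)).exists
    exact ⟨δ, hδ0, hδ.le⟩
  choose δ hδ0 hδ using hd
  obtain ⟨F, hF⟩ := hK.elim_finite_subcover (fun m => thickening (δ m) (t m))
    (fun m => isOpen_thickening)
    (htc.trans (iUnion_mono fun m => self_subset_thickening (hδ0 m) _))
  have hb := le_sum_rpow_of_cover ha ha2 hs.le hN hNa H (fun m => thickening (δ m) (t m))
    (fun m => (ediam (t m)).toReal + 2 * δ m) (fun m => by have := hδ0 m; positivity)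
    (fun m x hx y hy => by
      obtain ⟨x', hx', hxx⟩ := mem_thickening_iff.1 hx
      obtain ⟨y', hy', hyy⟩ := mem_thickening_iff.1 hy
      have h1 : dist x' y' ≤ (ediam (t m)).toReal := by
        rw [dist_edist]
        exact ENNReal.toReal_mono (hfin m) (edist_le_ediam_of_mem hx' hy')
      have h2 := dist_triangle4 x x' y' y
      rw [dist_comm y' y] at h2
      linarith) F q₀ r₀ hr₀ (by simp) hF
  have hb2 : c ≤ ∑ m ∈ F, ((ediam (t m)).toReal ^ s + η m) :=
    hb.trans (Finset.sum_le_sum fun m _ => hδ m)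
  have hb3 : ENNReal.ofReal c ≤ ∑ m ∈ F, (ediam (t m) ^ s + η m) := by
    refine (ENNReal.ofReal_le_ofReal hb2).trans ?_
    rw [ENNReal.ofReal_sum_of_nonneg fun m _ => by positivity]
    refine Finset.sum_le_sum fun m _ => ?_
    rw [ENNReal.ofReal_add (by positivity) (by positivity), ENNReal.ofReal_coe_nnreal,
      ← ENNReal.ofReal_rpow_of_nonneg ENNReal.toReal_nonneg hs.le, ENNReal.ofReal_toReal (hfin m)]
  have hb4 : ∑ m ∈ F, (ediam (t m) ^ s + (η m : ℝ≥0∞)) <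
      ENNReal.ofReal (c / 2) + ENNReal.ofReal (c / 2) := by
    rw [Finset.sum_add_distrib]
    exact ENNReal.add_lt_add ((ENNReal.sum_le_tsum F).trans_lt hts)
      ((ENNReal.sum_le_tsum F).trans_lt hηsum)
  rw [← ENNReal.ofReal_add (by positivity) (by positivity), add_halves] at hb4
  exact absurd (hb3.trans_lt hb4) (lt_irrefl _)

theorem packing_card_le {M : Type*} [MetricSpace M] [MeasurableSpace M] [BorelSpace M] {n : ℕ}
    {k : ℝ} (hG : GeodesicSpace M) (hdim : dimH (univ : Set M) = n) {q₀ : M} {r₀ : ℝ}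
    (hr₀ : 0 < r₀) (hK : IsCompact (closedBall q₀ r₀)) (hk : Real.sqrt |k| * (2 * r₀) ≤ 1 / 2)
    (hc : ∀ q ∈ closedBall q₀ r₀, ContractsAt k q (2 * r₀)) {ε : ℝ} (hε : 0 < ε)
    (hε1 : ε ≤ r₀) {N : ℕ} {S : Fin N → M} (hS : ∀ j, dist (S j) q₀ ≤ r₀)
    (hsep : ∀ i j, i ≠ j → ε ≤ dist (S i) (S j)) : (N : ℝ) * (ε / (32 * r₀)) ^ (n : ℝ) ≤ 1 := by
  set a := ε / (8 * r₀) with ha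
  have ha0 : 0 < a := by positivity
  have ha4 : ε / (32 * r₀) = a / 4 := by rw [ha]; field_simp; norm_num
  have ha1 : a ≤ 1 := by rw [ha, div_le_one (by positivity)]; linarith
  rw [ha4]
  rcases lt_or_ge N 2 with hN | hN
  · have h1 : (N : ℝ) ≤ 1 := by exact_mod_cast (show N ≤ 1 by omega)
    exact mul_le_one₀ h1 (by positivity)
      (Real.rpow_le_one (by positivity) (by linarith) (by positivity))
  have H : ∀ q ρ, 0 < ρ → dist q q₀ + ρ ≤ r₀ → ∃ y : Fin N → M,
      (∀ j, dist (y j) q ≤ ρ / 2) ∧ ∀ i j, i ≠ j → a * ρ ≤ dist (y i) (y j) := by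
    intro q ρ hρ hq
    have hρr : ρ ≤ r₀ := by linarith [dist_nonneg (x := q) (y := q₀)]
    have ht0 : 0 < ρ / (4 * r₀) := by positivity
    have ht1 : ρ / (4 * r₀) ≤ 1 := by rw [div_le_one (by positivity)]; linarith
    have hqS : ∀ j, dist q (S j) ≤ 2 * r₀ := by
      intro j
      have := dist_triangle_right q (S j) q₀
      linarith [hS j]
    choose y hy using fun j => hG.exists_isDivPt ht0.le ht1 q (S j)
    refine ⟨y, fun j => ?_, fun i j hij => ?_⟩
    · rw [dist_comm, (hy j).1, div_mul_eq_mul_div, div_le_div_iff₀ (by positivity) (by norm_num)]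
      nlinarith [hqS j]
    · have := (hc q (by rw [mem_closedBall]; linarith)).2 (2 * r₀) le_rfl (S i)
        (by rw [mem_closedBall']; exact hqS i) (S j) (by rw [mem_closedBall']; exact hqS j)
        _ ht0 ht1 _ _ (hy i) (hy j)
      refine le_trans ?_ this
      have h2 : (1:ℝ) / 2 ≤ 1 - (1 - ρ / (4 * r₀)) * (Real.sqrt |k| * (2 * r₀)) := by
        have : (1 - ρ / (4 * r₀)) * (Real.sqrt |k| * (2 * r₀)) ≤ 1 * (1 / 2) :=
          mul_le_mul (by linarith) hk (by positivity) zero_le_one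
        linarith
      calc a * ρ = ρ / (4 * r₀) * (1 / 2) * ε := by rw [ha]; field_simp; norm_num
        _ ≤ _ := mul_le_mul (mul_le_mul_of_nonneg_left h2 ht0.le) (hsep i j hij) hε.le
            (mul_nonneg ht0.le (by linarith))
  have hlt : ∀ s : ℝ, (n : ℝ) < s → (N : ℝ) * (a / 4) ^ s ≤ 1 := by
    intro s hs
    have hs0 : 0 < s := lt_of_le_of_lt (Nat.cast_nonneg n) hs
    by_contra hcon
    push Not at hcon
    apply hausdorffMeasure_ne_zero_of_packing hr₀ hK ha0 (by linarith) hs0 hN hcon.le H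
    have h0 : dimH (univ : Set M) < (s.toNNReal : ℝ≥0∞) := by
      rw [hdim]
      have : ((n : ℝ≥0) : ℝ≥0∞) < (s.toNNReal : ℝ≥0∞) := by
        rw [ENNReal.coe_lt_coe, ← NNReal.coe_lt_coe, Real.coe_toNNReal _ hs0.le]
        exact_mod_cast hs
      simpa using this
    have h1 := hausdorffMeasure_of_dimH_lt h0
    rw [Real.coe_toNNReal _ hs0.le] at h1
    exact measure_mono_null (subset_univ _) h1
  have hcont : ContinuousAt (fun s : ℝ => (N : ℝ) * (a / 4) ^ s) (n : ℝ) :=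
    continuousAt_const.mul (Real.continuousAt_const_rpow (by positivity))
  exact le_of_tendsto (x := 𝓝[>] (n : ℝ)) (hcont.tendsto.mono_left nhdsWithin_le_nhds)
    (eventually_nhdsWithin_of_forall fun s hs => hlt s hs)

theorem hausdorffMeasure_closedBall_lt_top {M : Type*} [MetricSpace M] [MeasurableSpace M]
    [BorelSpace M] {n : ℕ} {k : ℝ} (hG : GeodesicSpace M) (hdim : dimH (univ : Set M) = n)
    {q₀ : M} {r₀ : ℝ} (hr₀ : 0 < r₀) (hK : IsCompact (closedBall q₀ r₀))
    (hk : Real.sqrt |k| * (2 * r₀) ≤ 1 / 2)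
    (hc : ∀ q ∈ closedBall q₀ r₀, ContractsAt k q (2 * r₀)) :
    μH[(n : ℝ)] (closedBall q₀ r₀) < ∞ := by
  have hcov : ∀ ε : ℝ, 0 < ε → ε ≤ r₀ → ∃ (N : ℕ) (S : Fin N → M),
      (N : ℝ) * (ε / (32 * r₀)) ^ (n : ℝ) ≤ 1 ∧ closedBall q₀ r₀ ⊆ ⋃ j, closedBall (S j) ε := by
    intro ε hε hε1
    let P : ℕ → Prop := fun N => ∃ S : Fin N → M, (∀ j, dist (S j) q₀ ≤ r₀) ∧
      ∀ i j, i ≠ j → ε ≤ dist (S i) (S j)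
    have hb : ∀ N, P N → (N : ℝ) * (ε / (32 * r₀)) ^ (n : ℝ) ≤ 1 := fun N ⟨S, h1, h2⟩ =>
      packing_card_le hG hdim hr₀ hK hk hc hε hε1 h1 h2
    have hpos : 0 < (ε / (32 * r₀)) ^ (n : ℝ) := Real.rpow_pos_of_pos (by positivity) _
    obtain ⟨b, hb'⟩ := exists_nat_gt (1 / (ε / (32 * r₀)) ^ (n : ℝ))
    have hPb : ¬ P b := fun h => by
      rw [div_lt_iff₀ hpos] at hb'
      linarith [hb b h]
    have h0 : P 0 := ⟨Fin.elim0, fun j => j.elim0, fun j => j.elim0⟩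
    obtain ⟨N, hN, hN'⟩ : ∃ N, P N ∧ ¬ P (N + 1) := by
      by_contra hcon
      push Not at hcon
      exact hPb (Nat.rec h0 (fun m hm => hcon m hm) b)
    obtain ⟨S, hS, hsep⟩ := hN
    refine ⟨N, S, hb N ⟨S, hS, hsep⟩, fun z hz => ?_⟩
    by_contra hcon
    simp only [mem_iUnion, mem_closedBall, not_exists, not_le] at hcon
    apply hN'
    refine ⟨Fin.cons z S, fun j => ?_, fun i j hij => ?_⟩
    · refine Fin.cases ?_ (fun j => ?_) j
      · simpa using hz
      · simpa using hS j
    · revert hij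
      refine Fin.cases ?_ (fun i => ?_) i <;> refine Fin.cases ?_ (fun j => ?_) j
      · simp
      · intro _; simpa using (hcon j).le
      · intro _; rw [dist_comm]; simpa using (hcon i).le
      · intro hij; simpa using hsep i j (fun h => hij (by rw [h]))
  let e : ℕ → ℝ := fun m => r₀ / (m + 1)
  have he0 : ∀ m, 0 < e m := fun m => by positivity
  have he1 : ∀ m, e m ≤ r₀ := fun m => div_le_self hr₀.le (by simp)
  choose N S hN hS using fun m => hcov (e m) (he0 m) (he1 m)
  have hdiam : ∀ (m : ℕ) (x : M), ediam (closedBall x (e m)) ≤ ENNReal.ofReal (2 * e m) := by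
    intro m x
    have : closedBall x (e m) ⊆ closedEBall x (ENNReal.ofReal (e m)) := by
      rw [Metric.closedEBall_ofReal (he0 m).le]
    refine (ediam_mono this).trans (ediam_closedEBall_le.trans ?_)
    rw [ENNReal.ofReal_mul zero_le_two, ENNReal.ofReal_ofNat]
  have hlim : Tendsto (fun m => ENNReal.ofReal (2 * e m)) atTop (𝓝 0) := by
    rw [← ENNReal.ofReal_zero]
    apply ENNReal.tendsto_ofReal
    have := (tendsto_const_div_atTop_nhds_zero_nat (2 * r₀)).comp (tendsto_add_atTop_nat 1)
    refine this.congr fun m => ?_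
    simp only [Function.comp, e]; push_cast; ring
  have hle := Measure.hausdorffMeasure_le_liminf_sum (n : ℝ) (closedBall q₀ r₀) (l := atTop)
    (fun m => ENNReal.ofReal (2 * e m)) hlim
    (fun m (j : Fin (N m)) => closedBall (S m j) (e m))
    (Eventually.of_forall fun m j => hdiam m _)
    (Eventually.of_forall fun m => hS m)
  refine hle.trans_lt (lt_of_le_of_lt (b := ENNReal.ofReal ((64 * r₀) ^ (n : ℝ))) ?_
    ENNReal.ofReal_lt_top)
  refine liminf_le_of_frequently_le' (Frequently.of_forall fun m => ?_)
  calc ∑ j : Fin (N m), ediam (closedBall (S m j) (e m)) ^ (n : ℝ)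
      ≤ ∑ _j : Fin (N m), ENNReal.ofReal ((2 * e m) ^ (n : ℝ)) := by
        refine Finset.sum_le_sum fun j _ => ?_
        rw [← ENNReal.ofReal_rpow_of_nonneg (by have := he0 m; positivity) (Nat.cast_nonneg n)]
        exact ENNReal.rpow_le_rpow (hdiam m _) (Nat.cast_nonneg n)
    _ = ENNReal.ofReal (N m * (2 * e m) ^ (n : ℝ)) := by
        rw [Finset.sum_const, Finset.card_univ, Fintype.card_fin, nsmul_eq_mul,
          ENNReal.ofReal_mul (Nat.cast_nonneg _), ENNReal.ofReal_natCast]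
    _ ≤ ENNReal.ofReal ((64 * r₀) ^ (n : ℝ)) := by
        apply ENNReal.ofReal_le_ofReal
        have h1 := hN m
        have h2 : 2 * e m = (e m / (32 * r₀)) * (64 * r₀) := by field_simp; ring
        rw [h2, Real.mul_rpow (by have := he0 m; positivity) (by positivity), ← mul_assoc]
        exact mul_le_of_le_one_left (by positivity) h1

theorem AlexandrovSpace.isLocallyFiniteMeasure {M : Type*} [MetricSpace M] [MeasurableSpace M]
    [BorelSpace M] {n : ℕ} {k : ℝ} (hM : AlexandrovSpace M n k) :
    IsLocallyFiniteMeasure (μH[(n : ℝ)] : Measure M) := by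
  have := hM.curv.locallyCompact
  refine ⟨fun x => ?_⟩
  obtain ⟨R, hR, hRc⟩ := Metric.exists_isCompact_closedBall x
  obtain ⟨ρ, hρ, hc⟩ := hM.curv.contractsAt_nhds x
  have hs := (hc x (mem_ball_self hρ)).1
  have hs0 := Real.sqrt_nonneg |k|
  set r := min R (ρ / 4) with hr
  have hr0 : 0 < r := by positivity
  have hrR : r ≤ R := min_le_left _ _
  have hrρ : r ≤ ρ / 4 := min_le_right _ _
  refine ⟨closedBall x r, closedBall_mem_nhds x hr0,
    hausdorffMeasure_closedBall_lt_top (k := k) hM.curv.geodesic hM.dim hr0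
      (hRc.of_isClosed_subset isClosed_closedBall (closedBall_subset_closedBall hrR))
      (by nlinarith) fun q hq => (hc q ?_).mono (by linarith)⟩
  rw [mem_closedBall] at hq
  rw [mem_ball]
  linarith

theorem hausdorffMeasure_le_image_of_expanding {M : Type*} [MetricSpace M] [MeasurableSpace M]
    [BorelSpace M] {d l : ℝ} (hd : 0 ≤ d) (hl : 0 < l) {f : M → M} {A : Set M}
    (hf : ∀ x ∈ A, ∀ y ∈ A, l * dist x y ≤ dist (f x) (f y)) :
    ENNReal.ofReal l ^ d * μH[d] A ≤ μH[d] (f '' A) := by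
  rcases A.eq_empty_or_nonempty with rfl | hne
  · simp
  have : Nonempty M := ⟨hne.some⟩
  have hinj : InjOn f A := fun x hx y hy hxy => by
    have := hf x hx y hy
    rw [hxy, dist_self] at this
    exact dist_le_zero.1 (nonpos_of_mul_nonpos_right this hl)
  set g := Function.invFunOn f A
  have hg : ∀ x ∈ A, g (f x) = x := fun x hx => hinj.leftInvOn_invFunOn hx
  have hlip : LipschitzOnWith (Real.toNNReal l⁻¹) g (f '' A) := by
    refine LipschitzOnWith.of_dist_le_mul ?_
    rintro _ ⟨x, hx, rfl⟩ _ ⟨y, hy, rfl⟩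
    rw [hg x hx, hg y hy, Real.coe_toNNReal _ (by positivity), ← div_eq_inv_mul,
      le_div_iff₀ hl, mul_comm]
    exact hf x hx y hy
  have himg : g '' (f '' A) = A := by
    rw [image_image]
    exact (image_congr hg).trans (image_id' A)
  have h := hlip.hausdorffMeasure_image_le hd
  rw [himg] at h
  calc ENNReal.ofReal l ^ d * μH[d] A
      ≤ ENNReal.ofReal l ^ d * (ENNReal.ofReal l⁻¹ ^ d * μH[d] (f '' A)) := by gcongr; exact h
    _ = μH[d] (f '' A) := by
      rw [← mul_assoc, ← ENNReal.mul_rpow_of_nonneg _ _ hd, ← ENNReal.ofReal_mul hl.le,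
        mul_inv_cancel₀ hl.ne', ENNReal.ofReal_one, ENNReal.one_rpow, one_mul]

theorem lintegral_comp_le_of_expanding {M : Type*} [MetricSpace M] [MeasurableSpace M]
    [BorelSpace M] {d l : ℝ} (hd : 0 ≤ d) (hl : 0 < l) {f : M → M} (hfm : Measurable f)
    {A B : Set M}
    (hf : ∀ x ∈ A, ∀ y ∈ A, l * dist x y ≤ dist (f x) (f y)) (hAB : MapsTo f A B)
    {g : M → ℝ≥0∞} (hg : Measurable g) :
    ENNReal.ofReal l ^ d * ∫⁻ x in A, g (f x) ∂μH[d] ≤ ∫⁻ x in B, g x ∂μH[d] := by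
  rw [← lintegral_map hg hfm, ← smul_eq_mul, ← lintegral_smul_measure]
  refine lintegral_mono' ?_ le_rfl
  rw [Measure.le_iff]
  intro E hE
  rw [Measure.smul_apply, Measure.map_apply hfm hE, Measure.restrict_apply (hfm hE),
    Measure.restrict_apply hE, smul_eq_mul]
  refine (hausdorffMeasure_le_image_of_expanding hd hl
    (fun x hx y hy => hf x hx.2 y hy.2)).trans (measure_mono ?_)
  rintro _ ⟨x, hx, rfl⟩
  exact ⟨hx.1, hAB hx.2⟩

theorem isClosed_isDivPt {M : Type*} [MetricSpace M] (t : ℝ) :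
    IsClosed {q : M × M × M | IsDivPt t q.1 q.2.1 q.2.2} :=
  (isClosed_eq (by fun_prop) (by fun_prop)).inter (isClosed_eq (by fun_prop) (by fun_prop))

theorem IsDivPt.eq_of_extends {M : Type*} [MetricSpace M] {k ρ s t : ℝ} {z y e w w' : M}
    (hs0 : 0 ≤ s) (hs1 : s ≤ 1) (ht1 : t < 1) (hc : ContractsAt k e ρ)
    (hρ : dist z e ≤ ρ) (hk : Real.sqrt |k| * ρ < 1) (he : IsDivPt t z e y)
    (hw : IsDivPt s z y w) (hw' : IsDivPt s z y w') : w = w' := by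
  rcases eq_or_ne z e with rfl | hze
  · have h0 : dist z y = 0 := by rw [he.1, dist_self, mul_zero]
    have h1 : dist z w = 0 := by rw [hw.1, h0, mul_zero]
    have h2 : dist z w' = 0 := by rw [hw'.1, h0, mul_zero]
    rw [← dist_eq_zero.1 h1, ← dist_eq_zero.1 h2]
  have hd := dist_pos.2 hze
  have hye : 0 < dist y e := by rw [he.2]; exact mul_pos (by linarith) hd
  have key : ∀ v, IsDivPt s z y v →
      dist e v = dist y e + (1 - s) * dist z y := by
    intro v hv
    have h1 := dist_triangle e y v
    have h2 := dist_triangle z v e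
    rw [dist_comm e y, dist_comm y v, hv.2] at h1
    rw [hv.1, dist_comm v e] at h2
    have h3 : dist z e = dist z y + dist y e := by rw [he.1, he.2]; ring
    nlinarith
  have hzy : dist z y + dist y e = dist z e := by rw [he.1, he.2]; ring
  set D := dist y e + (1 - s) * dist z y with hD
  have hD0 : 0 < D := by
    have : 0 ≤ (1 - s) * dist z y := mul_nonneg (by linarith) dist_nonneg
    linarith
  have hDr : dist y e / D ≤ 1 := by
    rw [div_le_one hD0]
    have : 0 ≤ (1 - s) * dist z y := mul_nonneg (by linarith) dist_nonneg
    linarith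
  have hdiv : ∀ v, IsDivPt s z y v → IsDivPt (dist y e / D) e v y := by
    intro v hv
    refine ⟨?_, ?_⟩
    · rw [key v hv, div_mul_cancel₀ _ hD0.ne', dist_comm]
    · rw [key v hv, sub_mul, div_mul_cancel₀ _ hD0.ne', dist_comm, hv.2, hD]; ring
  have hmem : ∀ v, IsDivPt s z y v → v ∈ closedBall e ρ := by
    intro v hv
    have h2 := dist_triangle z v e
    have h1 := key v hv
    rw [mem_closedBall', h1]
    nlinarith [mul_nonneg hs0 (dist_nonneg (x := z) (y := y))]
  have hle := hc.2 ρ le_rfl w (hmem w hw) w' (hmem w' hw') _ (div_pos hye hD0) hDr y y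
    (hdiv w hw) (hdiv w' hw')
  rw [dist_self] at hle
  have hr0 : 0 ≤ ρ := dist_nonneg.trans hρ
  have hpos : 0 < dist y e / D * (1 - (1 - dist y e / D) * (Real.sqrt |k| * ρ)) := by
    apply mul_pos (div_pos hye hD0)
    have h1 : (1 - dist y e / D) * (Real.sqrt |k| * ρ) ≤ 1 * (Real.sqrt |k| * ρ) :=
      mul_le_mul_of_nonneg_right (by linarith [div_pos hye hD0]) (by positivity)
    linarith
  exact dist_le_zero.1 (nonpos_of_mul_nonpos_right hle hpos)

/-- The pairs `(z, y)` such that some geodesic from `z` to `y` can be prolonged within `K'` by a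
factor `1 / t` to a geodesic of length at most `ρ`. -/
def extendable {M : Type*} [MetricSpace M] (K K' : Set M) (ρ t : ℝ) : Set (M × M) :=
  {q | q.1 ∈ K ∧ q.2 ∈ K' ∧ ∃ e ∈ K', dist q.1 e ≤ ρ ∧ IsDivPt t q.1 e q.2}

theorem isCompact_extendable {M : Type*} [MetricSpace M] {K K' : Set M} (hK : IsCompact K)
    (hK' : IsCompact K') (ρ t : ℝ) : IsCompact (extendable K K' ρ t) := by
  have h1 : IsClosed {q : M × M × M | dist q.1 q.2.1 ≤ ρ ∧ IsDivPt t q.1 q.2.1 q.2.2} :=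
    (isClosed_le (f := fun q : M × M × M => dist q.1 q.2.1) (g := fun _ => ρ)
      (by fun_prop) (by fun_prop)).inter (isClosed_isDivPt t)
  have h2 := ((hK.prod (hK'.prod hK')).inter_right h1).image
    (show Continuous fun q : M × M × M => (q.1, q.2.2) by fun_prop)
  convert h2 using 1
  ext ⟨z, y⟩
  constructor
  · rintro ⟨hz, hy, e, he, h⟩
    exact ⟨(z, e, y), ⟨⟨hz, he, hy⟩, h⟩, rfl⟩
  · rintro ⟨⟨z', e, y'⟩, ⟨⟨hz, he, hy⟩, h⟩, h'⟩
    simp only [Prod.mk.injEq] at h'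
    obtain ⟨rfl, rfl⟩ := h'
    exact ⟨hz, hy, e, he, h⟩

theorem exists_measurable_divPt {M : Type*} [MetricSpace M] [MeasurableSpace M] [BorelSpace M]
    [SecondCountableTopology M] {k ρ : ℝ} {K K' : Set M} (hG : GeodesicSpace M)
    (hK : IsCompact K) (hK' : IsCompact K') (hKK : ∀ z ∈ K, closedBall z ρ ⊆ K')
    (hk : Real.sqrt |k| * ρ < 1) (hc : ∀ q ∈ K', ContractsAt k q ρ)
    {s : ℝ} (hs0 : 0 ≤ s) (hs1 : s ≤ 1) {t : ℕ → ℝ} (ht0 : ∀ i, 0 < t i) (ht1 : ∀ i, t i < 1) :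
    ∃ W : M × M → M, Measurable W ∧
      ∀ q ∈ ⋃ i, extendable K K' ρ (t i), IsDivPt s q.1 q.2 (W q) := by
  classical
  set G := ⋃ i, extendable K K' ρ (t i) with hGdef
  choose w hw using fun q : M × M => hG.exists_isDivPt hs0 hs1 q.1 q.2
  let W : M × M → M := fun q => if q ∈ G then w q else q.1
  have hGm : MeasurableSet G :=
    MeasurableSet.iUnion fun i => (isCompact_extendable hK hK' ρ (t i)).measurableSet
  have hWG : ∀ q ∈ G, W q = w q := fun q hq => if_pos hq
  refine ⟨W, measurable_of_isClosed fun C hC => ?_, fun q hq => by rw [hWG q hq]; exact hw q⟩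
  let T : ℕ → Set (M × M) := fun i => (fun q : M × M × M => (q.1, q.2.1)) ''
    {q | (q.1, q.2.1) ∈ extendable K K' ρ (t i) ∧ q.2.2 ∈ K' ∩ C ∧ IsDivPt s q.1 q.2.1 q.2.2}
  have hT : ∀ i, IsCompact (T i) := by
    intro i
    have hE := isCompact_extendable hK hK' ρ (t i)
    have hcl : IsClosed {q : M × M × M | (q.1, q.2.1) ∈ extendable K K' ρ (t i) ∧
        IsDivPt s q.1 q.2.1 q.2.2} :=
      (hE.isClosed.preimage (show Continuous fun q : M × M × M => (q.1, q.2.1) by fun_prop)).inter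
        (isClosed_isDivPt s)
    refine IsCompact.image ?_ (by fun_prop)
    refine ((hK.prod (hK'.prod (hK'.inter_right hC))).inter_right hcl).of_isClosed_subset ?_ ?_
    · have : IsClosed {q : M × M × M | q.2.2 ∈ K' ∩ C} :=
        (hK'.isClosed.inter hC).preimage (by fun_prop)
      convert hcl.inter this using 1
      ext q; simp only [mem_ofPred_eq, mem_inter_iff]; tauto
    · rintro ⟨z, y, v⟩ ⟨h1, h2, h3⟩
      exact ⟨⟨h1.1, h1.2.1, h2⟩, h1, h3⟩
  have hpre : W ⁻¹' C = (⋃ i, T i) ∪ (Gᶜ ∩ Prod.fst ⁻¹' C) := by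
    ext ⟨z, y⟩
    constructor
    · intro hq
      by_cases hqG : (z, y) ∈ G
      · left
        rw [mem_preimage, hWG _ hqG] at hq
        obtain ⟨i, hi⟩ := mem_iUnion.1 hqG
        obtain ⟨hz, hy, e, he, hze, hdiv⟩ := hi
        refine mem_iUnion.2 ⟨i, (z, y, w (z, y)), ⟨⟨hz, hy, e, he, hze, hdiv⟩, ⟨?_, hq⟩,
          hw (z, y)⟩, rfl⟩
        apply hKK z hz
        rw [mem_closedBall', (hw (z, y)).1]
        calc s * dist z y ≤ 1 * (1 * dist z e) := by
              rw [hdiv.1]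
              exact mul_le_mul hs1 (mul_le_mul_of_nonneg_right (ht1 i).le dist_nonneg)
                (mul_nonneg (ht0 i).le dist_nonneg) zero_le_one
          _ ≤ ρ := by linarith
      · right
        refine ⟨hqG, ?_⟩
        have : W (z, y) = z := if_neg hqG
        rw [mem_preimage, this] at hq
        exact hq
    · rintro (hq | ⟨hq, hq'⟩)
      · obtain ⟨i, ⟨z', y', v⟩, ⟨h1, h2, h3⟩, h⟩ := mem_iUnion.1 hq
        simp only [Prod.mk.injEq] at h
        obtain ⟨rfl, rfl⟩ := h
        have hqG : (z', y') ∈ G := mem_iUnion.2 ⟨i, h1⟩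
        rw [mem_preimage, hWG _ hqG]
        obtain ⟨hz, hy, e, he, hze, hdiv⟩ := h1
        have := IsDivPt.eq_of_extends hs0 hs1 (ht1 i) (hc e he) hze hk hdiv
          (hw (z', y')) h3
        rw [this]
        exact h2.2
      · have : W (z, y) = z := if_neg hq
        rw [mem_preimage, this]
        exact hq'
  rw [hpre]
  exact (MeasurableSet.iUnion fun i => (hT i).measurableSet).union
    (hGm.compl.inter (measurable_fst hC.measurableSet))

theorem ae_mem_extendable {M : Type*} [MetricSpace M] [MeasurableSpace M] [BorelSpace M]
    {d k ρ r : ℝ} {K K' : Set M} (hd : 0 ≤ d) (hG : GeodesicSpace M)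
    (hK : IsCompact K) (hK' : IsCompact K') {z : M} (hz : z ∈ K) (hr : r ≤ ρ)
    (hKK : closedBall z ρ ⊆ K') (hk : Real.sqrt |k| * ρ < 1) (hc : ContractsAt k z ρ)
    (hfin : μH[d] (ball z r) < ∞) {t : ℕ → ℝ} (ht0 : ∀ i, 0 < t i) (ht1 : ∀ i, t i < 1)
    (ht : Tendsto t atTop (𝓝 1)) :
    ∀ᵐ y ∂μH[d], y ∈ ball z r → (z, y) ∈ ⋃ i, extendable K K' ρ (t i) := by
  rcases le_or_gt r 0 with hr0 | hr0
  · rw [ball_eq_empty.2 hr0]; simp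
  set G := ⋃ i, extendable K K' ρ (t i)
  set S := {y : M | (z, y) ∈ G}
  have hSm : MeasurableSet S := by
    have : S = ⋃ i, {y : M | (z, y) ∈ extendable K K' ρ (t i)} := by
      ext y; simp [S, G]
    rw [this]
    exact MeasurableSet.iUnion fun i => ((isCompact_extendable hK hK' ρ (t i)).isClosed.preimage
      (show Continuous fun y : M => (z, y) by fun_prop)).measurableSet
  have hle : ∀ i, ENNReal.ofReal (t i * (1 - (1 - t i) * (Real.sqrt |k| * ρ))) ^ d *
      μH[d] (ball z r) ≤ μH[d] (ball z r ∩ S) := by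
    intro i
    choose f hf using fun y => hG.exists_isDivPt (ht0 i).le (ht1 i).le z y
    have hlam : 0 < t i * (1 - (1 - t i) * (Real.sqrt |k| * ρ)) := by
      apply mul_pos (ht0 i)
      have hρ : 0 ≤ Real.sqrt |k| * ρ := mul_nonneg (Real.sqrt_nonneg _) (hr0.le.trans hr)
      nlinarith [ht0 i, ht1 i]
    have hsub : ball z r ⊆ closedBall z ρ := ball_subset_closedBall.trans (closedBall_subset_closedBall hr)
    refine (hausdorffMeasure_le_image_of_expanding hd hlam (f := f) (A := ball z r)
      fun x hx y hy => hc.2 ρ le_rfl x (hsub hx) y (hsub hy) (t i) (ht0 i) (ht1 i).le _ _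
        (hf x) (hf y)).trans (measure_mono ?_)
    rintro _ ⟨y, hy, rfl⟩
    have hfb : f y ∈ ball z r := by
      rw [mem_ball', (hf y).1]
      rw [mem_ball'] at hy
      nlinarith [ht1 i, dist_nonneg (x := z) (y := y)]
    refine ⟨hfb, mem_iUnion.2 ⟨i, hz, hKK (hsub hfb), y, hKK (hsub hy), ?_, hf y⟩⟩
    exact mem_closedBall'.1 (hsub hy)
  have hlim : Tendsto (fun i => ENNReal.ofReal (t i * (1 - (1 - t i) * (Real.sqrt |k| * ρ))) ^ d *
      μH[d] (ball z r)) atTop (𝓝 (1 * μH[d] (ball z r))) := by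
    refine ENNReal.Tendsto.mul_const ?_ (Or.inl one_ne_zero)
    have h1 : Tendsto (fun i => t i * (1 - (1 - t i) * (Real.sqrt |k| * ρ))) atTop (𝓝 1) := by
      have := ht.mul ((tendsto_const_nhds (x := (1:ℝ))).sub
        (((tendsto_const_nhds (x := (1:ℝ))).sub ht).mul_const (Real.sqrt |k| * ρ)))
      simpa using this
    have h2 := (ENNReal.tendsto_ofReal h1).ennrpow_const d
    simpa using h2
  have hfull : μH[d] (ball z r) ≤ μH[d] (ball z r ∩ S) := by
    rw [one_mul] at hlim
    exact le_of_tendsto' hlim hle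
  have hdiff : μH[d] (ball z r \ S) = 0 := by
    have h1 := measure_inter_add_sdiff (μ := (μH[d] : Measure M)) (ball z r) hSm
    have h2 : μH[d] (ball z r ∩ S) + μH[d] (ball z r \ S) ≤ μH[d] (ball z r ∩ S) + 0 := by
      rw [h1, add_zero]; exact hfull
    have hne : μH[d] (ball z r ∩ S) ≠ ∞ := ((measure_mono inter_subset_left).trans_lt hfin).ne
    exact nonpos_iff_eq_zero.1 ((ENNReal.add_le_add_iff_left hne).1 h2)
  rw [ae_iff]
  convert hdiff using 2
  ext y
  simp [S]

theorem one_le_one_sub_pow_mul {x : ℝ} {n : ℕ} (hx0 : 0 ≤ x) (hx : n * x ≤ 1 / 2) (hx1 : x ≤ 1) :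
    1 ≤ (1 - x) ^ n * (1 + 2 * n * x) := by
  have h1 : 1 - n * x ≤ (1 - x) ^ n := by
    have := one_add_mul_le_pow (a := -x) (by linarith) n
    rw [← sub_eq_add_neg] at this
    linarith
  have h0 : 0 ≤ n * x := by positivity
  calc (1:ℝ) ≤ (1 - n * x) * (1 + 2 * n * x) := by nlinarith
    _ ≤ _ := by gcongr

theorem lintegral_comp_le_of_contraction {M : Type*} [MetricSpace M] [MeasurableSpace M]
    [BorelSpace M] {n : ℕ} {s x : ℝ} (hs : 0 < s) (hx0 : 0 ≤ x) (hx : n * x ≤ 1 / 2)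
    (hx1 : x ≤ 1 / 2) {f : M → M} (hfm : Measurable f) {A B : Set M}
    (hf : ∀ y ∈ A, ∀ y' ∈ A, s * (1 - x) * dist y y' ≤ dist (f y) (f y'))
    (hAB : MapsTo f A B) {g : M → ℝ≥0∞} (hg : Measurable g) :
    ∫⁻ y in A, g (f y) ∂μH[(n : ℝ)] ≤
      ENNReal.ofReal ((s ^ n)⁻¹ * (1 + 2 * n * x)) * ∫⁻ y in B, g y ∂μH[(n : ℝ)] := by
  have hl : 0 < s * (1 - x) := mul_pos hs (by linarith)
  have h := lintegral_comp_le_of_expanding n.cast_nonneg hl hfm hf hAB hg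
  rw [ENNReal.rpow_natCast, ← ENNReal.ofReal_pow hl.le] at h
  calc ∫⁻ y in A, g (f y) ∂μH[(n : ℝ)]
      = 1 * ∫⁻ y in A, g (f y) ∂μH[(n : ℝ)] := (one_mul _).symm
    _ ≤ ENNReal.ofReal ((s ^ n)⁻¹ * (1 + 2 * n * x)) * ENNReal.ofReal ((s * (1 - x)) ^ n) *
        ∫⁻ y in A, g (f y) ∂μH[(n : ℝ)] := by
      gcongr
      rw [← ENNReal.ofReal_mul (by positivity), ← ENNReal.ofReal_one]
      apply ENNReal.ofReal_le_ofReal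
      rw [mul_pow]
      have h1 := one_le_one_sub_pow_mul hx0 hx (by linarith)
      calc (1:ℝ) ≤ (1 - x) ^ n * (1 + 2 * n * x) := h1
        _ = (s ^ n)⁻¹ * (1 + 2 * n * x) * (s ^ n * (1 - x) ^ n) := by field_simp
    _ ≤ _ := by rw [mul_assoc]; gcongr

theorem AlexandrovSpace.exists_interpolation {M : Type*} [MetricSpace M] [MeasurableSpace M]
    [BorelSpace M] [SecondCountableTopology M] {n : ℕ} {k : ℝ} (hM : AlexandrovSpace M n k)
    {K : Set M} (hK : IsCompact K) :
    ∃ c r₀ : ℝ, 0 ≤ c ∧ 0 < r₀ ∧ ∀ s : ℝ, 0 < s → s < 1 →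
      ∃ (W : M × M → M) (G : Set (M × M)), Measurable W ∧ MeasurableSet G ∧
        (∀ q ∈ G, dist q.1 (W q) = s * dist q.1 q.2) ∧ ∀ r : ℝ, 0 < r → r < r₀ →
          (∀ z ∈ K, ∀ᵐ y ∂μH[(n : ℝ)], y ∈ ball z r → (z, y) ∈ G) ∧
          (∀ z, ∀ g : M → ℝ≥0∞, Measurable g →
            ∫⁻ y in {y | y ∈ ball z r ∧ (z, y) ∈ G}, g (W (z, y)) ∂μH[(n : ℝ)] ≤
              ENNReal.ofReal ((s ^ n)⁻¹ * (1 + c * r)) *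
                ∫⁻ y in ball z (s * r), g y ∂μH[(n : ℝ)]) ∧
          (∀ y, ∀ g : M → ℝ≥0∞, Measurable g →
            ∫⁻ z in {z | z ∈ ball y r ∧ (z, y) ∈ G}, g (W (z, y)) ∂μH[(n : ℝ)] ≤
              ENNReal.ofReal (((1 - s) ^ n)⁻¹ * (1 + s * (c * r))) *
                ∫⁻ w in ball y ((1 - s) * r), g w ∂μH[(n : ℝ)]) := by
  have := hM.curv.locallyCompact
  have := hM.isLocallyFiniteMeasure
  have hG := hM.curv.geodesic
  obtain ⟨δ, hδ, hK'⟩ := hK.exists_isCompact_cthickening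
  set K' := cthickening δ K
  obtain ⟨ρ₁, hρ₁, hc₁⟩ := hM.curv.exists_contractsAt hK'
  set a := Real.sqrt |k| with ha
  have ha0 : 0 ≤ a := Real.sqrt_nonneg _
  have hb : 0 < 2 * (n + 1) * (a + 1) := by positivity
  set ρ := min (min δ ρ₁) (1 / (2 * (n + 1) * (a + 1))) with hρ
  have hρ0 : 0 < ρ := by positivity
  have hρδ : ρ ≤ δ := (min_le_left _ _).trans (min_le_left _ _)
  have hρb : 2 * (n + 1) * (a + 1) * ρ ≤ 1 := by
    have : ρ ≤ 1 / (2 * (n + 1) * (a + 1)) := min_le_right _ _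
    rwa [le_div_iff₀ hb, mul_comm] at this
  have hna : 0 ≤ (n : ℝ) * a * ρ := by positivity
  have hnρ : 0 ≤ (n : ℝ) * ρ := by positivity
  have haρ0 : 0 ≤ a * ρ := by positivity
  have haρ : a * ρ ≤ 1 / 2 := by nlinarith
  have hnaρ : n * (a * ρ) ≤ 1 / 2 := by nlinarith
  have hc : ∀ q ∈ K', ContractsAt k q ρ := fun q hq =>
    (hc₁ q hq).mono ((min_le_left _ _).trans (min_le_right _ _))
  have hKK' : K ⊆ K' := self_subset_cthickening K
  have hKK : ∀ z ∈ K, closedBall z ρ ⊆ K' := fun z hz =>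
    (closedBall_subset_closedBall hρδ).trans (closedBall_subset_cthickening hz δ)
  refine ⟨2 * n * a, ρ, by positivity, hρ0, fun s hs0 hs1 => ?_⟩
  let t : ℕ → ℝ := fun i => 1 - 1 / ((i : ℝ) + 2)
  have ht0 : ∀ i, 0 < t i := fun i => by
    have : 1 / ((i : ℝ) + 2) < 1 := by
      rw [div_lt_one (by positivity)]; have := i.cast_nonneg (α := ℝ); linarith
    simp only [t]; linarith
  have ht1 : ∀ i, t i < 1 := fun i => by
    have : 0 < 1 / ((i : ℝ) + 2) := by positivity
    simp only [t]; linarith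
  have ht : Tendsto t atTop (𝓝 1) := by
    have h1 : Tendsto (fun i : ℕ => 1 / ((i : ℝ) + 2)) atTop (𝓝 0) := by
      have := (tendsto_one_div_add_atTop_nhds_zero_nat (𝕜 := ℝ)).comp (tendsto_add_atTop_nat 1)
      refine this.congr fun i => ?_
      simp only [Function.comp, Nat.cast_add, Nat.cast_one]; ring
    simpa [t] using h1.const_sub 1
  obtain ⟨W, hWm, hW⟩ := exists_measurable_divPt hG hK hK' hKK (by linarith) hc hs0.le hs1.le
    ht0 ht1
  set G := ⋃ i, extendable K K' ρ (t i)
  have hGK : ∀ q ∈ G, q.1 ∈ K ∧ q.2 ∈ K' := fun q hq => by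
    obtain ⟨i, hi⟩ := mem_iUnion.1 hq
    exact ⟨hi.1, hi.2.1⟩
  refine ⟨W, G, hWm, MeasurableSet.iUnion fun i =>
    (isCompact_extendable hK hK' ρ (t i)).measurableSet, fun q hq => (hW q hq).1,
    fun r hr0 hr => ⟨fun z hz => ?_, fun z g hg => ?_, fun y g hg => ?_⟩⟩
  · refine ae_mem_extendable n.cast_nonneg hG hK hK' hz hr.le (hKK z hz) (by linarith)
      (hc z (hKK' hz)) ?_ ht0 ht1 ht
    exact (measure_mono (ball_subset_closedBall.trans
      ((closedBall_subset_closedBall hr.le).trans (hKK z hz)))).trans_lt hK'.measure_lt_top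
  · rcases (({y | y ∈ ball z r ∧ (z, y) ∈ G} : Set M)).eq_empty_or_nonempty with he | ⟨y₀, -, hy₀⟩
    · rw [he]; simp
    have hz := (hGK _ hy₀).1
    have har : a * r ≤ a * ρ := by gcongr
    have har0 : 0 ≤ a * r := by positivity
    have hx : (1 - s) * (a * r) ≤ a * r := by nlinarith
    have hx0 : 0 ≤ (1 - s) * (a * r) := mul_nonneg (by linarith) har0
    refine (lintegral_comp_le_of_contraction (B := ball z (s * r)) hs0 hx0 ?_ ?_
      (hWm.comp measurable_prodMk_left) ?_ ?_ hg).trans ?_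
    · exact (mul_le_mul_of_nonneg_left (hx.trans har) n.cast_nonneg).trans hnaρ
    · linarith
    · rintro y ⟨hy, hyG⟩ y' ⟨hy', hyG'⟩
      exact (hc z (hKK' hz)).2 r hr.le y (ball_subset_closedBall hy) y'
        (ball_subset_closedBall hy') s hs0 hs1.le _ _ (hW _ hyG) (hW _ hyG')
    · rintro y ⟨hy, hyG⟩
      rw [mem_ball'] at hy ⊢
      have h := (hW _ hyG).1
      dsimp only at h
      dsimp only [Function.comp]
      rw [h]
      exact mul_lt_mul_of_pos_left hy hs0
    · gcongr ENNReal.ofReal (_ * (1 + ?_)) * _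
      nlinarith [mul_le_mul_of_nonneg_left hx (Nat.cast_nonneg (α := ℝ) n)]
  · rcases (({z | z ∈ ball y r ∧ (z, y) ∈ G} : Set M)).eq_empty_or_nonempty with he | ⟨z₀, -, hz₀⟩
    · rw [he]; simp
    have hy := (hGK _ hz₀).2
    have har : a * r ≤ a * ρ := by gcongr
    have har0 : 0 ≤ a * r := by positivity
    have hx : s * (a * r) ≤ a * r := by nlinarith
    have hx0 : 0 ≤ s * (a * r) := mul_nonneg hs0.le har0
    refine (lintegral_comp_le_of_contraction (B := ball y ((1 - s) * r)) (sub_pos.2 hs1) hx0 ?_ ?_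
      (hWm.comp measurable_prodMk_right) ?_ ?_ hg).trans ?_
    · exact (mul_le_mul_of_nonneg_left (hx.trans har) n.cast_nonneg).trans hnaρ
    · linarith
    · rintro z ⟨hz, hzG⟩ z' ⟨hz', hzG'⟩
      have := (hc y hy).2 r hr.le z (ball_subset_closedBall hz) z'
        (ball_subset_closedBall hz') (1 - s) (sub_pos.2 hs1) (by linarith) _ _ (hW _ hzG).symm
        (hW _ hzG').symm
      rwa [sub_sub_cancel] at this
    · rintro z ⟨hz, hzG⟩
      rw [mem_ball] at hz ⊢
      have h := (hW _ hzG).2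
      dsimp only at h
      dsimp only [Function.comp]
      rw [h]
      exact mul_lt_mul_of_pos_left hz (sub_pos.2 hs1)
    · gcongr ENNReal.ofReal (_ * (1 + ?_)) * _
      exact le_of_eq (by ring)

theorem exists_one_sub_rpow_le {p σ : ℝ} (hp : 1 < p) (hσ : 0 < σ) :
    ∃ C : ℝ, 0 < C ∧ ∀ x : ℝ, 0 ≤ x → x ≤ 1 → 1 - x ^ p ≤ σ + C * (x ^ p - 1 - p * (x - 1)) := by
  have hp0 : 0 < p := by linarith
  set B : ℝ → ℝ := fun x => x ^ p - 1 - p * (x - 1) with hB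
  have hBc : ContinuousOn B (Icc 0 (1 - σ / p)) := by
    have : Continuous B := by
      have := Real.continuous_rpow_const (q := p) hp0.le
      fun_prop
    exact this.continuousOn
  have hB0 : ∀ x, 0 ≤ x → 0 ≤ B x := fun x hx => by
    have := one_add_mul_self_le_rpow_one_add (s := x - 1) (by linarith) hp.le
    rw [add_sub_cancel] at this
    simp only [hB]; linarith
  have near : ∀ C : ℝ, 0 < C → ∀ x : ℝ, 0 ≤ x → 1 - σ / p ≤ x →
      1 - x ^ p ≤ σ + C * B x := by
    intro C hC x hx0 hx
    have h1 := hB0 x hx0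
    have h2 : p * (1 - x) ≤ σ := by
      have : p * (σ / p) = σ := by field_simp
      nlinarith
    have h3 : 0 ≤ C * B x := by positivity
    simp only [hB] at h1 h3 ⊢
    linarith
  rcases (Icc (0:ℝ) (1 - σ / p)).eq_empty_or_nonempty with he | hne
  · refine ⟨1, one_pos, fun x hx0 _ => near 1 one_pos x hx0 ?_⟩
    by_contra! hlt
    exact (he ▸ (⟨hx0, hlt.le⟩ : x ∈ Icc (0:ℝ) (1 - σ / p)) : x ∈ (∅ : Set ℝ))
  · obtain ⟨x₀, hx₀, hmin⟩ := isCompact_Icc.exists_isMinOn hne hBc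
    have hpos : 0 < B x₀ := by
      have hx1 : x₀ - 1 ≠ 0 := ne_of_lt <| by
        have : 0 < σ / p := by positivity
        have := hx₀.2
        linarith
      have := one_add_mul_self_lt_rpow_one_add (s := x₀ - 1) (by linarith [hx₀.1]) hx1 hp
      rw [add_sub_cancel] at this
      simp only [hB]; linarith
    refine ⟨(B x₀)⁻¹, inv_pos.2 hpos, fun x hx0 _ => ?_⟩
    rcases le_total (1 - σ / p) x with h | h
    · exact near _ (inv_pos.2 hpos) x hx0 h
    · have h1 : B x₀ ≤ B x := hmin ⟨hx0, h⟩
      have h2 : 1 ≤ (B x₀)⁻¹ * B x := by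
        rw [inv_mul_eq_div, le_div_iff₀ hpos]; linarith
      have h3 : 0 ≤ x ^ p := Real.rpow_nonneg hx0 p
      simp only [hB] at h2 ⊢
      linarith

theorem exists_mul_rpow_sub_le {p σ : ℝ} (hp : 1 < p) (hσ : 0 < σ) :
    ∃ C : ℝ, 0 < C ∧ ∀ s D h H : ℝ, 0 < s → s < 1 → 0 ≤ D → 0 ≤ h → 0 ≤ H →
      D ≤ s * h + (1 - s) * H →
      s * max (D ^ p - h ^ p) 0 + C * D ^ p ≤
        s * σ * D ^ p + C * (s * h ^ p + (1 - s) * H ^ p) := by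
  obtain ⟨C, hC, hCx⟩ := exists_one_sub_rpow_le hp hσ
  refine ⟨C, hC, fun s D h H hs0 hs1 hD hh hH hle => ?_⟩
  have hDp := Real.rpow_nonneg hD p
  rcases le_or_gt D h with hDh | hDh
  · have h1 : D ^ p ≤ h ^ p := Real.rpow_le_rpow hD hDh (by linarith)
    rw [max_eq_right (by linarith)]
    have h2 : D ^ p ≤ s * h ^ p + (1 - s) * H ^ p := by
      have h3 := (convexOn_rpow hp.le).2 (mem_Ici.2 hh) (mem_Ici.2 hH) hs0.le
        (sub_nonneg.2 hs1.le) (by ring)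
      simp only [smul_eq_mul] at h3
      exact (Real.rpow_le_rpow hD hle (by linarith)).trans h3
    have h3 : C * D ^ p ≤ C * (s * h ^ p + (1 - s) * H ^ p) := by gcongr
    have h4 : 0 ≤ s * σ * D ^ p := by positivity
    linarith
  · have hD0 : 0 < D := hh.trans_lt hDh
    have h1 : h ^ p ≤ D ^ p := Real.rpow_le_rpow hh hDh.le (by linarith)
    rw [max_eq_left (by linarith)]
    have hDpp : 0 < D ^ p := Real.rpow_pos_of_pos hD0 p
    set x := h / D
    set y := H / D
    have hx0 : 0 ≤ x := by positivity
    have hx1 : x ≤ 1 := (div_le_one hD0).2 hDh.le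
    have hy0 : 0 ≤ y := by positivity
    have hhx : h = x * D := by simp only [x]; field_simp
    have hHy : H = y * D := by simp only [y]; field_simp
    have hxy : 1 ≤ s * x + (1 - s) * y := by
      have h5 : D * 1 ≤ D * (s * x + (1 - s) * y) := by
        rw [hhx, hHy] at hle; linarith
      exact le_of_mul_le_mul_left h5 hD0
    rw [hhx, hHy, Real.mul_rpow hx0 hD, Real.mul_rpow hy0 hD]
    have h6 := hCx x hx0 hx1
    have h7 := one_add_mul_self_le_rpow_one_add (s := y - 1) (by linarith) hp.le
    rw [add_sub_cancel] at h7
    have h8 : (1 - s) * (1 + p * (y - 1)) ≤ (1 - s) * y ^ p :=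
      mul_le_mul_of_nonneg_left h7 (by linarith)
    have h9 : s * (x ^ p - 1 - p * (x - 1)) ≤ s * x ^ p + (1 - s) * y ^ p - 1 := by
      have : p * (s * (1 - x)) ≤ p * ((1 - s) * (y - 1)) :=
        mul_le_mul_of_nonneg_left (by linarith) (by linarith)
      nlinarith
    have h10 : s * (1 - x ^ p) ≤ s * σ + C * (s * x ^ p + (1 - s) * y ^ p - 1) := by
      have := mul_le_mul_of_nonneg_left h6 hs0.le
      have := mul_le_mul_of_nonneg_left h9 hC.le
      nlinarith
    have := mul_le_mul_of_nonneg_right h10 hDp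
    nlinarith

theorem exists_ofReal_rpow_sub_le {p σ : ℝ} (hp : 1 < p) (hσ : 0 < σ) :
    ∃ C : ℝ, 0 < C ∧ ∀ s D a b : ℝ, 0 < s → s < 1 → 0 ≤ D → 0 ≤ a → 0 ≤ b → D ≤ a + b →
      ENNReal.ofReal s * (ENNReal.ofReal (D ^ p) -
          ENNReal.ofReal ((s ^ p)⁻¹) * ENNReal.ofReal (a ^ p)) +
        ENNReal.ofReal C * ENNReal.ofReal (D ^ p) ≤
      ENNReal.ofReal (s * σ) * ENNReal.ofReal (D ^ p) + ENNReal.ofReal C *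
        (ENNReal.ofReal s * (ENNReal.ofReal ((s ^ p)⁻¹) * ENNReal.ofReal (a ^ p)) +
          ENNReal.ofReal (1 - s) *
            (ENNReal.ofReal (((1 - s) ^ p)⁻¹) * ENNReal.ofReal (b ^ p))) := by
  obtain ⟨C, hC, hCs⟩ := exists_mul_rpow_sub_le hp hσ
  refine ⟨C, hC, fun s D a b hs0 hs1 hD ha hb hle => ?_⟩
  have h1s : 0 < 1 - s := by linarith
  have h := hCs s D (a / s) (b / (1 - s)) hs0 hs1 hD (by positivity) (by positivity) (by
    rw [mul_div_cancel₀ _ hs0.ne', mul_div_cancel₀ _ h1s.ne']; exact hle)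
  rw [Real.div_rpow ha hs0.le, Real.div_rpow hb h1s.le, div_eq_inv_mul, div_eq_inv_mul] at h
  have hDp := Real.rpow_nonneg hD p
  have hap := Real.rpow_nonneg ha p
  have hbp := Real.rpow_nonneg hb p
  have hsp := Real.rpow_nonneg hs0.le p
  have hsp' := Real.rpow_nonneg h1s.le p
  have h' := ENNReal.ofReal_le_ofReal h
  have hmax : ENNReal.ofReal (max (D ^ p - (s ^ p)⁻¹ * a ^ p) 0) =
      ENNReal.ofReal (D ^ p) - ENNReal.ofReal ((s ^ p)⁻¹) * ENNReal.ofReal (a ^ p) := by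
    rw [ENNReal.ofReal_max, ENNReal.ofReal_zero, max_eq_left zero_le,
      ENNReal.ofReal_sub _ (by positivity), ENNReal.ofReal_mul (by positivity)]
  rwa [ENNReal.ofReal_add (by positivity) (by positivity), ENNReal.ofReal_mul hs0.le, hmax,
    ENNReal.ofReal_mul hC.le, ENNReal.ofReal_add (by positivity) (by positivity),
    ENNReal.ofReal_mul (q := D ^ p) (by positivity : 0 ≤ s * σ), ENNReal.ofReal_mul hC.le,
    ENNReal.ofReal_add (by positivity) (by positivity),
    ENNReal.ofReal_mul (q := (s ^ p)⁻¹ * a ^ p) hs0.le,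
    ENNReal.ofReal_mul (q := ((1 - s) ^ p)⁻¹ * b ^ p) h1s.le,
    ENNReal.ofReal_mul (q := a ^ p) (by positivity),
    ENNReal.ofReal_mul (q := b ^ p) (by positivity)] at h'

/-- The normalised average `r ^ (-q) ∫_{B_z(r)} f (z, y) dμ(y)`. -/
def ballAvg {M : Type*} [MetricSpace M] [MeasurableSpace M] (μ : Measure M) (q : ℝ)
    (f : M × M → ℝ≥0∞) (r : ℝ) (z : M) : ℝ≥0∞ :=
  ENNReal.ofReal ((r ^ q)⁻¹) * ∫⁻ y in ball z r, f (z, y) ∂μ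

section

variable {M : Type*} [MetricSpace M] [MeasurableSpace M] [BorelSpace M]
  [SecondCountableTopology M]

theorem measurable_lintegral_ball (μ : Measure M) [SFinite μ] {f : M × M → ℝ≥0∞}
    (hf : Measurable f) (r : ℝ) : Measurable fun z => ∫⁻ y in ball z r, f (z, y) ∂μ := by
  have h : MeasurableSet {q : M × M | dist q.2 q.1 < r} :=
    (isOpen_lt (by fun_prop) (by fun_prop)).measurableSet
  have h1 : ∀ z, ∫⁻ y in ball z r, f (z, y) ∂μ =
      ∫⁻ y, {q : M × M | dist q.2 q.1 < r}.indicator f (z, y) ∂μ := by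
    intro z
    rw [← lintegral_indicator measurableSet_ball]
    rfl
  simp_rw [h1]
  exact (hf.indicator h).lintegral_prod_right'

theorem measurable_ballAvg (μ : Measure M) [SFinite μ] (q : ℝ) {f : M × M → ℝ≥0∞}
    (hf : Measurable f) (r : ℝ) : Measurable (ballAvg μ q f r) :=
  (measurable_lintegral_ball μ hf r).const_mul _

theorem lintegral_lintegral_ball_comm (μ : Measure M) [SFinite μ] {f : M × M → ℝ≥0∞}
    (hf : Measurable f) {G : Set (M × M)} (hG : MeasurableSet G) (r : ℝ) :
    ∫⁻ z, ∫⁻ y in {y | y ∈ ball z r ∧ (z, y) ∈ G}, f (z, y) ∂μ ∂μ =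
      ∫⁻ y, ∫⁻ z in {z | z ∈ ball y r ∧ (z, y) ∈ G}, f (z, y) ∂μ ∂μ := by
  have h : MeasurableSet {q : M × M | dist q.2 q.1 < r ∧ q ∈ G} :=
    (isOpen_lt (f := fun q : M × M => dist q.2 q.1) (g := fun _ => r)
      (by fun_prop) (by fun_prop)).measurableSet.inter hG
  set F := {q : M × M | dist q.2 q.1 < r ∧ q ∈ G}.indicator f
  have h1 : ∀ z, ∫⁻ y in {y | y ∈ ball z r ∧ (z, y) ∈ G}, f (z, y) ∂μ = ∫⁻ y, F (z, y) ∂μ := by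
    intro z
    have hm : MeasurableSet {y | y ∈ ball z r ∧ (z, y) ∈ G} := measurable_prodMk_left h
    rw [← lintegral_indicator hm]
    rfl
  have h2 : ∀ y, ∫⁻ z in {z | z ∈ ball y r ∧ (z, y) ∈ G}, f (z, y) ∂μ = ∫⁻ z, F (z, y) ∂μ := by
    intro y
    have he : {z | z ∈ ball y r ∧ (z, y) ∈ G} = (fun z => (z, y)) ⁻¹'
        {q : M × M | dist q.2 q.1 < r ∧ q ∈ G} := by
      ext z
      simp only [mem_ofPred_eq, mem_preimage, mem_ball, dist_comm y z]
    rw [he, ← lintegral_indicator (measurable_prodMk_right h)]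
    rfl
  simp_rw [h1, h2]
  exact lintegral_lintegral_swap (hf.indicator h).aemeasurable

theorem lintegral_mul_lintegral_ball_comm (μ : Measure M) [SFinite μ] {f : M × M → ℝ≥0∞}
    (hf : Measurable f) {g : M → ℝ≥0∞} (hg : Measurable g)
    (r : ℝ) :
    ∫⁻ y, ∫⁻ w in ball y r, g w * f (w, y) ∂μ ∂μ =
      ∫⁻ w, g w * ∫⁻ y in ball w r, f (w, y) ∂μ ∂μ := by
  have h := lintegral_lintegral_ball_comm μ (f := fun q => g q.1 * f q)
    ((hg.comp measurable_fst).mul hf) MeasurableSet.univ r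
  simp only [mem_univ, and_true, ofPred_mem_eq] at h
  rw [← h]
  refine lintegral_congr fun z => ?_
  exact lintegral_const_mul _ (hf.comp measurable_prodMk_left)

end

theorem AlexandrovSpace.exists_step {M : Type*} [MetricSpace M] [MeasurableSpace M]
    [BorelSpace M] [SecondCountableTopology M] {n : ℕ} {k p : ℝ} (hM : AlexandrovSpace M n k)
    (hp : 1 < p) {Y : Type*} [MetricSpace Y] {u : M → Y}
    (hu : Measurable fun q : M × M => dist (u q.1) (u q.2)) {K : Set M} (hK : IsCompact K) :
    ∃ c r₀ : ℝ, 0 ≤ c ∧ 0 < r₀ ∧ ∀ σ : ℝ, 0 < σ → ∃ C : ℝ, 0 < C ∧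
      ∀ s r : ℝ, 0 < s → s < 1 → 0 < r → r < r₀ → ∀ φ g : M → ℝ≥0∞,
        Measurable φ → Measurable g → (∀ z ∉ K, φ z = 0) →
        (∀ z w, dist z w ≤ s * r → φ z ≤ g w) →
        let a := ballAvg (μH[(n : ℝ)] : Measure M) (n + p)
          (fun q => ENNReal.ofReal (dist (u q.1) (u q.2) ^ p))
        ENNReal.ofReal s * ∫⁻ z, φ z * (a r z - ENNReal.ofReal (1 + c * r) * a (s * r) z)
            ∂μH[(n : ℝ)] + ENNReal.ofReal C * ∫⁻ z, φ z * a r z ∂μH[(n : ℝ)] ≤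
          ENNReal.ofReal (s * σ) * ∫⁻ z, φ z * a r z ∂μH[(n : ℝ)] + ENNReal.ofReal C *
            (ENNReal.ofReal (s * (1 + c * r)) * ∫⁻ z, φ z * a (s * r) z ∂μH[(n : ℝ)] +
              ENNReal.ofReal ((1 - s) * (1 + s * (c * r))) *
                ∫⁻ z, g z * a ((1 - s) * r) z ∂μH[(n : ℝ)]) := by
  have := hM.isLocallyFiniteMeasure
  obtain ⟨c, r₀, hc, hr₀, hint⟩ := hM.exists_interpolation hK
  refine ⟨c, r₀, hc, hr₀, fun σ hσ => ?_⟩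
  obtain ⟨C, hC, hCs⟩ := exists_ofReal_rpow_sub_le hp hσ
  refine ⟨C, hC, fun s r hs0 hs1 hr0 hr φ g hφ hg hφK hφg => ?_⟩
  intro a
  set μ : Measure M := μH[(n : ℝ)]
  obtain ⟨W, G, hWm, hGm, hWd, hWr⟩ := hint s hs0 hs1
  obtain ⟨hae, hmc1, hmc2⟩ := hWr r hr0 hr
  set f : M × M → ℝ≥0∞ := fun q => ENNReal.ofReal (dist (u q.1) (u q.2) ^ p) with hfdef
  have hf : Measurable f := (hu.pow_const p).ennreal_ofReal
  have h1s : 0 < 1 - s := by linarith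
  have hcr : 0 ≤ c * r := by positivity
  set α := ENNReal.ofReal ((s ^ p)⁻¹)
  set α' := ENNReal.ofReal (((1 - s) ^ p)⁻¹)
  set β := ENNReal.ofReal ((s ^ n)⁻¹ * (1 + c * r))
  set γ := ENNReal.ofReal (((1 - s) ^ n)⁻¹ * (1 + s * (c * r)))
  set η := ENNReal.ofReal ((r ^ ((n : ℝ) + p))⁻¹)
  set S := ENNReal.ofReal s
  set S' := ENNReal.ofReal (1 - s)
  set J : ℝ → M → ℝ≥0∞ := fun t z => ∫⁻ y in ball z t, f (z, y) ∂μ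
  have haJ : ∀ t z, a t z = ENNReal.ofReal ((t ^ ((n : ℝ) + p))⁻¹) * J t z := fun t z => rfl
  set T : M → Set M := fun z => {y | y ∈ ball z r ∧ (z, y) ∈ G}
  have hTm : ∀ z, MeasurableSet (T z) := fun z =>
    measurableSet_ball.inter (measurable_prodMk_left hGm)
  have hpow : ∀ t b : ℝ, 0 < t → 0 ≤ b →
      η * (ENNReal.ofReal ((t ^ p)⁻¹) * ENNReal.ofReal ((t ^ n)⁻¹ * b)) =
        ENNReal.ofReal b * ENNReal.ofReal (((t * r) ^ ((n : ℝ) + p))⁻¹) := by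
    intro t b ht hb
    rw [← ENNReal.ofReal_mul (by positivity), ← ENNReal.ofReal_mul (by positivity),
      ← ENNReal.ofReal_mul hb]
    congr 1
    rw [Real.mul_rpow ht.le hr0.le, Real.rpow_add ht, Real.rpow_natCast, mul_inv, mul_inv]
    ring
  -- the pointwise inequality, integrated in `y`
  have hptw : ∀ z ∈ K, S * (J r z - α * (β * J (s * r) z)) + ENNReal.ofReal C * J r z ≤
      ENNReal.ofReal (s * σ) * J r z + ENNReal.ofReal C *
        (S * (α * (β * J (s * r) z)) + S' * (α' * ∫⁻ y in T z, f (W (z, y), y) ∂μ)) := by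
    intro z hz
    have hJ : J r z = ∫⁻ y in T z, f (z, y) ∂μ := by
      refine setLIntegral_congr ?_
      filter_upwards [hae z hz] with y hy
      exact propext ⟨fun h => ⟨h, hy h⟩, fun h => h.1⟩
    have hm1 : Measurable fun y => f (z, y) := hf.comp measurable_prodMk_left
    have hWz : Measurable fun y => W (z, y) := hWm.comp measurable_prodMk_left
    have hm2 : Measurable fun y => f (z, W (z, y)) := hm1.comp hWz
    have hm3 : Measurable fun y => f (W (z, y), y) := hf.comp (hWz.prodMk measurable_id)
    have hle1 : ∫⁻ y in T z, f (z, W (z, y)) ∂μ ≤ β * J (s * r) z :=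
      hmc1 z (fun y => f (z, y)) hm1
    have hsub : J r z - α * (β * J (s * r) z) ≤
        ∫⁻ y in T z, (f (z, y) - α * f (z, W (z, y))) ∂μ := by
      refine le_trans ?_ (lintegral_sub_le _ _ (hm2.const_mul α))
      rw [lintegral_const_mul _ hm2, hJ]
      gcongr
    calc S * (J r z - α * (β * J (s * r) z)) + ENNReal.ofReal C * J r z
        ≤ S * (∫⁻ y in T z, (f (z, y) - α * f (z, W (z, y))) ∂μ) +
          ENNReal.ofReal C * ∫⁻ y in T z, f (z, y) ∂μ := by rw [← hJ]; gcongr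
      _ = ∫⁻ y in T z, (S * (f (z, y) - α * f (z, W (z, y))) +
            ENNReal.ofReal C * f (z, y)) ∂μ := by
          rw [lintegral_add_right _ (hm1.const_mul _), lintegral_const_mul _ hm1,
            lintegral_const_mul' _ _ ENNReal.ofReal_ne_top]
      _ ≤ ∫⁻ y in T z, (ENNReal.ofReal (s * σ) * f (z, y) + ENNReal.ofReal C *
            (S * (α * f (z, W (z, y))) + S' * (α' * f (W (z, y), y)))) ∂μ := by
          refine lintegral_mono fun y => ?_
          exact hCs s _ _ _ hs0 hs1 dist_nonneg dist_nonneg dist_nonneg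
            (dist_triangle (u z) (u (W (z, y))) (u y))
      _ = ENNReal.ofReal (s * σ) * J r z + ENNReal.ofReal C *
            (S * (α * ∫⁻ y in T z, f (z, W (z, y)) ∂μ) +
              S' * (α' * ∫⁻ y in T z, f (W (z, y), y) ∂μ)) := by
          rw [lintegral_add_left (hm1.const_mul _), lintegral_const_mul _ hm1,
            lintegral_const_mul' _ _ ENNReal.ofReal_ne_top,
            lintegral_add_left ((hm2.const_mul _).const_mul _),
            lintegral_const_mul' _ _ ENNReal.ofReal_ne_top, lintegral_const_mul _ hm2,
            lintegral_const_mul' _ _ ENNReal.ofReal_ne_top, lintegral_const_mul _ hm3, hJ]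
      _ ≤ _ := by gcongr
  have hswap : ∫⁻ z, φ z * ∫⁻ y in T z, f (W (z, y), y) ∂μ ∂μ ≤
      γ * ∫⁻ w, g w * J ((1 - s) * r) w ∂μ := by
    have hWy : ∀ y, Measurable fun w => g w * f (w, y) := fun y =>
      hg.mul (hf.comp measurable_prodMk_right)
    calc ∫⁻ z, φ z * ∫⁻ y in T z, f (W (z, y), y) ∂μ ∂μ
        ≤ ∫⁻ z, ∫⁻ y in T z, g (W (z, y)) * f (W (z, y), y) ∂μ ∂μ := by
          refine lintegral_mono fun z => ?_
          have hWz : Measurable fun y => W (z, y) := hWm.comp measurable_prodMk_left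
          have hm : Measurable fun y => f (W (z, y), y) := hf.comp (hWz.prodMk measurable_id)
          rw [← lintegral_const_mul _ hm]
          refine setLIntegral_mono' (hTm z) fun y hy => ?_
          gcongr
          apply hφg
          have h := hWd _ hy.2
          dsimp only at h
          rw [h]
          have h2 : dist z y < r := mem_ball'.1 hy.1
          gcongr
      _ = ∫⁻ y, ∫⁻ z in {z | z ∈ ball y r ∧ (z, y) ∈ G},
            g (W (z, y)) * f (W (z, y), y) ∂μ ∂μ :=
          lintegral_lintegral_ball_comm μ (f := fun q => g (W q) * f (W q, q.2))
            ((hg.comp hWm).mul (hf.comp (hWm.prodMk measurable_snd))) hGm r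
      _ ≤ ∫⁻ y, γ * ∫⁻ w in ball y ((1 - s) * r), g w * f (w, y) ∂μ ∂μ :=
          lintegral_mono fun y => hmc2 y (fun w => g w * f (w, y)) (hWy y)
      _ ≤ γ * ∫⁻ y, ∫⁻ w in ball y ((1 - s) * r), g w * f (w, y) ∂μ ∂μ := by
          rw [lintegral_const_mul' _ _ ENNReal.ofReal_ne_top]
      _ = _ := by rw [lintegral_mul_lintegral_ball_comm μ hf hg]
  have hJm : ∀ t, Measurable (J t) := fun t => measurable_lintegral_ball μ hf t
  have ham : ∀ t, Measurable (a t) := fun t => measurable_ballAvg μ _ hf t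
  have hkey1 : ∀ z, η * (α * (β * J (s * r) z)) = ENNReal.ofReal (1 + c * r) * a (s * r) z := by
    intro z
    rw [haJ, ← mul_assoc, ← mul_assoc, mul_assoc η, hpow s _ hs0 (by positivity), mul_assoc]
  set V : M → ℝ≥0∞ := fun z => ∫⁻ y in T z, f (W (z, y), y) ∂μ
  have hptw' : ∀ z, S * (φ z * (a r z - ENNReal.ofReal (1 + c * r) * a (s * r) z)) +
      ENNReal.ofReal C * (φ z * a r z) ≤ ENNReal.ofReal (s * σ) * (φ z * a r z) +
        ENNReal.ofReal C * (S * (ENNReal.ofReal (1 + c * r) * (φ z * a (s * r) z)) +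
          S' * (η * (α' * (φ z * V z)))) := by
    intro z
    by_cases hz : z ∈ K
    · have h := mul_le_mul_right (hptw z hz) (φ z * η)
      rw [← hkey1, haJ r]
      have hη : η ≠ ∞ := ENNReal.ofReal_ne_top
      calc _ = φ z * η * (S * (J r z - α * (β * J (s * r) z)) + ENNReal.ofReal C * J r z) := by
            rw [← ENNReal.mul_sub fun _ _ => hη]; ring
        _ ≤ _ := h
        _ = ENNReal.ofReal (s * σ) * (φ z * (η * J r z)) + ENNReal.ofReal C *
              (S * (φ z * (η * (α * (β * J (s * r) z)))) + S' * (η * (α' * (φ z * V z)))) := by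
            ring
        _ = _ := by rw [hkey1]; ring
    · simp [hφK z hz]
  have hφa : ∀ t, Measurable fun z => φ z * a t z := fun t => hφ.mul (ham t)
  have hint2 := lintegral_mono (μ := μ) hptw'
  rw [lintegral_add_right _ ((hφa r).const_mul _), lintegral_add_left ((hφa r).const_mul _),
    lintegral_const_mul' _ _ ENNReal.ofReal_ne_top, lintegral_const_mul' _ _ ENNReal.ofReal_ne_top,
    lintegral_const_mul' _ _ ENNReal.ofReal_ne_top, lintegral_const_mul' _ _ ENNReal.ofReal_ne_top,
    lintegral_add_left (((hφa _).const_mul _).const_mul _),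
    lintegral_const_mul' _ _ ENNReal.ofReal_ne_top, lintegral_const_mul' _ _ ENNReal.ofReal_ne_top,
    lintegral_const_mul' _ _ ENNReal.ofReal_ne_top, lintegral_const_mul' _ _ ENNReal.ofReal_ne_top,
    lintegral_const_mul' _ _ ENNReal.ofReal_ne_top] at hint2
  refine hint2.trans ?_
  rw [ENNReal.ofReal_mul (q := 1 + c * r) hs0.le, ENNReal.ofReal_mul h1s.le, mul_assoc S,
    mul_assoc S']
  gcongr _ + _ * (_ + _ * ?_)
  calc η * (α' * ∫⁻ z, φ z * V z ∂μ)
      ≤ η * (α' * (γ * ∫⁻ w, g w * J ((1 - s) * r) w ∂μ)) := by gcongr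
    _ = ENNReal.ofReal (1 + s * (c * r)) * ∫⁻ z, g z * a ((1 - s) * r) z ∂μ := by
      rw [← mul_assoc, ← mul_assoc, mul_assoc η, hpow (1 - s) _ h1s (by positivity), mul_assoc,
        ← lintegral_const_mul' _ _ ENNReal.ofReal_ne_top]
      congr 1
      refine lintegral_congr fun z => ?_
      rw [haJ]; ring

theorem measurable_dist_prod {M Y : Type*} [MeasurableSpace M] [MetricSpace Y] {u : M → Y}
    (hu : ∀ P : Y, Measurable fun x => dist (u x) P)
    (hsep : TopologicalSpace.IsSeparable (range u)) :
    Measurable fun q : M × M => dist (u q.1) (u q.2) := by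
  obtain ⟨t, -, htc, ht⟩ := hsep.exists_countable_dense_subset
  refine measurable_of_Iio fun a => ?_
  have he : (fun q : M × M => dist (u q.1) (u q.2)) ⁻¹' Iio a =
      ⋃ P ∈ t, {q : M × M | dist (u q.1) P + dist (u q.2) P < a} := by
    ext q
    simp only [mem_preimage, mem_Iio, mem_iUnion, mem_ofPred_eq, exists_prop]
    constructor
    · intro h
      obtain ⟨P, hP, hPd⟩ := Metric.mem_closure_iff.1 (ht (mem_range_self q.1))
        ((a - dist (u q.1) (u q.2)) / 2) (by linarith)
      refine ⟨P, hP, ?_⟩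
      have := dist_triangle_left (u q.2) P (u q.1)
      linarith
    · rintro ⟨P, -, h⟩
      exact (dist_triangle_right _ _ P).trans_lt h
  rw [he]
  exact MeasurableSet.biUnion htc fun P _ => measurableSet_lt
    (((hu P).comp measurable_fst).add ((hu P).comp measurable_snd)) measurable_const

theorem exists_small_of_telescoping {A : ℝ → ℝ} {X : ℝ → ℝ → ℝ} {L E q r₁ : ℝ} (hr₁ : 0 < r₁)
    (hstep : ∀ σ : ℝ, 0 < σ → ∃ C c r₀ : ℝ, 0 < C ∧ 0 ≤ c ∧ 0 < r₀ ∧ ∀ r : ℝ, 0 < r → r < r₀ →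
      ∀ N : ℕ, 2 ≤ N → X r (r / N) ≤
        σ + c * r + C * (A (r / N) + (N - 1) * A ((N - 1) * (r / N)) - N * A r))
    (hA : Tendsto A (𝓝[>] 0) (𝓝 L))
    (hX : ∀ b r ε t : ℝ, 0 < b → 0 < r → r ≤ ε → ε < r₁ → b * ε ≤ r → 0 < t → t < r₁ →
      X ε t ≤ A ε - A r + ((b ^ q)⁻¹ - 1) * E + X r t)
    {η : ℝ} (hη : 0 < η) :
    ∃ ε₀ : ℝ, 0 < ε₀ ∧ ∀ ε : ℝ, 0 < ε → ε < ε₀ → ∀ t₀ : ℝ, 0 < t₀ →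
      ∃ t : ℝ, 0 < t ∧ t < t₀ ∧ X ε t ≤ η := by
  obtain ⟨m, hm2, hm⟩ : ∃ m : ℕ, 2 ≤ m ∧ (((1 - 1 / (m : ℝ)) ^ q)⁻¹ - 1) * E ≤ η / 4 := by
    have h1 : Tendsto (fun m : ℕ => (((1 - 1 / (m : ℝ)) ^ q)⁻¹ - 1) * E) atTop (𝓝 0) := by
      have h2 : Tendsto (fun m : ℕ => 1 - 1 / (m : ℝ)) atTop (𝓝 1) := by
        simpa using tendsto_one_div_atTop_nhds_zero_nat.const_sub (1 : ℝ)
      have h3 := ((h2.rpow_const (p := q) (Or.inl one_ne_zero)).inv₀ (by simp)).sub_const 1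
      simpa using h3.mul_const E
    have h2 := h1.eventually (ge_mem_nhds (show (0:ℝ) < η / 4 by positivity))
    obtain ⟨m, h, h'⟩ := (h2.and (eventually_ge_atTop 2)).exists
    exact ⟨m, h', h⟩
  obtain ⟨C, c, r₀, hC, hc, hr₀, hst⟩ := hstep (η / 4) (by positivity)
  have hm0 : (2:ℝ) ≤ m := by exact_mod_cast hm2
  set θ := min (η / 16) (η / (16 * C * m)) with hθ
  have hθ0 : 0 < θ := by positivity
  have hθ1 : θ ≤ η / 16 := min_le_left _ _
  have hθ2 : C * m * θ ≤ η / 16 := by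
    have : θ ≤ η / (16 * C * m) := min_le_right _ _
    rw [le_div_iff₀ (by positivity)] at this
    linarith
  have hev : ∀ᶠ r in 𝓝[>] (0:ℝ), |A r - L| ≤ θ := by
    have := hA.eventually (Metric.closedBall_mem_nhds L hθ0)
    filter_upwards [this] with r hr
    rwa [Real.dist_eq] at hr
  obtain ⟨δ, hδ, hδA⟩ := mem_nhdsGT_iff_exists_Ioo_subset.1 hev
  replace hδ : 0 < δ := hδ
  set ε₀ := min (min r₀ r₁) (min δ (η / (8 * (c + 1))))
  refine ⟨ε₀, by positivity, fun ε hε hεε t₀ ht₀ => ?_⟩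
  have hεr₀ : ε < r₀ := hεε.trans_le ((min_le_left _ _).trans (min_le_left _ _))
  have hεr₁ : ε < r₁ := hεε.trans_le ((min_le_left _ _).trans (min_le_right _ _))
  have hεδ : ε < δ := hεε.trans_le ((min_le_right _ _).trans (min_le_left _ _))
  have hεc : c * ε ≤ η / 8 := by
    have : ε < η / (8 * (c + 1)) := hεε.trans_le ((min_le_right _ _).trans (min_le_right _ _))
    rw [lt_div_iff₀ (by positivity)] at this
    nlinarith
  have hAθ : ∀ r, 0 < r → r ≤ ε → |A r - L| ≤ θ := fun r h0 h1 => hδA ⟨h0, h1.trans_lt hεδ⟩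
  obtain ⟨l₀, hl₀⟩ := exists_nat_gt (ε / t₀)
  set l := l₀ + 1 with hl
  have hl0 : (0:ℝ) < l := by simp only [hl]; positivity
  have hl1 : (1:ℝ) ≤ l := by simp only [hl]; push_cast; linarith [l₀.cast_nonneg (α := ℝ)]
  set t := ε / (m * l) with ht
  have ht0 : 0 < t := by positivity
  have hml : (m * l : ℝ) * t = ε := by simp only [ht]; field_simp
  have htt₀ : t < t₀ := by
    rw [ht, div_lt_iff₀ (by positivity)]
    rw [div_lt_iff₀ ht₀] at hl₀
    have : (l₀ : ℝ) ≤ m * l := by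
      have : (l : ℝ) = l₀ + 1 := by simp [hl]
      nlinarith [l₀.cast_nonneg (α := ℝ)]
    nlinarith
  have htε : t ≤ ε := by
    have : (1:ℝ) ≤ m * l := by nlinarith
    calc t = 1 * t := (one_mul t).symm
      _ ≤ m * l * t := by gcongr
      _ = ε := hml
  set G : ℕ → ℝ := fun j => (((m - 1) * l + j : ℝ)) * A (((m - 1) * l + j) * t) with hG
  have hsum : ∑ j ∈ Finset.range l, X (((m - 1) * l + (j + 1)) * t) t ≤
      ∑ j ∈ Finset.range l, (η / 4 + η / 8 + 2 * (C * m * θ)) := by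
    calc ∑ j ∈ Finset.range l, X (((m - 1) * l + (j + 1)) * t) t
        ≤ ∑ j ∈ Finset.range l, (η / 4 + η / 8 + C * (A t + (G j - G (j + 1)))) := by
          refine Finset.sum_le_sum fun j hj => ?_
          have hjl : (j : ℝ) + 1 ≤ l := by exact_mod_cast Finset.mem_range.1 hj
          set N : ℕ := (m - 1) * l + (j + 1) with hN
          have hNr : (N : ℝ) = (m - 1) * l + (j + 1) := by
            simp only [hN]; push_cast [Nat.cast_sub (show 1 ≤ m by omega)]; ring
          have hN2 : 2 ≤ N := by
            have : 1 ≤ (m - 1) * l := Nat.mul_pos (by omega) (by omega)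
            omega
          have hN0 : (0:ℝ) < N := by positivity
          have hNε : N * t ≤ ε := by
            rw [← hml, hNr]
            gcongr
            linarith
          have h := hst (N * t) (by positivity) (hNε.trans_lt hεr₀) N hN2
          rw [mul_div_cancel_left₀ _ hN0.ne'] at h
          have h4 : c * (N * t) ≤ c * ε := by gcongr
          have h5 : ((N : ℝ) - 1) = (m - 1) * l + j := by rw [hNr]; ring
          rw [h5, hNr] at h
          simp only [hG]
          push_cast
          rw [hNr] at h4
          linarith
      _ = l * (η / 4 + η / 8) + C * (l * A t + (G 0 - G l)) := by
          simp only [Finset.sum_add_distrib, ← Finset.mul_sum, Finset.sum_range_sub',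
            Finset.sum_const, Finset.card_range, nsmul_eq_mul]
          ring
      _ ≤ l * (η / 4 + η / 8) + C * (l * (2 * m * θ)) := by
          gcongr
          have h1 := (abs_le.1 (hAθ t ht0 htε)).2
          have hmm : 0 < ((m : ℝ) - 1) * l := mul_pos (by linarith) hl0
          have h2 := (abs_le.1 (hAθ ((m - 1) * l * t) (by positivity) (by
            rw [← hml]; gcongr; linarith))).2
          have h3 := (abs_le.1 (hAθ ε hε le_rfl)).1
          have e1 : ((m : ℝ) - 1) * l + l = m * l := by ring
          simp only [hG, Nat.cast_zero, add_zero, e1, hml]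
          have k1 := mul_le_mul_of_nonneg_left h1 hl0.le
          have k2 := mul_le_mul_of_nonneg_left h2 hmm.le
          have k3 := mul_le_mul_of_nonneg_left h3 (show 0 ≤ (m : ℝ) * l by positivity)
          nlinarith
      _ = ∑ j ∈ Finset.range l, (η / 4 + η / 8 + 2 * (C * m * θ)) := by
          rw [Finset.sum_const, Finset.card_range, nsmul_eq_mul]; ring
  obtain ⟨j, hj, hXj⟩ := Finset.exists_le_of_sum_le (Finset.nonempty_range_iff.2 (by omega)) hsum
  refine ⟨t, ht0, htt₀, ?_⟩
  have hjl : (j : ℝ) + 1 ≤ l := by exact_mod_cast Finset.mem_range.1 hj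
  have hmm : 0 < ((m : ℝ) - 1) * l := mul_pos (by linarith) hl0
  have hr0 : 0 < ((m - 1) * l + (j + 1)) * t := by positivity
  have hrε : ((m - 1) * l + (j + 1)) * t ≤ ε := by
    rw [← hml]; gcongr; linarith
  have hb : (0:ℝ) < 1 - 1 / m := by
    rw [sub_pos, div_lt_one (by linarith)]; linarith
  have h := hX (1 - 1 / m) _ ε t hb hr0 hrε hεr₁ (by
    have : (1 - 1 / (m:ℝ)) * ε = (m - 1) * l * t := by
      rw [← hml]; field_simp
    rw [this]
    gcongr
    linarith [j.cast_nonneg (α := ℝ)]) ht0 (htε.trans_lt hεr₁)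
  have h1 := (abs_le.1 (hAθ _ hr0 hrε)).1
  have h2 := (abs_le.1 (hAθ ε hε le_rfl)).2
  linarith

theorem ballAvg_le {M : Type*} [MetricSpace M] [MeasurableSpace M] (μ : Measure M) {q : ℝ}
    (hq : 0 ≤ q) (f : M × M → ℝ≥0∞) {b r ε : ℝ} (hb : 0 < b) (hr : 0 < r) (hrε : r ≤ ε)
    (hbr : b * ε ≤ r) (z : M) :
    ballAvg μ q f r z ≤ ENNReal.ofReal ((b ^ q)⁻¹) * ballAvg μ q f ε z := by
  have hε : 0 < ε := hr.trans_le hrε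
  rw [ballAvg, ballAvg, ← mul_assoc, ← ENNReal.ofReal_mul (by positivity), ← mul_inv,
    ← Real.mul_rpow hb.le hε.le]
  gcongr

theorem lintegral_mul_tsub_add_le {M : Type*} [MetricSpace M] [MeasurableSpace M] [BorelSpace M]
    [SecondCountableTopology M] (μ : Measure M) [SFinite μ] {q : ℝ}
    (hq : 0 ≤ q) {f : M × M → ℝ≥0∞} (hf : Measurable f) {φ : M → ℝ≥0∞} (hφ : Measurable φ)
    {b r ε : ℝ} (hb : 0 < b) (hr : 0 < r) (hrε : r ≤ ε) (hbr : b * ε ≤ r) :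
    ∫⁻ z, φ z * (ballAvg μ q f ε z - ballAvg μ q f r z) ∂μ + ∫⁻ z, φ z * ballAvg μ q f r z ∂μ ≤
      ENNReal.ofReal ((b ^ q)⁻¹) * ∫⁻ z, φ z * ballAvg μ q f ε z ∂μ := by
  have hm := measurable_ballAvg μ q hf
  rw [← lintegral_add_right _ (hφ.fun_mul (hm r)), ← lintegral_const_mul _ (hφ.fun_mul (hm ε))]
  refine lintegral_mono fun z => ?_
  have hε : 0 < ε := hr.trans_le hrε
  have hb1 : b ≤ 1 := by
    by_contra h
    nlinarith
  have h1 : (1 : ℝ) ≤ (b ^ q)⁻¹ :=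
    (one_le_inv₀ (by positivity)).2 (Real.rpow_le_one hb.le hb1 hq)
  rw [← mul_add, mul_left_comm]
  gcongr
  rw [tsub_add_eq_max]
  refine max_le ?_ (ballAvg_le μ hq f hb hr hrε hbr z)
  exact le_mul_of_one_le_left' (ENNReal.one_le_ofReal.2 h1)

theorem lintegral_mul_tsub_le_add {M : Type*} [MeasurableSpace M] (μ : Measure M)
    {φ a b c : M → ℝ≥0∞} (hφ : Measurable φ) (ha : Measurable a) (hb : Measurable b) :
    ∫⁻ z, φ z * (a z - c z) ∂μ ≤ ∫⁻ z, φ z * (a z - b z) ∂μ + ∫⁻ z, φ z * (b z - c z) ∂μ := by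
  rw [← lintegral_add_left (hφ.fun_mul (ha.fun_sub hb))]
  refine lintegral_mono fun z => ?_
  rw [← mul_add]
  gcongr
  exact tsub_le_tsub_add_tsub

theorem step_arith {N s c r L E C σ x x' a₀ a₁ a₂ : ℝ} (hN0 : 0 < N) (hNs : N * s = 1)
    (hs0 : 0 ≤ s) (hs1 : s ≤ 1) (hc : 0 ≤ c) (hr : 0 ≤ r) (hr1 : r ≤ 1) (hL : 0 ≤ L) (hE : 0 < E)
    (hC : 0 ≤ C) (hσ : 0 ≤ σ) (h₂ : 0 ≤ a₂) (q₀ : a₀ ≤ E) (q₁ : a₁ ≤ E) (q₂ : a₂ ≤ E)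
    (hx : x ≤ x' + c * r * a₁)
    (h : s * x' + C * a₀ ≤ s * (σ / E) * a₀ + C * (s * (1 + c * r) * a₁ +
      (1 - s) * (1 + s * (c * r)) * (a₂ + L * (s * r) * E))) :
    x ≤ σ + (C * E * (2 * c + (1 + c) * L) + c * E) * r + C * (a₁ + (N - 1) * a₂ - N * a₀) := by
  have h2 := mul_le_mul_of_nonneg_left h hN0.le
  have i1 : N * (s * x' + C * a₀) = x' + N * C * a₀ := by
    linear_combination x' * hNs
  have i2 : N * (s * (σ / E) * a₀ + C * (s * (1 + c * r) * a₁ +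
      (1 - s) * (1 + s * (c * r)) * (a₂ + L * (s * r) * E))) = σ / E * a₀ +
      C * ((1 + c * r) * a₁ + (N - 1) * a₂ +
        (1 - s) * (c * r * a₂ + (1 + s * (c * r)) * (L * r * E))) := by
    linear_combination (σ / E * a₀ + C * ((1 + c * r) * a₁ - a₂ +
      (1 - s) * (c * r * a₂ + (1 + s * (c * r)) * (L * r * E)))) * hNs
  rw [i1, i2] at h2
  have j1 : σ / E * a₀ ≤ σ := by
    rw [div_mul_eq_mul_div, div_le_iff₀ hE]
    gcongr
  have j2 : c * r * a₁ ≤ c * r * E := by gcongr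
  have j3 : (1 - s) * (c * r * a₂ + (1 + s * (c * r)) * (L * r * E)) ≤
      c * r * E + (1 + c) * (L * r * E) := by
    have : s * (c * r) ≤ c :=
      (mul_le_of_le_one_left (by positivity) hs1).trans (mul_le_of_le_one_right hc hr1)
    calc _ ≤ 1 * (c * r * a₂ + (1 + s * (c * r)) * (L * r * E)) := by
          gcongr; linarith
      _ ≤ c * r * E + (1 + c) * (L * r * E) := by rw [one_mul]; gcongr
  have j4 := mul_le_mul_of_nonneg_left (add_le_add j2 j3) hC
  linarith

theorem AlexandrovSpace.exists_lintegral_tsub_le {n : ℕ} {k p : ℝ} {M Y : Type*} [MetricSpace M]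
    [MeasurableSpace M] [BorelSpace M] [SecondCountableTopology M] [MetricSpace Y]
    {u : M → Y} (hM : AlexandrovSpace M n k) (hp : 1 < p)
    (hu : Measurable fun q : M × M => dist (u q.1) (u q.2)) {K : Set M} (hK : IsCompact K)
    {φ ψ : M → ℝ≥0∞} (hφ : Measurable φ) (hψ : Measurable ψ) (hφK : ∀ z ∉ K, φ z = 0)
    {L R : ℝ} (hL : 0 ≤ L) (hR : 0 < R)
    (hφψ : ∀ z w d, dist z w ≤ d → d ≤ R → φ z ≤ φ w + ENNReal.ofReal (L * d) * ψ w)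
    {l₁ l₂ : ℝ≥0∞} (hl₁ : l₁ ≠ ⊤) (hl₂ : l₂ ≠ ⊤) :
    let μ : Measure M := μH[(n : ℝ)]
    let a := ballAvg μ (n + p) (fun q : M × M => ENNReal.ofReal (dist (u q.1) (u q.2) ^ p))
    Tendsto (fun r => ∫⁻ z, φ z * a r z ∂μ) (𝓝[>] 0) (𝓝 l₁) →
    Tendsto (fun r => ∫⁻ z, ψ z * a r z ∂μ) (𝓝[>] 0) (𝓝 l₂) →
    ∀ η : ℝ, 0 < η → ∃ ε₀ : ℝ, 0 < ε₀ ∧ ∀ ε : ℝ, 0 < ε → ε < ε₀ → ∀ t₀ : ℝ, 0 < t₀ →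
      ∃ t : ℝ, 0 < t ∧ t < t₀ ∧ ∫⁻ z, φ z * (a ε z - a t z) ∂μ ≤ ENNReal.ofReal η := by
  intro μ a h₁ h₂ η hη
  have : IsLocallyFiniteMeasure μ := hM.isLocallyFiniteMeasure
  have hq : (0:ℝ) ≤ n + p := by positivity
  have hf : Measurable fun q : M × M => ENNReal.ofReal (dist (u q.1) (u q.2) ^ p) :=
    (hu.pow_const p).ennreal_ofReal
  have ha : ∀ r, Measurable (a r) := measurable_ballAvg μ _ hf
  set E : ℝ := (max l₁ l₂).toReal + 1 with hE
  have hE0 : 0 < E := by positivity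
  have hEl : max l₁ l₂ < ENNReal.ofReal E := by
    rw [← ENNReal.ofReal_toReal (max_lt hl₁.lt_top hl₂.lt_top).ne]
    exact (ENNReal.ofReal_lt_ofReal_iff hE0).2 (by linarith)
  obtain ⟨r₁, hr₁, hr₁E⟩ := mem_nhdsGT_iff_exists_Ioo_subset.1
    ((h₁.eventually (gt_mem_nhds ((le_max_left _ _).trans_lt hEl))).and
      (h₂.eventually (gt_mem_nhds ((le_max_right _ _).trans_lt hEl))))
  replace hr₁ : 0 < r₁ := hr₁
  have hAE : ∀ r, 0 < r → r < r₁ → ∫⁻ z, φ z * a r z ∂μ ≤ ENNReal.ofReal E :=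
    fun r h h' => (hr₁E ⟨h, h'⟩).1.le
  have hBE : ∀ r, 0 < r → r < r₁ → ∫⁻ z, ψ z * a r z ∂μ ≤ ENNReal.ofReal E :=
    fun r h h' => (hr₁E ⟨h, h'⟩).2.le
  set A : ℝ → ℝ := fun r => (∫⁻ z, φ z * a r z ∂μ).toReal with hA
  set X : ℝ → ℝ → ℝ := fun r t => (∫⁻ z, φ z * (a r z - a t z) ∂μ).toReal with hX
  have hA0 : ∀ r, 0 ≤ A r := fun r => ENNReal.toReal_nonneg
  have hAE' : ∀ r, 0 < r → r < r₁ → A r ≤ E := fun r h h' =>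
    ENNReal.toReal_le_of_le_ofReal hE0.le (hAE r h h')
  have hAr : ∀ r, 0 < r → r < r₁ → ∫⁻ z, φ z * a r z ∂μ = ENNReal.ofReal (A r) := fun r h h' =>
    (ENNReal.ofReal_toReal ((hAE r h h').trans_lt ENNReal.ofReal_lt_top).ne).symm
  have hXfin : ∀ r t, 0 < r → r < r₁ → ∫⁻ z, φ z * (a r z - a t z) ∂μ ≠ ⊤ := fun r t h h' =>
    ((lintegral_mono fun z => by gcongr; exact tsub_le_self).trans_lt
      ((hAE r h h').trans_lt ENNReal.ofReal_lt_top)).ne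
  have hXr : ∀ r t, 0 < r → r < r₁ →
      ∫⁻ z, φ z * (a r z - a t z) ∂μ = ENNReal.ofReal (X r t) := fun r t h h' =>
    (ENNReal.ofReal_toReal (hXfin r t h h')).symm
  have hX0 : ∀ r t, 0 ≤ X r t := fun r t => ENNReal.toReal_nonneg
  have hAl : Tendsto A (𝓝[>] 0) (𝓝 l₁.toReal) := (ENNReal.tendsto_toReal hl₁).comp h₁
  obtain ⟨c, r₀, hc, hr₀, hst⟩ := hM.exists_step hp hu hK
  have hstep : ∀ σ : ℝ, 0 < σ → ∃ C c r₀ : ℝ, 0 < C ∧ 0 ≤ c ∧ 0 < r₀ ∧ ∀ r : ℝ, 0 < r → r < r₀ →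
      ∀ N : ℕ, 2 ≤ N → X r (r / N) ≤
        σ + c * r + C * (A (r / N) + (N - 1) * A ((N - 1) * (r / N)) - N * A r) := by
    intro σ hσ
    obtain ⟨C, hC, hs⟩ := hst (σ / E) (by positivity)
    refine ⟨C, C * E * (2 * c + (1 + c) * L) + c * E, min (min r₀ r₁) (min R 1), hC, by positivity,
      by positivity, fun r hr hrr N hN => ?_⟩
    have hrr₀ : r < r₀ := hrr.trans_le ((min_le_left _ _).trans (min_le_left _ _))
    have hrr₁ : r < r₁ := hrr.trans_le ((min_le_left _ _).trans (min_le_right _ _))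
    have hrR : r < R := hrr.trans_le ((min_le_right _ _).trans (min_le_left _ _))
    have hr1 : r < 1 := hrr.trans_le ((min_le_right _ _).trans (min_le_right _ _))
    have hN2 : (2:ℝ) ≤ N := by exact_mod_cast hN
    have hN0 : (0:ℝ) < N := by linarith
    set s : ℝ := 1 / N with hsN
    have hs0 : 0 < s := by positivity
    have hs1 : s < 1 := by rw [hsN, div_lt_one hN0]; linarith
    have e1 : r / N = s * r := by rw [hsN]; ring
    have e2 : ((N:ℝ) - 1) * (r / N) = (1 - s) * r := by rw [hsN]; field_simp
    have hNs : (N:ℝ) * s = 1 := by rw [hsN]; field_simp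
    have hsr0 : 0 < s * r := by positivity
    have hsr : s * r ≤ r := by nlinarith
    have hsr0' : 0 < (1 - s) * r := mul_pos (by linarith) hr
    have hsr' : (1 - s) * r ≤ r := by nlinarith
    set g : M → ℝ≥0∞ := fun w => φ w + ENNReal.ofReal (L * (s * r)) * ψ w with hg
    have h := hs s r hs0 hs1 hr hrr₀ φ g hφ (hφ.add (hψ.const_mul _)) hφK
      (fun z w hzw => hφψ z w _ hzw (hsr.trans hrR.le))
    simp only [] at h
    have hcr : 0 ≤ c * r := by positivity
    set X' : ℝ := (∫⁻ z, φ z * (a r z - ENNReal.ofReal (1 + c * r) * a (s * r) z) ∂μ).toReal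
      with hX'
    have hX'0 : 0 ≤ X' := ENNReal.toReal_nonneg
    have hX'r : ∫⁻ z, φ z * (a r z - ENNReal.ofReal (1 + c * r) * a (s * r) z) ∂μ =
        ENNReal.ofReal X' := (ENNReal.ofReal_toReal ((lintegral_mono fun z => by
          gcongr; exact tsub_le_self).trans_lt
            ((hAE r hr hrr₁).trans_lt ENNReal.ofReal_lt_top)).ne).symm
    have hgA : ∫⁻ z, g z * a ((1 - s) * r) z ∂μ ≤
        ENNReal.ofReal (A ((1 - s) * r) + L * (s * r) * E) := by
      simp only [hg, add_mul, mul_assoc (ENNReal.ofReal (L * (s * r)))]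
      rw [lintegral_add_left (hφ.fun_mul (ha _)), lintegral_const_mul _ (hψ.fun_mul (ha _)),
        ENNReal.ofReal_add (hA0 _) (by positivity), hAr _ hsr0' (hsr'.trans_lt hrr₁),
        ENNReal.ofReal_mul (p := L * (s * r)) (by positivity)]
      gcongr
      exact hBE _ hsr0' (hsr'.trans_lt hrr₁)
    have h' : ENNReal.ofReal (s * X' + C * A r) ≤ ENNReal.ofReal (s * (σ / E) * A r +
        C * (s * (1 + c * r) * A (s * r) + (1 - s) * (1 + s * (c * r)) *
          (A ((1 - s) * r) + L * (s * r) * E))) := by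
      have p1 : 0 ≤ A r := hA0 r
      have p2 : 0 ≤ A (s * r) := hA0 _
      have p3 : 0 ≤ A ((1 - s) * r) := hA0 _
      have p4 : 0 ≤ 1 - s := by linarith
      rw [ENNReal.ofReal_add (by positivity) (by positivity),
        ENNReal.ofReal_add (by positivity) (by positivity), ENNReal.ofReal_mul hs0.le,
        ENNReal.ofReal_mul hC.le, ENNReal.ofReal_mul (by positivity), ENNReal.ofReal_mul hC.le,
        ENNReal.ofReal_add (by positivity) (by positivity),
        ENNReal.ofReal_mul (p := s * (1 + c * r)) (by positivity),
        ENNReal.ofReal_mul (p := (1 - s) * (1 + s * (c * r))) (by positivity), ← hX'r,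
        ← hAr _ hr hrr₁, ← hAr _ hsr0 (hsr.trans_lt hrr₁)]
      refine h.trans ?_
      gcongr
    have p1 : 0 ≤ A r := hA0 r
    have p2 : 0 ≤ A (s * r) := hA0 _
    have p3 : 0 ≤ A ((1 - s) * r) := hA0 _
    have p4 : 0 ≤ 1 - s := by linarith
    replace h' := (ENNReal.ofReal_le_ofReal_iff (by positivity)).1 h'
    have q1 := hAE' r hr hrr₁
    have q2 := hAE' _ hsr0 (hsr.trans_lt hrr₁)
    have q3 := hAE' _ hsr0' (hsr'.trans_lt hrr₁)
    have hXX : X r (s * r) ≤ X' + c * r * A (s * r) := by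
      rw [← ENNReal.ofReal_le_ofReal_iff (by positivity), ← hXr _ _ hr hrr₁,
        ENNReal.ofReal_add hX'0 (by positivity), ENNReal.ofReal_mul hcr, ← hX'r,
        ← hAr _ hsr0 (hsr.trans_lt hrr₁), ← lintegral_const_mul _ (hφ.fun_mul (ha _)),
        ← lintegral_add_right _ ((hφ.fun_mul (ha _)).const_mul _)]
      refine lintegral_mono fun z => ?_
      rw [mul_left_comm, ← mul_add]
      gcongr
      rw [tsub_le_iff_right, ENNReal.ofReal_add zero_le_one hcr, ENNReal.ofReal_one, add_mul,
        one_mul, add_assoc, add_comm (ENNReal.ofReal (c * r) * _)]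
      exact le_tsub_add
    rw [e2, e1]
    exact step_arith hN0 hNs hs0.le hs1.le hc hr.le hr1.le hL hE0 hC.le hσ.le p3 q1 q2 q3 hXX h'
  have hmono : ∀ b r ε t : ℝ, 0 < b → 0 < r → r ≤ ε → ε < r₁ → b * ε ≤ r → 0 < t → t < r₁ →
      X ε t ≤ A ε - A r + ((b ^ ((n:ℝ) + p))⁻¹ - 1) * E + X r t := by
    intro b r ε t hb hr hrε hεr hbr ht htr
    have hε : 0 < ε := hr.trans_le hrε
    have hrr := hrε.trans_lt hεr
    have h1 := lintegral_mul_tsub_add_le μ hq hf hφ hb hr hrε hbr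
    have h2 := lintegral_mul_tsub_le_add μ (c := a t) hφ (ha ε) (ha r)
    change ∫⁻ z, φ z * (a ε z - a r z) ∂μ + ∫⁻ z, φ z * a r z ∂μ ≤
      ENNReal.ofReal ((b ^ ((n:ℝ) + p))⁻¹) * ∫⁻ z, φ z * a ε z ∂μ at h1
    have hβ : 0 ≤ (b ^ ((n:ℝ) + p))⁻¹ := by positivity
    rw [hXr _ _ hε hεr, hAr _ hr hrr, hAr _ hε hεr, ← ENNReal.ofReal_add (hX0 _ _) (hA0 _),
      ← ENNReal.ofReal_mul hβ,
      ENNReal.ofReal_le_ofReal_iff (mul_nonneg hβ (hA0 _))] at h1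
    rw [hXr _ _ hε hεr, hXr _ _ hε hεr, hXr _ _ hr hrr, ← ENNReal.ofReal_add (hX0 _ _) (hX0 _ _),
      ENNReal.ofReal_le_ofReal_iff (add_nonneg (hX0 _ _) (hX0 _ _))] at h2
    have hb1 : b ≤ 1 := by
      by_contra h
      nlinarith
    have h3 : (1 : ℝ) ≤ (b ^ ((n:ℝ) + p))⁻¹ :=
      (one_le_inv₀ (by positivity)).2 (Real.rpow_le_one hb.le hb1 hq)
    have h4 := mul_le_mul_of_nonneg_left (hAE' ε hε hεr) (sub_nonneg.2 h3)
    linarith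
  obtain ⟨ε₀, hε₀, H⟩ := exists_small_of_telescoping (A := A) (X := X) (E := E) (q := n + p) hr₁
    hstep hAl hmono hη
  refine ⟨min ε₀ r₁, by positivity, fun ε hε hεε t₀ ht₀ => ?_⟩
  obtain ⟨t, ht, htt, hXt⟩ := H ε hε (hεε.trans_le (min_le_left _ _)) t₀ ht₀
  refine ⟨t, ht, htt, ?_⟩
  rw [hXr ε t hε (hεε.trans_le (min_le_right _ _))]
  exact ENNReal.ofReal_le_ofReal hXt

theorem measure_le_of_forall_continuous {M : Type*} [MetricSpace M] [MeasurableSpace M]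
    [BorelSpace M] {α β : Measure M} [IsFiniteMeasure α] [IsFiniteMeasure β] {B : Set M}
    (hB : IsOpen B) (hBc : IsCompact (closure B)) {τ : ℝ≥0∞}
    (h : ∀ g : M → ℝ, Continuous g → (∀ x, 0 ≤ g x) → (∀ x, g x ≤ 1) → tsupport g ⊆ B →
      ∫⁻ x, ENNReal.ofReal (g x) ∂α ≤ ∫⁻ x, ENNReal.ofReal (g x) ∂β + τ)
    {A : Set M} (hA : MeasurableSet A) (hAB : A ⊆ B) : α A ≤ β A + τ := by
  refine le_of_forall_lt fun c hc => ?_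
  obtain ⟨F, hFA, hF, hcF⟩ := hA.exists_lt_isClosed_of_ne_top (measure_ne_top _ _) hc
  refine hcF.trans_le ((?_ : α F ≤ β F + τ).trans (by gcongr))
  refine ENNReal.le_of_forall_pos_le_add fun ε hε _ => ?_
  obtain ⟨U, hFU, hU, hβU⟩ := F.exists_isOpen_le_add β (ENNReal.coe_ne_zero.2 hε.ne')
  obtain ⟨g, hg, hgF, hg01⟩ := exists_tsupport_one_of_isOpen_isClosed (hU.inter hB)
    (hBc.of_isClosed_subset isClosed_closure (closure_mono inter_subset_right)) hF
    (subset_inter hFU (hFA.trans hAB))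
  have h1 := h g g.continuous (fun x => (hg01 x).1) (fun x => (hg01 x).2)
    (hg.trans inter_subset_right)
  have h2 : α F ≤ ∫⁻ x, ENNReal.ofReal (g x) ∂α := by
    rw [← lintegral_indicator_one hF.measurableSet]
    refine lintegral_mono fun x => indicator_apply_le' (fun hx => ?_) fun _ => zero_le
    simp [hgF hx]
  have h3 : ∫⁻ x, ENNReal.ofReal (g x) ∂β ≤ β U := by
    rw [← lintegral_indicator_one hU.measurableSet]
    refine lintegral_mono fun x => le_indicator_apply (fun _ => ?_) fun hx => ?_
    · simpa using (hg01 x).2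
    · have : g x = 0 := image_eq_zero_of_notMem_tsupport fun hx' => hx (hg hx').1
      simp [this]
  calc α F ≤ β U + τ := h2.trans (h1.trans (by gcongr))
    _ ≤ β F + ε + τ := by gcongr
    _ = β F + τ + ε := by ring

theorem lintegral_tsub_le_of_setLIntegral_le {M : Type*} [MeasurableSpace M] {μ : Measure M}
    {e f : M → ℝ≥0∞} (he : Measurable e) (hf : Measurable f) {B : Set M} (hB : MeasurableSet B)
    {τ : ℝ≥0∞} (hfin : ∫⁻ x in B, f x ∂μ ≠ ⊤)
    (h : ∀ A, MeasurableSet A → A ⊆ B → ∫⁻ x in A, e x ∂μ ≤ ∫⁻ x in A, f x ∂μ + τ) :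
    ∫⁻ x in B, (e x - f x) ∂μ ≤ τ := by
  have hm : MeasurableSet {x | f x ≤ e x} := measurableSet_le hf he
  have h1 : ∫⁻ x in B, (e x - f x) ∂μ = ∫⁻ x in B ∩ {x | f x ≤ e x}, (e x - f x) ∂μ := by
    rw [← lintegral_indicator hB, ← lintegral_indicator (hB.inter hm)]
    congr 1
    ext x
    by_cases hx : f x ≤ e x
    · by_cases hxB : x ∈ B <;> simp [indicator, hx, hxB]
    · simp [indicator, hx, tsub_eq_zero_of_le (not_le.1 hx).le]
  have hfin' : ∫⁻ x in B ∩ {x | f x ≤ e x}, f x ∂μ ≠ ⊤ :=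
    ((lintegral_mono_set inter_subset_left).trans_lt hfin.lt_top).ne
  rw [h1]
  refine ENNReal.le_of_add_le_add_right hfin' ?_
  rw [← lintegral_add_right _ hf]
  calc _ = ∫⁻ x in B ∩ {x | f x ≤ e x}, e x ∂μ :=
        setLIntegral_congr_fun (hB.inter hm) fun x hx => tsub_add_cancel_of_le hx.2
    _ ≤ _ := (h _ (hB.inter hm) inter_subset_left).trans (add_comm _ _).le

theorem lintegral_abs_sub_rnDeriv_le {M : Type*} [MetricSpace M] [MeasurableSpace M]
    [BorelSpace M] {μ ν : Measure M} [SigmaFinite μ] [IsFiniteMeasure ν] {B : Set M}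
    (hB : IsOpen B) (hBc : IsCompact (closure B)) {e : M → ℝ≥0∞} (he : Measurable e)
    (hfin : ∫⁻ x in B, e x ∂μ ≠ ⊤) {τ : ℝ≥0∞}
    (h : ∀ g : M → ℝ, Continuous g → (∀ x, 0 ≤ g x) → (∀ x, g x ≤ 1) → tsupport g ⊆ B →
      ∫⁻ x, ENNReal.ofReal (g x) * e x ∂μ ≤ ∫⁻ x, ENNReal.ofReal (g x) ∂ν + τ ∧
      ∫⁻ x, ENNReal.ofReal (g x) ∂ν ≤ ∫⁻ x, ENNReal.ofReal (g x) * e x ∂μ + τ) :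
    ∫⁻ x in B, ENNReal.ofReal |(e x).toReal - (ν.rnDeriv μ x).toReal| ∂μ ≤ 2 * τ := by
  have hf : Measurable (ν.rnDeriv μ) := ν.measurable_rnDeriv μ
  set α : Measure M := (μ.withDensity e).restrict B with hα
  set β : Measure M := ν.restrict B
  have : IsFiniteMeasure α := ⟨by simpa [α, withDensity_apply _ hB.measurableSet]
    using hfin.lt_top⟩
  have hgB : ∀ g : M → ℝ, tsupport g ⊆ B → ∀ ρ : Measure M,
      ∫⁻ x in B, ENNReal.ofReal (g x) ∂ρ = ∫⁻ x, ENNReal.ofReal (g x) ∂ρ := by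
    intro g hg ρ
    refine setLIntegral_eq_of_support_subset fun x hx => hg (subset_tsupport g ?_)
    intro h0
    simp [h0] at hx
  have hgα : ∀ g : M → ℝ, Continuous g → tsupport g ⊆ B →
      ∫⁻ x, ENNReal.ofReal (g x) ∂α = ∫⁻ x, ENNReal.ofReal (g x) * e x ∂μ := by
    intro g hgc hg
    rw [hα, hgB g hg, lintegral_withDensity_eq_lintegral_mul _ he (by fun_prop)]
    exact lintegral_congr fun x => mul_comm _ _
  have hαβ : ∀ A, MeasurableSet A → A ⊆ B → α A ≤ β A + τ := fun A hA hAB =>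
    measure_le_of_forall_continuous hB hBc (fun g hgc h0 h1 hg => by
      rw [hgα g hgc hg, hgB g hg]; exact (h g hgc h0 h1 hg).1) hA hAB
  have hβα : ∀ A, MeasurableSet A → A ⊆ B → β A ≤ α A + τ := fun A hA hAB =>
    measure_le_of_forall_continuous hB hBc (fun g hgc h0 h1 hg => by
      rw [hgα g hgc hg, hgB g hg]; exact (h g hgc h0 h1 hg).2) hA hAB
  have hs := ν.mutuallySingular_singularPart μ
  set S := hs.nullSet
  have hSm : MeasurableSet S := hs.measurableSet_nullSet
  have hSμ : μ Sᶜ = 0 := hs.measure_compl_nullSet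
  have hSν : ν.singularPart μ S = 0 := hs.measure_nullSet
  have hαA : ∀ A, MeasurableSet A → A ⊆ B → α A = ∫⁻ x in A, e x ∂μ := fun A hA hAB => by
    rw [hα, Measure.restrict_eq_self _ hAB, withDensity_apply _ hA]
  have hβA : ∀ A, MeasurableSet A → A ⊆ B ∩ S → β A = ∫⁻ x in A, ν.rnDeriv μ x ∂μ := by
    intro A hA hAB
    rw [Measure.restrict_eq_self _ (hAB.trans inter_subset_left)]
    conv_lhs => rw [ν.haveLebesgueDecomposition_add μ]
    rw [Measure.add_apply, measure_mono_null (hAB.trans inter_subset_right) hSν, zero_add,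
      withDensity_apply _ hA]
  have hBS : MeasurableSet (B ∩ S) := hB.measurableSet.inter hSm
  have hfB : ∫⁻ x in B ∩ S, ν.rnDeriv μ x ∂μ ≠ ⊤ := by
    rw [← hβA _ hBS le_rfl]; exact measure_ne_top _ _
  have heB : ∫⁻ x in B ∩ S, e x ∂μ ≠ ⊤ := by
    rw [← hαA _ hBS inter_subset_left]; exact measure_ne_top _ _
  have h1 := lintegral_tsub_le_of_setLIntegral_le he hf hBS hfB (τ := τ) fun A hA hAB => by
    rw [← hβA A hA hAB, ← hαA A hA (hAB.trans inter_subset_left)]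
    exact hαβ A hA (hAB.trans inter_subset_left)
  have h2 := lintegral_tsub_le_of_setLIntegral_le hf he hBS heB (τ := τ) fun A hA hAB => by
    rw [← hβA A hA hAB, ← hαA A hA (hAB.trans inter_subset_left)]
    exact hβα A hA (hAB.trans inter_subset_left)
  have hae : (B ∩ S : Set M) =ᵐ[μ] B := by
    refine inter_ae_eq_left_of_ae_eq_univ (ae_eq_univ.2 hSμ)
  rw [← setLIntegral_congr hae, two_mul]
  calc _ ≤ ∫⁻ x in B ∩ S, ((e x - ν.rnDeriv μ x) + (ν.rnDeriv μ x - e x)) ∂μ := by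
        refine lintegral_mono fun x => ?_
        generalize e x = a
        generalize ν.rnDeriv μ x = b
        rcases eq_or_ne a ⊤ with rfl | ha
        · rcases eq_or_ne b ⊤ with rfl | hb
          · simp
          · simp [hb]
        rcases eq_or_ne b ⊤ with rfl | hb
        · simp [ha]
        lift a to ℝ≥0 using ha
        lift b to ℝ≥0 using hb
        simp only [ENNReal.coe_toReal]
        rcases le_total a b with hab | hab
        · rw [abs_sub_comm, abs_of_nonneg (sub_nonneg.2 (NNReal.coe_le_coe.2 hab)),
            ENNReal.ofReal_sub _ a.coe_nonneg]
          simp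
        · rw [abs_of_nonneg (sub_nonneg.2 (NNReal.coe_le_coe.2 hab)), ENNReal.ofReal_sub _ b.coe_nonneg]
          simp
    _ = _ := lintegral_add_left (he.sub hf) _
    _ ≤ _ := add_le_add h1 h2

theorem cnp_pos (n : ℕ) {p : ℝ} (hp : 1 < p) : 0 < cnp n p := by
  have h1 : 0 < Real.Gamma ((p + 1) / 2) := Real.Gamma_pos_of_pos (by linarith)
  have h2 : 0 < Real.Gamma (((n : ℝ) + p) / 2) := Real.Gamma_pos_of_pos (by positivity)
  unfold cnp
  positivity

section

variable {M Y : Type*} [MetricSpace M] [MeasurableSpace M] [MetricSpace Y] {u : M → Y}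

theorem ksDensity_eq_toReal (n : ℕ) {p : ℝ} (hp : 1 < p) (μ : Measure M) {Ω : Set M}
    (hu : Measurable fun q : M × M => dist (u q.1) (u q.2)) {ε : ℝ} (hε : 0 < ε) {x : M}
    (hx : ball x ε ⊆ Ω) :
    ksDensity n p μ Ω u ε x = (ENNReal.ofReal ((n + p) / cnp n p) * ballAvg μ (n + p)
      (fun q : M × M => ENNReal.ofReal (dist (u q.1) (u q.2) ^ p)) ε x).toReal := by
  have hc := cnp_pos n hp
  rw [ksDensity, inter_eq_self_of_subset_left hx, integral_eq_lintegral_of_nonneg_ae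
    (.of_forall fun y => by positivity)
    (by exact ((hu.comp measurable_prodMk_left).pow_const p).aestronglyMeasurable),
    ballAvg, ← mul_assoc, ← ENNReal.ofReal_mul (by positivity), ENNReal.toReal_mul,
    ENNReal.toReal_ofReal (by positivity), div_mul_eq_div_mul_one_div, one_div]

theorem setLIntegral_ballAvg_ne_top [BorelSpace M]
    [SecondCountableTopology M] (μ : Measure M) [SFinite μ] (q : ℝ)
    {p : ℝ} (hp : 1 < p) (hu : ∀ P : Y, Measurable fun x => dist (u x) P) {P : Y}
    {K N : Set M} (hKN : K ⊆ N) (hN : μ N ≠ ⊤)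
    (hP : ∫⁻ x in N, ENNReal.ofReal (dist (u x) P ^ p) ∂μ ≠ ⊤) {r : ℝ}
    (hr : ∀ z ∈ K, ball z r ⊆ N) (hK : MeasurableSet K) :
    ∫⁻ z in K, ballAvg μ q (fun q : M × M => ENNReal.ofReal (dist (u q.1) (u q.2) ^ p)) r z ∂μ
      ≠ ⊤ := by
  have hm : Measurable fun x => ENNReal.ofReal (dist (u x) P ^ p) :=
    ((hu P).pow_const p).ennreal_ofReal
  set I := ∫⁻ x in N, ENNReal.ofReal (dist (u x) P ^ p) ∂μ
  have hC : ∀ x y, ENNReal.ofReal (dist (u x) (u y) ^ p) ≤ ENNReal.ofReal (2 ^ (p - 1)) *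
      (ENNReal.ofReal (dist (u x) P ^ p) + ENNReal.ofReal (dist (u y) P ^ p)) := by
    intro x y
    rw [← ENNReal.ofReal_add (by positivity) (by positivity), ← ENNReal.ofReal_mul (by positivity)]
    refine ENNReal.ofReal_le_ofReal ?_
    refine (Real.rpow_le_rpow dist_nonneg (dist_triangle_right _ _ P) (by linarith)).trans ?_
    exact_mod_cast NNReal.coe_le_coe.2
      (NNReal.rpow_add_le_mul_rpow_add_rpow (nndist (u x) P) (nndist (u y) P) hp.le)
  have hin : ∀ z ∈ K, ∫⁻ y in ball z r, ENNReal.ofReal (dist (u z) (u y) ^ p) ∂μ ≤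
      ENNReal.ofReal (2 ^ (p - 1)) * (ENNReal.ofReal (dist (u z) P ^ p) * μ N + I) := by
    intro z hz
    calc _ ≤ ∫⁻ y in N, ENNReal.ofReal (2 ^ (p - 1)) *
          (ENNReal.ofReal (dist (u z) P ^ p) + ENNReal.ofReal (dist (u y) P ^ p)) ∂μ :=
          (lintegral_mono_set (hr z hz)).trans (lintegral_mono fun y => hC z y)
      _ = _ := by
          rw [lintegral_const_mul _ (hm.const_add _), lintegral_add_left measurable_const,
            setLIntegral_const]
  refine ne_top_of_le_ne_top (b := ENNReal.ofReal ((r ^ q)⁻¹) *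
    (ENNReal.ofReal (2 ^ (p - 1)) * (I * μ N + I * μ N))) ?_ ?_
  · exact ENNReal.mul_ne_top ENNReal.ofReal_ne_top (ENNReal.mul_ne_top ENNReal.ofReal_ne_top
      (ENNReal.add_ne_top.2 ⟨ENNReal.mul_ne_top hP hN, ENNReal.mul_ne_top hP hN⟩))
  · calc _ ≤ ∫⁻ z in K, ENNReal.ofReal ((r ^ q)⁻¹) * (ENNReal.ofReal (2 ^ (p - 1)) *
          (ENNReal.ofReal (dist (u z) P ^ p) * μ N + I)) ∂μ :=
          setLIntegral_mono' hK fun z hz => by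
            unfold ballAvg
            gcongr
            exact hin z hz
      _ ≤ ∫⁻ z in N, ENNReal.ofReal ((r ^ q)⁻¹) * (ENNReal.ofReal (2 ^ (p - 1)) *
          (ENNReal.ofReal (dist (u z) P ^ p) * μ N + I)) ∂μ := lintegral_mono_set hKN
      _ = _ := by
          rw [lintegral_const_mul _ (((hm.mul_const _).add_const _).const_mul _),
            lintegral_const_mul _ ((hm.mul_const _).add_const _),
            lintegral_add_right _ measurable_const, lintegral_mul_const _ hm, setLIntegral_const]

theorem tendsto_lintegral_mul_ballAvg [BorelSpace M] [SecondCountableTopology M]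
    [LocallyCompactSpace M] {n : ℕ} {p : ℝ} (hp : 1 < p) {μ : Measure M} [IsLocallyFiniteMeasure μ] {Ω : Set M}
    (hΩ : IsOpen Ω) (hu : MemKS n p μ Ω u) {ν : Measure M} (hν : IsEnergyMeasure n p μ Ω u ν)
    {g : M → ℝ} (hg : IsC0 Ω g) (hg0 : ∀ x, 0 ≤ g x) :
    Tendsto (fun r => ∫⁻ z, ENNReal.ofReal (g z) *
      (ENNReal.ofReal ((n + p) / cnp n p) * ballAvg μ (n + p)
        (fun q : M × M => ENNReal.ofReal (dist (u q.1) (u q.2) ^ p)) r z) ∂μ) (𝓝[>] 0)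
      (𝓝 (∫⁻ z, ENNReal.ofReal (g z) ∂ν)) := by
  have hνf : IsFiniteMeasure ν := hν.1
  obtain ⟨hgc, hgs, hgΩ⟩ := hg
  have hlim := hν.2 g ⟨hgc, hgs, hgΩ⟩ hg0
  have hud := measurable_dist_prod hu.1 hu.2.1
  have hm := measurable_ballAvg μ ((n:ℝ) + p) (hud.pow_const p).ennreal_ofReal
  obtain ⟨P, hP⟩ := hu.2.2.1
  set c₀ : ℝ := (n + p) / cnp n p
  set a := ballAvg μ ((n:ℝ) + p) (fun q : M × M => ENNReal.ofReal (dist (u q.1) (u q.2) ^ p))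
  set K := tsupport g
  obtain ⟨N, hN, hKN, hNΩ⟩ := exists_compact_between hgs hΩ hgΩ
  obtain ⟨δ, hδ, hδN⟩ := hgs.exists_thickening_subset_open isOpen_interior hKN
  obtain ⟨b, hb⟩ := hgs.exists_bound_of_continuousOn hgc.continuousOn
  have hball : ∀ r, r < δ → ∀ z ∈ K, ball z r ⊆ N := fun r hr z hz =>
    (ball_subset_ball hr.le).trans
      ((ball_subset_thickening hz δ).trans (hδN.trans interior_subset))
  have hgint : Integrable g ν := hgc.integrable_of_hasCompactSupport hgs
  have hPN : ∫⁻ x in N, ENNReal.ofReal (dist (u x) P ^ p) ∂μ ≠ ⊤ :=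
    ((lintegral_mono_set hNΩ).trans_lt
      ((hasFiniteIntegral_iff_ofReal (.of_forall fun x => by positivity)).1 hP.2)).ne
  rw [← ofReal_integral_eq_lintegral_ofReal hgint (.of_forall hg0)]
  refine ((ENNReal.continuous_ofReal.tendsto _).comp hlim).congr' ?_
  filter_upwards [Ioo_mem_nhdsGT hδ] with r hr
  have hfin : ∫⁻ z, ENNReal.ofReal (g z) * (ENNReal.ofReal c₀ * a r z) ∂μ ≠ ⊤ := by
    have h1 := setLIntegral_ballAvg_ne_top μ ((n:ℝ) + p) hp hu.1 (hKN.trans interior_subset)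
      hN.measure_lt_top.ne hPN (hball r hr.2) hgs.measurableSet
    refine ne_top_of_le_ne_top (ENNReal.mul_ne_top (ENNReal.mul_ne_top
      (ENNReal.ofReal_ne_top (r := b)) (ENNReal.ofReal_ne_top (r := c₀))) h1) ?_
    rw [← lintegral_const_mul _ (hm r), ← lintegral_indicator hgs.measurableSet]
    refine lintegral_mono fun z => le_indicator_apply (fun hz => ?_) fun hz => ?_
    · rw [mul_assoc]
      gcongr
      exact (le_abs_self _).trans (hb z hz)
    · simp [image_eq_zero_of_notMem_tsupport hz]
  have heq : ksApproxEnergy n p μ Ω u g r =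
      (∫⁻ z, ENNReal.ofReal (g z) * (ENNReal.ofReal c₀ * a r z) ∂μ).toReal := by
    rw [← integral_toReal (by
      exact (hgc.measurable.ennreal_ofReal.fun_mul ((hm r).const_mul _)).aemeasurable)
      (ae_lt_top (hgc.measurable.ennreal_ofReal.fun_mul ((hm r).const_mul _)) hfin), ksApproxEnergy]
    refine Eq.trans ?_ (setIntegral_eq_integral_of_forall_compl_eq_zero (s := Ω) ?_)
    · refine setIntegral_congr_fun hΩ.measurableSet fun z hz => ?_
      by_cases hzK : z ∈ K
      · rw [ksDensity_eq_toReal n hp μ hud hr.1 ((hball r hr.2 z hzK).trans hNΩ),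
          ENNReal.toReal_mul (a := ENNReal.ofReal (g z)), ENNReal.toReal_ofReal (hg0 z)]
      · simp [image_eq_zero_of_notMem_tsupport hzK]
    · intro z hz
      simp [image_eq_zero_of_notMem_tsupport fun h => hz (hgΩ h)]
  rw [Function.comp_apply, heq, ENNReal.ofReal_toReal hfin]

end

theorem lintegral_mul_le_of_tendsto {M : Type*} [MeasurableSpace M] {μ : Measure M}
    {e : ℝ → M → ℝ≥0∞} (he : ∀ r, Measurable (e r)) {φ g : M → ℝ≥0∞} (hφ : Measurable φ)
    (hg : Measurable g) (hgφ : ∀ x, g x ≤ φ x) {l l₁ η : ℝ≥0∞}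
    (hφl : Tendsto (fun r => ∫⁻ z, φ z * e r z ∂μ) (𝓝[>] 0) (𝓝 l₁))
    (hgl : Tendsto (fun r => ∫⁻ z, g z * e r z ∂μ) (𝓝[>] 0) (𝓝 l)) {ε : ℝ}
    (hfin : ∫⁻ z, φ z * e ε z ∂μ ≠ ⊤) (hη : l₁ ≤ ∫⁻ z, φ z * e ε z ∂μ + η)
    (hsmall : ∀ t₀ : ℝ, 0 < t₀ → ∃ t : ℝ, 0 < t ∧ t < t₀ ∧
      ∫⁻ z, φ z * (e ε z - e t z) ∂μ ≤ η) :
    ∫⁻ z, g z * e ε z ∂μ ≤ l + 2 * η ∧ l ≤ ∫⁻ z, g z * e ε z ∂μ + 2 * η := by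
  have hfr : ∃ᶠ t in 𝓝[>] (0:ℝ), ∫⁻ z, φ z * (e ε z - e t z) ∂μ ≤ η := by
    rw [(nhdsGT_basis (0:ℝ)).frequently_iff]
    intro t₀ ht₀
    obtain ⟨t, h0, h1, h2⟩ := hsmall t₀ ht₀
    exact ⟨t, ⟨h0, h1⟩, h2⟩
  constructor
  · refine ge_of_tendsto_of_frequently (hgl.add_const (2 * η)) (hfr.mono fun t ht => ?_)
    calc ∫⁻ z, g z * e ε z ∂μ ≤ ∫⁻ z, (g z * e t z + φ z * (e ε z - e t z)) ∂μ := by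
          refine lintegral_mono fun z => ?_
          calc g z * e ε z ≤ g z * (e t z + (e ε z - e t z)) := by
                gcongr; exact le_add_tsub
            _ ≤ g z * e t z + φ z * (e ε z - e t z) := by
                rw [mul_add]; gcongr; exact hgφ z
      _ = ∫⁻ z, g z * e t z ∂μ + ∫⁻ z, φ z * (e ε z - e t z) ∂μ :=
          lintegral_add_left (hg.mul (he t)) _
      _ ≤ _ := by
          gcongr
          exact ht.trans (le_mul_of_one_le_left' one_le_two)
  · have h2 : l + ∫⁻ z, φ z * e ε z ∂μ ≤ ∫⁻ z, g z * e ε z ∂μ + η + l₁ := by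
      refine le_of_tendsto_of_tendsto_of_frequently (hgl.add_const _)
        (hφl.const_add (∫⁻ z, g z * e ε z ∂μ + η)) (hfr.mono fun t ht => ?_)
      calc _ ≤ ∫⁻ z, (g z * e ε z + φ z * (e ε z - e t z) + φ z * e t z) ∂μ := by
            rw [← lintegral_add_left (hg.fun_mul (he t))]
            refine lintegral_mono fun z => ?_
            rw [add_assoc, ← mul_add, tsub_add_eq_max]
            rcases le_total (e ε z) (e t z) with h | h
            · rw [max_eq_right h]
              calc _ ≤ g z * (e ε z + (e t z - e ε z)) + φ z * e ε z := by
                    gcongr; exact le_add_tsub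
                _ ≤ g z * e ε z + φ z * (e t z - e ε z) + φ z * e ε z := by
                    rw [mul_add]; gcongr; exact hgφ z
                _ = _ := by rw [add_assoc, ← mul_add, tsub_add_cancel_of_le h]
            · rw [max_eq_left h]
              gcongr
        _ = ∫⁻ z, g z * e ε z ∂μ + ∫⁻ z, φ z * (e ε z - e t z) ∂μ +
              ∫⁻ z, φ z * e t z ∂μ := by
            rw [lintegral_add_right _ (hφ.fun_mul (he t)),
              lintegral_add_left (hg.fun_mul (he ε))]
        _ ≤ _ := by gcongr
    refine ENNReal.le_of_add_le_add_right hfin (h2.trans ?_)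
    calc _ ≤ ∫⁻ z, g z * e ε z ∂μ + η + (∫⁻ z, φ z * e ε z ∂μ + η) := by gcongr
      _ = _ := by ring

theorem AlexandrovSpace.exists_integral_abs_sub_le {n : ℕ} {k p : ℝ} {M Y : Type*} [MetricSpace M]
    [MeasurableSpace M] [BorelSpace M] [MetricSpace Y] (hM : AlexandrovSpace M n k) (hp : 1 < p)
    {Ω : Set M} (hΩ : IsOpen Ω) {u : M → Y} (hu : MemKS n p μH[(n : ℝ)] Ω u) {ν : Measure M}
    (hν : IsEnergyMeasure n p μH[(n : ℝ)] Ω u ν) {B : Set M} (hB : IsOpen B) (hBΩ : CptIn B Ω)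
    {δ : ℝ} (hδ : 0 < δ) :
    ∃ ε₀ : ℝ, 0 < ε₀ ∧ ∀ ε : ℝ, 0 < ε → ε < ε₀ →
      ∫ x in B, |ksDensity n p μH[(n : ℝ)] Ω u ε x - ksDens μH[(n : ℝ)] ν x| ∂μH[(n : ℝ)]
        ≤ δ := by
  have := hM.curv.locallyCompact
  have := hM.curv.geodesic.preconnectedSpace
  have := separableSpace_of_locallyCompact_preconnected (M := M)
  have := UniformSpace.secondCountable_of_separable M
  have := hM.isLocallyFiniteMeasure
  have hνf : IsFiniteMeasure ν := hν.1
  set μ : Measure M := μH[(n : ℝ)]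
  obtain ⟨hBc, hBΩ⟩ := hBΩ
  obtain ⟨N, hN, hBN, hNΩ⟩ := exists_compact_between hBc hΩ hBΩ
  obtain ⟨N', hN', hNN', hNΩ'⟩ := exists_compact_between hN hΩ hNΩ
  obtain ⟨R, hR, hRN⟩ := hBc.exists_cthickening_subset_open isOpen_interior hBN
  obtain ⟨R', hR', hRN'⟩ := hN.exists_cthickening_subset_open isOpen_interior hNN'
  set φ₀ := thickenedIndicator hR (closure B)
  have hφ₀1 : ∀ x, φ₀ x ≤ 1 := thickenedIndicator_le_one hR _
  have hφ₀B : ∀ x ∈ B, φ₀ x = 1 := fun x hx => thickenedIndicator_one hR _ (subset_closure hx)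
  have hφ₀N : ∀ x ∉ N, φ₀ x = 0 := fun x hx => thickenedIndicator_zero hR _ fun h =>
    hx (interior_subset (hRN (thickening_subset_cthickening _ _ h)))
  have hφ₀L : LipschitzWith R.toNNReal⁻¹ φ₀ := lipschitzWith_thickenedIndicator hR _
  set φ : M → ℝ := fun x => φ₀ x
  have hφc : Continuous φ := NNReal.continuous_coe.comp φ₀.continuous
  have hφN : tsupport φ ⊆ N := closure_minimal (fun x hx => by
    by_contra h
    exact hx (by simp [φ, hφ₀N x h])) hN.isClosed
  have hφC0 : IsC0 Ω φ :=
    ⟨hφc, hN.of_isClosed_subset isClosed_closure hφN, hφN.trans hNΩ⟩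
  obtain ⟨ψ, hψN', hψ1, hψ01⟩ := exists_tsupport_one_of_isOpen_isClosed
    (isOpen_interior (s := N'))
    (hN'.of_isClosed_subset isClosed_closure (closure_minimal interior_subset hN'.isClosed))
    (isClosed_cthickening (δ := R') (E := N)) hRN'
  have hψC0 : IsC0 Ω ψ := ⟨ψ.continuous, hN'.of_isClosed_subset isClosed_closure
    (hψN'.trans interior_subset), hψN'.trans (interior_subset.trans hNΩ')⟩
  have hud := measurable_dist_prod hu.1 hu.2.1
  have hm := measurable_ballAvg μ ((n:ℝ) + p) (hud.pow_const p).ennreal_ofReal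
  have hc₀ : 0 < (n + p) / cnp n p := div_pos (by positivity) (cnp_pos n hp)
  set c₀ : ℝ := (n + p) / cnp n p
  set a := ballAvg μ ((n:ℝ) + p) (fun q : M × M => ENNReal.ofReal (dist (u q.1) (u q.2) ^ p))
  set e : ℝ → M → ℝ≥0∞ := fun r z => ENNReal.ofReal c₀ * a r z with he
  have hem : ∀ r, Measurable (e r) := fun r => (hm r).const_mul _
  have hlim : ∀ g : M → ℝ, IsC0 Ω g → (∀ x, 0 ≤ g x) → Tendsto (fun r => ∫⁻ z,
      ENNReal.ofReal (g z) * e r z ∂μ) (𝓝[>] 0) (𝓝 (∫⁻ z, ENNReal.ofReal (g z) ∂ν)) :=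
    fun g hg hg0 => tendsto_lintegral_mul_ballAvg hp hΩ hu hν hg hg0
  have hea : ∀ g : M → ℝ≥0∞, ∀ w : M → ℝ≥0∞, Measurable g → Measurable w →
      ∫⁻ z, g z * w z ∂μ =
        ENNReal.ofReal c₀⁻¹ * ∫⁻ z, g z * (ENNReal.ofReal c₀ * w z) ∂μ := by
    intro g w hg hw
    rw [← lintegral_const_mul _ (hg.fun_mul (hw.const_mul _))]
    refine lintegral_congr fun z => ?_
    rw [mul_left_comm, ← mul_assoc (ENNReal.ofReal c₀⁻¹), ← ENNReal.ofReal_mul (by positivity),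
      inv_mul_cancel₀ hc₀.ne', ENNReal.ofReal_one, one_mul]
  have hlim' : ∀ g : M → ℝ, IsC0 Ω g → (∀ x, 0 ≤ g x) → Tendsto (fun r => ∫⁻ z,
      ENNReal.ofReal (g z) * a r z ∂μ) (𝓝[>] 0)
        (𝓝 (ENNReal.ofReal c₀⁻¹ * ∫⁻ z, ENNReal.ofReal (g z) ∂ν)) := by
    intro g hg hg0
    refine (ENNReal.Tendsto.const_mul (hlim g hg hg0) (Or.inr ENNReal.ofReal_ne_top)).congr
      fun r => (hea _ _ hg.1.measurable.ennreal_ofReal (hm r)).symm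
  have hfin : ∀ g : M → ℝ, IsC0 Ω g → ∫⁻ z, ENNReal.ofReal (g z) ∂ν ≠ ⊤ := by
    intro g hg
    exact ne_top_of_le_ne_top ((hasFiniteIntegral_iff_norm _).1
      (hg.1.integrable_of_hasCompactSupport (μ := ν) hg.2.1).2).ne
      (lintegral_mono fun z => ENNReal.ofReal_le_ofReal (le_abs_self _))
  have hφ0 : ∀ x, 0 ≤ φ x := fun x => (φ₀ x).2
  have hφψ : ∀ z w d, dist z w ≤ d → d ≤ R' → ENNReal.ofReal (φ z) ≤
      ENNReal.ofReal (φ w) + ENNReal.ofReal (R⁻¹ * d) * ENNReal.ofReal (ψ w) := by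
    intro z w d hzw hd
    by_cases hz : z ∈ N
    · have hw : ψ w = 1 := hψ1 (mem_cthickening_of_dist_le w z R' N hz
        (by rw [dist_comm]; exact hzw.trans hd))
      have hd0 : 0 ≤ d := dist_nonneg.trans hzw
      rw [hw, ENNReal.ofReal_one, mul_one, ← ENNReal.ofReal_add (hφ0 w) (by positivity)]
      refine ENNReal.ofReal_le_ofReal ?_
      have h1 := hφ₀L.dist_le_mul z w
      rw [NNReal.dist_eq, NNReal.coe_inv, Real.coe_toNNReal R hR.le] at h1
      have h2 : R⁻¹ * dist z w ≤ R⁻¹ * d := by gcongr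
      linarith [(abs_le.1 h1).2]
    · simp [φ, hφ₀N z hz]
  set η : ℝ := δ / 4 with hη
  have hη0 : 0 < η := by positivity
  obtain ⟨ε₁, hε₁, H⟩ := hM.exists_lintegral_tsub_le hp hud hN
    hφC0.1.measurable.ennreal_ofReal hψC0.1.measurable.ennreal_ofReal
    (fun z hz => by simp [φ, hφ₀N z hz]) (inv_nonneg.2 hR.le) hR' hφψ
    (ENNReal.mul_ne_top ENNReal.ofReal_ne_top (hfin φ hφC0))
    (ENNReal.mul_ne_top ENNReal.ofReal_ne_top (hfin ψ hψC0))
    (hlim' φ hφC0 hφ0) (hlim' ψ hψC0 fun x => (hψ01 x).1) (c₀⁻¹ * η) (by positivity)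
  have hlφ := hlim φ hφC0 hφ0
  set l₁ := ∫⁻ z, ENNReal.ofReal (φ z) ∂ν
  have hl₁ : l₁ ≠ ⊤ := hfin φ hφC0
  have hηE : ENNReal.ofReal η ≠ 0 := by simpa using hη0
  obtain ⟨ε₂, hε₂, hε₂A⟩ := mem_nhdsGT_iff_exists_Ioo_subset.1
    ((hlφ.eventually (gt_mem_nhds hl₁.lt_top)).and
      ((hlφ.add_const (ENNReal.ofReal η)).eventually
        (lt_mem_nhds (ENNReal.lt_add_right hl₁ hηE))))
  replace hε₂ : 0 < ε₂ := hε₂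
  refine ⟨min ε₁ (min ε₂ R), by positivity, fun ε hε hεε => ?_⟩
  have hεε₁ : ε < ε₁ := hεε.trans_le (min_le_left _ _)
  have hεε₂ : ε < ε₂ := hεε.trans_le ((min_le_right _ _).trans (min_le_left _ _))
  have hεR : ε < R := hεε.trans_le ((min_le_right _ _).trans (min_le_right _ _))
  obtain ⟨hA1, hA2⟩ := hε₂A ⟨hε, hεε₂⟩
  have hsmall : ∀ t₀ : ℝ, 0 < t₀ → ∃ t : ℝ, 0 < t ∧ t < t₀ ∧
      ∫⁻ z, ENNReal.ofReal (φ z) * (e ε z - e t z) ∂μ ≤ ENNReal.ofReal η := by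
    intro t₀ ht₀
    obtain ⟨t, ht, htt, h⟩ := H ε hε hεε₁ t₀ ht₀
    refine ⟨t, ht, htt, ?_⟩
    have h1 : ∀ z, e ε z - e t z = ENNReal.ofReal c₀ * (a ε z - a t z) := fun z =>
      (ENNReal.mul_sub fun _ _ => ENNReal.ofReal_ne_top).symm
    simp_rw [h1]
    change ∫⁻ z, ENNReal.ofReal (φ z) * (a ε z - a t z) ∂μ ≤ _ at h
    rw [hea _ _ hφC0.1.measurable.ennreal_ofReal ((hm ε).fun_sub (hm t)),
      ENNReal.ofReal_mul (by positivity)] at h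
    exact (ENNReal.mul_le_mul_iff_right (by simpa using hc₀) ENNReal.ofReal_ne_top).1 h
  have key := lintegral_abs_sub_rnDeriv_le (ν := ν) hB hBc (hem ε)
    (ne_top_of_le_ne_top hA1.ne ?_) (τ := 2 * ENNReal.ofReal η) fun g hgc hg0 hg1 hgB =>
      lintegral_mul_le_of_tendsto hem hφC0.1.measurable.ennreal_ofReal hgc.measurable.ennreal_ofReal
        (fun x => ?_) hlφ (hlim g ⟨hgc, hBc.of_isClosed_subset isClosed_closure
          (hgB.trans subset_closure), hgB.trans (subset_closure.trans hBΩ)⟩ hg0)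
        hA1.ne hA2.le hsmall
  · rw [setIntegral_congr_fun (g := fun x => |(e ε x).toReal - (ν.rnDeriv μ x).toReal|)
      hB.measurableSet fun x hx => ?_]
    · refine (Real.le_norm_self _).trans ((norm_integral_le_lintegral_norm _).trans ?_)
      simp only [Real.norm_eq_abs, abs_abs]
      refine ENNReal.toReal_le_of_le_ofReal hδ.le (key.trans_eq ?_)
      rw [← mul_assoc, hη, ← ENNReal.ofReal_ofNat 2, ← ENNReal.ofReal_mul (by norm_num),
        ← ENNReal.ofReal_mul (by norm_num)]
      congr 1
      ring
    · simp only []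
      rw [ksDensity_eq_toReal n hp μ hud hε]
      · rfl
      · exact ((ball_subset_ball hεR.le).trans (ball_subset_thickening (subset_closure hx) R)).trans
          ((thickening_subset_cthickening _ _).trans (hRN.trans (interior_subset.trans hNΩ)))
  · rw [← lintegral_indicator hB.measurableSet]
    refine lintegral_mono fun z => indicator_apply_le' (fun hz => ?_) fun _ => zero_le
    simp [φ, hφ₀B z hz]
  · by_cases hx : x ∈ B
    · simpa [φ, hφ₀B x hx] using hg1 x
    · simp [image_eq_zero_of_notMem_tsupport fun h => hx (hgB h)]

/-- Lemma 4.3. `Ω` a bounded domain of an `n`-dimensional Alexandrov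
space with curvature `≥ k`, `p > 1`, `Y` complete, `u ∈ W^{1,p}(Ω,Y)`. For every
sufficiently small `δ` (i.e. `δ < δ_{n,k}`) and every open `B ⊂⊂ Ω^δ` there is
`ε̄ = ε̄(δ,B)` with `∫_B |e^u_{p,ε} - |∇u|_p| dvol ≤ κ̄(δ)` for all `0 < ε < ε̄`, where
`κ̄(δ) > 0` depends only on `δ` and `κ̄(δ) → 0` as `δ → 0`. -/
theorem statement_8 (n : ℕ) (k : ℝ) (p : ℝ) (hp : 1 < p)
    {M : Type*} [MetricSpace M] [MeasurableSpace M] [BorelSpace M]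
    (hM : AlexandrovSpace M n k)
    {Y : Type*} [MetricSpace Y] (hYc : CompleteSpace Y)
    (Ω : Set M) (hΩo : IsOpen Ω) (hΩc : IsConnected Ω) (hΩb : Bornology.IsBounded Ω)
    (u : M → Y) (hu : MemKS n p (μH[(n : ℝ)]) Ω u)
    (ν : Measure M) (hν : IsEnergyMeasure n p (μH[(n : ℝ)]) Ω u ν) :
    ∃ δnk : ℝ, 0 < δnk ∧
    ∃ κ : ℝ → ℝ,
      (∀ δ : ℝ, 0 < δ → 0 < κ δ) ∧ Tendsto κ (𝓝[>] (0 : ℝ)) (𝓝 0) ∧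
      ∀ δ : ℝ, 0 < δ → δ < δnk →
        ∀ B : Set M, IsOpen B → CptIn B (Ω ∩ Mdelta (μH[(n : ℝ)]) n δ) →
          ∃ εbar : ℝ, 0 < εbar ∧ ∀ ε : ℝ, 0 < ε → ε < εbar →
            ∫ x in B,
                |ksDensity n p (μH[(n : ℝ)]) Ω u ε x - ksDens (μH[(n : ℝ)]) ν x|
                ∂(μH[(n : ℝ)]) ≤ κ δ := by
  refine ⟨1, one_pos, id, fun δ hδ => hδ, tendsto_id.mono_left nhdsWithin_le_nhds,
    fun δ hδ _ B hB hBΩ => ?_⟩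
  exact hM.exists_integral_abs_sub_le hp hΩo hu hν hB ⟨hBΩ.1, hBΩ.2.trans inter_subset_left⟩ hδ

end Paper
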